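/- Let N ≥ 3, m > 1, γ ∈ [0,2), 0 < k ≤ K, T > 0, and let ρ satisfy the weight condition. Let W₁, W₂ : ℝᴺ → (0,∞) be measurable functions in X_∞ ∩ L¹_loc(ℝᴺ, ρ dx) with W₁ ≤ W₂ a.e., each solving Δ(Wᵢᵐ) = ρ Wᵢ / (T(m−1)) in the distributional sense (∫ Wᵢᵐ Δφ dx = (1/(T(m−1))) ∫ ρ Wᵢ φ dx for all φ ∈ C_c^∞(ℝᴺ)). Let u₀ be measurable with W₁ ≤ u₀ ≤ W₂ a.e. Then there exists a very weak solution u of ρ u_t = Δ(uᵐ) on ℝᴺ × (0,T) with initial datum u₀ such that (1 − t/T)^{−1/(m−1)} W₁(x) ≤ u(x,t) ≤ (1 − t/T)^{−1/(m−1)} W₂(x) for a.e. (x,t) ∈ ℝᴺ × (0,T); consequently u blows up pointwise at t = T, i.e. ess lim_{t→T⁻} u(x,t) = +∞ for a.e. x ∈ ℝᴺ. -/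

import Mathlib

open MeasureTheory Metric Filter Set ENNReal

noncomputable section

abbrev Euc (N : ℕ) := EuclideanSpace ℝ (Fin N)

/-- The weight condition: `k (1+|x|)^(-γ) ≤ ρ(x) ≤ K |x|^(-γ)` for a.e. `x`. -/
def WeightCond (N : ℕ) (γ k K : ℝ) (ρ : Euc N → ℝ) : Prop :=
  Measurable ρ ∧
    ∀ᵐ x : Euc N ∂volume, k * (1 + ‖x‖) ^ (-γ) ≤ ρ x ∧ ρ x ≤ K * ‖x‖ ^ (-γ)

/-- Local integrability with respect to the weight `ρ`. -/
def LocInt1 {N : ℕ} (ρ f : Euc N → ℝ) : Prop :=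
  ∀ R : ℝ, 0 < R → IntegrableOn (fun x => |f x| * ρ x) (ball (0 : Euc N) R)

/-- The weighted norm `‖f‖_{1,r}`. -/
def wnorm1 {N : ℕ} (ρ : Euc N → ℝ) (m γ : ℝ) (r : ℝ) (f : Euc N → ℝ) : ℝ :=
  sSup ((fun R : ℝ =>
    R ^ (-((2 - γ) / (m - 1)) - (N : ℝ) + γ) * ∫ x in ball (0 : Euc N) R, |f x| * ρ x) '' Ici r)

/-- Membership in the space `X`. -/
def memX {N : ℕ} (ρ : Euc N → ℝ) (m γ : ℝ) (f : Euc N → ℝ) : Prop :=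
  LocInt1 ρ f ∧
    BddAbove ((fun R : ℝ =>
      R ^ (-((2 - γ) / (m - 1)) - (N : ℝ) + γ) * ∫ x in ball (0 : Euc N) R, |f x| * ρ x) '' Ici 1)

/-- `ℓ(f) = lim_{r→∞} ‖f‖_{1,r}`; since `r ↦ ‖f‖_{1,r}` is nonincreasing and nonnegative,
the limit equals the infimum. -/
def ell {N : ℕ} (ρ : Euc N → ℝ) (m γ : ℝ) (f : Euc N → ℝ) : ℝ :=
  sInf ((fun r : ℝ => wnorm1 ρ m γ r f) '' Ici 1)

/-- The weighted norm `‖f‖_{∞,r}`. -/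
def wnormInf {N : ℕ} (m γ : ℝ) (r : ℝ) (f : Euc N → ℝ) : ℝ :=
  sSup ((fun R : ℝ =>
    R ^ (-((2 - γ) / (m - 1))) *
      (eLpNorm f ⊤ (volume.restrict (ball (0 : Euc N) R))).toReal) '' Ici r)

/-- Membership in the space `X_∞`. -/
def memXinf {N : ℕ} (m γ : ℝ) (f : Euc N → ℝ) : Prop :=
  AEStronglyMeasurable f volume ∧
  (∀ R : ℝ, 0 < R → eLpNorm f ⊤ (volume.restrict (ball (0 : Euc N) R)) < ⊤) ∧
  BddAbove ((fun R : ℝ =>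
    R ^ (-((2 - γ) / (m - 1))) *
      (eLpNorm f ⊤ (volume.restrict (ball (0 : Euc N) R))).toReal) '' Ici 1)

/-- Signed power `u^m := |u|^(m-1) u`. -/
def spow (m s : ℝ) : ℝ := |s| ^ (m - 1) * s

/-- The Laplacian of `φ : ℝᴺ → ℝ`, as a sum of second directional derivatives along the
standard orthonormal basis. -/
def lap {N : ℕ} (φ : Euc N → ℝ) (x : Euc N) : ℝ :=
  ∑ i : Fin N, fderiv ℝ (fun y => fderiv ℝ φ y (EuclideanSpace.single i (1 : ℝ))) x
    (EuclideanSpace.single i (1 : ℝ))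

/-- The open time interval `(0,T)`, for `T ∈ (0,∞]`. -/
def TimeSet (T : ℝ≥0∞) : Set ℝ := {t : ℝ | 0 < t ∧ ENNReal.ofReal t < T}

/-- The time interval `[0,T)`, for `T ∈ (0,∞]`. -/
def TimeSet0 (T : ℝ≥0∞) : Set ℝ := {t : ℝ | 0 ≤ t ∧ ENNReal.ofReal t < T}

/-- Very weak solution of `ρ u_t = Δ(u^m)` on `ℝᴺ × (0,T)` with initial datum `u₀`. -/
def IsVeryWeakSol {N : ℕ} (ρ : Euc N → ℝ) (m : ℝ) (T : ℝ≥0∞)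
    (u : Euc N → ℝ → ℝ) (u₀ : Euc N → ℝ) : Prop :=
  (∀ t ∈ TimeSet0 T, LocInt1 ρ (fun x => u x t)) ∧
  (∀ s ∈ TimeSet0 T, ∀ R : ℝ, 0 < R →
    Tendsto (fun t => ∫ x in ball (0 : Euc N) R, |u x t - u x s| * ρ x)
      (nhdsWithin s (TimeSet0 T)) (nhds 0)) ∧
  (∀ᵐ x : Euc N ∂volume, u x 0 = u₀ x) ∧
  (∀ R : ℝ, 0 < R → ∀ a b : ℝ, 0 < a → a ≤ b → ENNReal.ofReal b < T →
    IntegrableOn (fun p : Euc N × ℝ => spow m (u p.1 p.2)) (ball (0 : Euc N) R ×ˢ Icc a b)) ∧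
  (∀ φ : Euc N × ℝ → ℝ, ContDiff ℝ (⊤ : ℕ∞) φ → HasCompactSupport φ →
    tsupport φ ⊆ {p : Euc N × ℝ | p.2 ∈ TimeSet T} →
    -(∫ p : Euc N × ℝ in (univ : Set (Euc N)) ×ˢ TimeSet T,
        u p.1 p.2 * deriv (fun s => φ (p.1, s)) p.2 * ρ p.1) =
      ∫ p : Euc N × ℝ in (univ : Set (Euc N)) ×ˢ TimeSet T,
        spow m (u p.1 p.2) * lap (fun y => φ (y, p.2)) p.1)

/-- The existence time `T = C / L^(m-1)` if `L > 0`, and `T = ∞` if `L = 0` (here `L = ℓ(u₀)` or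
`L = ‖u₀‖_{1,r}`). -/
def Tof (C m L : ℝ) : ℝ≥0∞ := if 0 < L then ENNReal.ofReal (C / L ^ (m - 1)) else ⊤

end


section
open MeasureTheory Metric Filter Set ENNReal
open scoped Topology ContDiff

noncomputable section

namespace Blow

variable {N : ℕ}

/-- Test functions. -/
def TF (φ : Euc N → ℝ) : Prop := ContDiff ℝ (⊤ : ℕ∞) φ ∧ HasCompactSupport φ

/-- partial derivative -/
def pd (i : Fin N) (φ : Euc N → ℝ) (x : Euc N) : ℝ := fderiv ℝ φ x (EuclideanSpace.single i (1 : ℝ))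

lemma lap_eq (φ : Euc N → ℝ) (x : Euc N) : lap φ x = ∑ i, pd i (pd i φ) x := rfl

lemma pd_contDiff {i : Fin N} {φ : Euc N → ℝ} {n k : WithTop ℕ∞} (h : ContDiff ℝ n φ)
    (hk : k + 1 ≤ n) : ContDiff ℝ k (pd i φ) := by
  have : ContDiff ℝ k (fun x => fderiv ℝ φ x) := h.fderiv_right hk
  exact this.clm_apply contDiff_const

lemma pd_support {i : Fin N} {φ : Euc N → ℝ} (h : HasCompactSupport φ) :
    HasCompactSupport (pd i φ) := by
  exact h.fderiv_apply (𝕜 := ℝ) (EuclideanSpace.single i (1 : ℝ))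

lemma TF.c2 {φ : Euc N → ℝ} (h : TF φ) : ContDiff ℝ 2 φ := h.1.of_le (WithTop.coe_le_coe.2 le_top)

lemma TF.cont {φ : Euc N → ℝ} (h : TF φ) : Continuous φ := h.1.continuous

lemma TF.pd {i : Fin N} {φ : Euc N → ℝ} (h : TF φ) : TF (pd i φ) :=
  ⟨pd_contDiff h.1 (by exact_mod_cast le_top), pd_support h.2⟩

lemma lap_continuous {φ : Euc N → ℝ} (h : ContDiff ℝ 2 φ) : Continuous (lap φ) := by
  show Continuous (fun x => ∑ i, Blow.pd i (Blow.pd i φ) x)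
  refine continuous_finsetSum _ fun i _ => ?_
  have h1 : ContDiff ℝ 1 (Blow.pd i φ) := pd_contDiff h (by norm_num)
  exact (pd_contDiff (k := 0) h1 (by norm_num)).continuous

lemma lap_support {φ : Euc N → ℝ} (h : HasCompactSupport φ) : HasCompactSupport (lap φ) := by
  apply HasCompactSupport.of_support_subset_isCompact h
  intro x hx
  by_contra hx'
  apply hx
  rw [lap_eq]
  refine Finset.sum_eq_zero fun i _ => ?_
  have h1 : φ =ᶠ[𝓝 x] 0 := notMem_tsupport_iff_eventuallyEq.1 hx'
  have h2 : Blow.pd i φ =ᶠ[𝓝 x] 0 := by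
    filter_upwards [h1.eventuallyEq_nhds] with y hy
    simp [Blow.pd, hy.fderiv_eq]
  simp [Blow.pd, h2.fderiv_eq]

lemma pd_add {i : Fin N} {φ ψ : Euc N → ℝ} (h : ContDiff ℝ 1 φ) (h' : ContDiff ℝ 1 ψ) :
    pd i (fun x => φ x + ψ x) = fun x => pd i φ x + pd i ψ x := by
  funext x
  simp only [Blow.pd]
  rw [fderiv_fun_add (h.differentiable (by norm_num) x) (h'.differentiable (by norm_num) x)]
  rfl

lemma pd_smul {i : Fin N} {φ : Euc N → ℝ} (c : ℝ) (h : ContDiff ℝ 1 φ) :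
    pd i (fun x => c * φ x) = fun x => c * pd i φ x := by
  funext x
  simp only [Blow.pd]
  rw [fderiv_const_mul (h.differentiable (by norm_num) x)]
  rfl

lemma lap_add {φ ψ : Euc N → ℝ} (h : ContDiff ℝ 2 φ) (h' : ContDiff ℝ 2 ψ) (x : Euc N) :
    lap (fun x => φ x + ψ x) x = lap φ x + lap ψ x := by
  simp only [lap_eq]
  rw [← Finset.sum_add_distrib]
  refine Finset.sum_congr rfl fun i _ => ?_
  rw [pd_add (h.of_le (by norm_num)) (h'.of_le (by norm_num)),
    pd_add (pd_contDiff h (by norm_num)) (pd_contDiff h' (by norm_num))]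

lemma lap_smul {φ : Euc N → ℝ} (c : ℝ) (h : ContDiff ℝ 2 φ) (x : Euc N) :
    lap (fun x => c * φ x) x = c * lap φ x := by
  simp only [lap_eq]
  rw [Finset.mul_sum]
  refine Finset.sum_congr rfl fun i _ => ?_
  rw [pd_smul c (h.of_le (by norm_num)), pd_smul c (pd_contDiff h (by norm_num))]

lemma TF.add {φ ψ : Euc N → ℝ} (h : TF φ) (h' : TF ψ) : TF (fun x => φ x + ψ x) :=
  ⟨h.1.add h'.1, h.2.add h'.2⟩

lemma TF.smul {φ : Euc N → ℝ} (c : ℝ) (h : TF φ) : TF (fun x => c * φ x) :=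
  ⟨contDiff_const.mul h.1, h.2.mul_left⟩

lemma int_mul {u χ : Euc N → ℝ} (hu : Continuous u) (hχ : Continuous χ)
    (hc : HasCompactSupport χ) : Integrable (fun x => u x * χ x) :=
  (hu.mul hχ).integrable_of_hasCompactSupport hc.mul_left

/-- one integration by parts -/
lemma ibp {i : Fin N} {u χ : Euc N → ℝ} (hu : ContDiff ℝ 1 u) (hχ : ContDiff ℝ 1 χ)
    (hc : HasCompactSupport χ) : ∫ x, u x * pd i χ x = - ∫ x, pd i u x * χ x := by
  have h0 : Continuous (Blow.pd i u) := (pd_contDiff (k := 0) hu (by norm_num)).continuous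
  have h1 : Continuous (Blow.pd i χ) := (pd_contDiff (k := 0) hχ (by norm_num)).continuous
  refine integral_mul_fderiv_eq_neg_fderiv_mul_of_integrable ?_ ?_ ?_ ?_ ?_
  · exact int_mul h0 hχ.continuous hc
  · exact int_mul hu.continuous h1 (pd_support hc)
  · exact int_mul hu.continuous hχ.continuous hc
  · exact fun x _ => hu.differentiable (by norm_num) x
  · exact fun x _ => hχ.differentiable (by norm_num) x

lemma green1 {u χ : Euc N → ℝ} (hu : ContDiff ℝ 1 u) (hχ : ContDiff ℝ 2 χ)
    (hc : HasCompactSupport χ) : ∫ x, u x * lap χ x = - ∑ i, ∫ x, pd i u x * pd i χ x := by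
  simp only [lap_eq, Finset.mul_sum]
  have h1 : ∀ i, ContDiff ℝ 1 (Blow.pd i χ) := fun i => pd_contDiff hχ (by norm_num)
  rw [integral_finsetSum, ← Finset.sum_neg_distrib]
  · refine Finset.sum_congr rfl fun i _ => ?_
    exact ibp hu (h1 i) (pd_support hc)
  · intro i _
    exact int_mul hu.continuous (pd_contDiff (k := 0) (h1 i) (by norm_num)).continuous
      (pd_support (pd_support hc))

/-- Green's identity -/
lemma green {u χ : Euc N → ℝ} (hu : ContDiff ℝ 2 u) (hχ : ContDiff ℝ 2 χ)
    (hc : HasCompactSupport χ) : ∫ x, u x * lap χ x = ∫ x, lap u x * χ x := by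
  rw [green1 (hu.of_le (by norm_num)) hχ hc]
  simp only [lap_eq, Finset.sum_mul]
  have h1 : ∀ i, ContDiff ℝ 1 (Blow.pd i u) := fun i => pd_contDiff hu (by norm_num)
  rw [integral_finsetSum, ← Finset.sum_neg_distrib]
  · refine Finset.sum_congr rfl fun i _ => ?_
    rw [ibp (h1 i) (hχ.of_le (by norm_num)) hc, neg_neg]
  · intro i _
    exact int_mul (pd_contDiff (k := 0) (h1 i) (by norm_num)).continuous hχ.continuous hc

lemma green_nonneg {φ : Euc N → ℝ} (h : TF φ) : ∫ x, φ x * lap φ x ≤ 0 := by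
  rw [green1 (h.c2.of_le (by norm_num)) h.c2 h.2]
  simp only [Left.neg_nonpos_iff]
  exact Finset.sum_nonneg fun i _ => integral_nonneg fun x => mul_self_nonneg _

/-- chain rule for one-variable composition -/
lemma lap_comp {j j' j'' : ℝ → ℝ} {G : Euc N → ℝ} (hG : ContDiff ℝ 2 G)
    (h1 : ∀ x, HasDerivAt j (j' (G x)) (G x)) (h2 : ∀ x, HasDerivAt j' (j'' (G x)) (G x)) (x : Euc N) :
    lap (fun y => j (G y)) x = j'' (G x) * ∑ i, pd i G x ^ 2 + j' (G x) * lap G x := by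
  simp only [lap_eq, Finset.mul_sum]
  rw [← Finset.sum_add_distrib]
  refine Finset.sum_congr rfl fun i _ => ?_
  have hd : Differentiable ℝ G := hG.differentiable (by norm_num)
  have e1 : Blow.pd i (fun y => j (G y)) = fun y => j' (G y) * Blow.pd i G y := by
    funext y
    have := ((h1 y).comp_hasFDerivAt y (hd y).hasFDerivAt).fderiv
    simp only [Blow.pd]
    rw [show (fun y => j (G y)) = j ∘ G from rfl, this]
    simp
  rw [e1]
  have hd2 : DifferentiableAt ℝ (Blow.pd i G) x :=
    (pd_contDiff (k := 1) hG (by norm_num)).differentiable (by norm_num) x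
  have := (((h2 x).comp_hasFDerivAt x (hd x).hasFDerivAt).mul hd2.hasFDerivAt).fderiv
  simp only [Function.comp_def, Pi.mul_def] at this
  have e2 : Blow.pd i (fun y => j' (G y) * Blow.pd i G y) x =
    fderiv ℝ (fun y => j' (G y) * Blow.pd i G y) x (EuclideanSpace.single i (1 : ℝ)) := rfl
  rw [e2, this]
  simp [Blow.pd]
  ring

lemma lap_sigma (x : Euc N) : lap (fun y : Euc N => 1 + ‖y‖ ^ 2) x = 2 * N ∧
    ∑ i, pd i (fun y : Euc N => 1 + ‖y‖ ^ 2) x ^ 2 = 4 * ‖x‖ ^ 2 := by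
  have e : ∀ i : Fin N, Blow.pd i (fun y : Euc N => 1 + ‖y‖ ^ 2) = fun y => 2 * y i := by
    intro i
    funext y
    simp only [Blow.pd]
    rw [fderiv_const_add]
    have := (hasStrictFDerivAt_norm_sq y).hasFDerivAt.fderiv
    rw [this]
    simp [EuclideanSpace.inner_single_right]
  constructor
  · simp only [lap_eq, e]
    have : ∀ i : Fin N, Blow.pd i (fun y : Euc N => 2 * y i) x = 2 := by
      intro i
      simp only [Blow.pd]
      have : HasFDerivAt (fun y : Euc N => 2 * y i) ((2:ℝ) • (EuclideanSpace.proj i : Euc N →L[ℝ] ℝ)) x :=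
        ((EuclideanSpace.proj i : Euc N →L[ℝ] ℝ).hasFDerivAt).const_mul 2
      rw [this.fderiv]
      simp
    simp [this]
    ring
  · simp only [e]
    rw [EuclideanSpace.norm_sq_eq, Finset.mul_sum]
    refine Finset.sum_congr rfl fun i _ => ?_
    simp only [Real.norm_eq_abs, sq_abs]
    ring

lemma sigma_contDiff {n : WithTop ℕ∞} : ContDiff ℝ n (fun y : Euc N => 1 + ‖y‖ ^ 2) :=
  contDiff_const.add (contDiff_norm_sq ℝ)

lemma lap_radial {j j' j'' : ℝ → ℝ}
    (h1 : ∀ s, 0 < s → HasDerivAt j (j' s) s) (h2 : ∀ s, 0 < s → HasDerivAt j' (j'' s) s) (x : Euc N) :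
    lap (fun y : Euc N => j (1 + ‖y‖ ^ 2)) x
      = 4 * ‖x‖ ^ 2 * j'' (1 + ‖x‖ ^ 2) + 2 * N * j' (1 + ‖x‖ ^ 2) := by
  rw [lap_comp (j := j) (j' := j') (j'' := j'') sigma_contDiff (fun x => h1 _ (by positivity))
    (fun x => h2 _ (by positivity)), (lap_sigma x).1, (lap_sigma x).2]
  ring

end Blow

end

end

section
open MeasureTheory Metric Filter Set ENNReal
open scoped Topology ContDiff Convolution

noncomputable section

namespace Blow

variable {N : ℕ}

def bump (N : ℕ) (n : ℕ) : ContDiffBump (0 : Euc N) :=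
  ⟨1 / (n + 1 : ℝ), 2 / (n + 1 : ℝ), by positivity, by gcongr; norm_num⟩

def ker (N : ℕ) (n : ℕ) : Euc N → ℝ := (bump N n).normed volume

def moll (n : ℕ) (g : Euc N → ℝ) : Euc N → ℝ :=
  ker N n ⋆[ContinuousLinearMap.lsmul ℝ ℝ, volume] g

lemma ker_TF (n : ℕ) : TF (ker N n) :=
  ⟨(bump N n).contDiff_normed, (bump N n).hasCompactSupport_normed⟩

lemma rOut_tendsto : Tendsto (fun n => (bump N n).rOut) atTop (𝓝 0) := by
  show Tendsto (fun n : ℕ => 2 / (n + 1 : ℝ)) atTop (𝓝 0)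
  have := (tendsto_one_div_add_atTop_nhds_zero_nat (𝕜 := ℝ)).const_mul 2
  simpa [div_eq_mul_inv] using this

lemma moll_ae {g : Euc N → ℝ} (hg : LocallyIntegrable g) :
    ∀ᵐ x, Tendsto (fun n => moll n g x) atTop (𝓝 (g x)) := by
  refine ContDiffBump.ae_convolution_tendsto_right_of_locallyIntegrable (K := 2) rOut_tendsto ?_ hg
  filter_upwards with n
  show 2 / (n + 1 : ℝ) ≤ 2 * (1 / (n + 1 : ℝ))
  rw [mul_one_div]

lemma moll_contDiff {g : Euc N → ℝ} (hg : LocallyIntegrable g) (n : ℕ) :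
    ContDiff ℝ (⊤ : ℕ∞) (moll n g) :=
  (ker_TF n).2.contDiff_convolution_left _ (ker_TF n).1 hg

lemma pd_conv {i : Fin N} {f g : Euc N → ℝ} (hf : TF f) (hg : LocallyIntegrable g) :
    pd i (f ⋆[ContinuousLinearMap.lsmul ℝ ℝ, volume] g)
      = (pd i f) ⋆[ContinuousLinearMap.lsmul ℝ ℝ, volume] g := by
  funext x
  have h1 := (hf.2.hasFDerivAt_convolution_left (ContinuousLinearMap.lsmul ℝ ℝ)
    (hf.1.of_le (by exact_mod_cast le_top)) hg x).fderiv
  have hce : ConvolutionExistsAt (fderiv ℝ f) g x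
      ((ContinuousLinearMap.lsmul ℝ ℝ).precompL (Euc N)) volume := by
    refine (HasCompactSupport.convolutionExists_left _ (hf.2.fderiv ℝ) ?_ hg) x
    exact hf.1.continuous_fderiv (by simp)
  unfold Blow.pd
  rw [h1]
  unfold convolution
  rw [ContinuousLinearMap.integral_apply hce]
  rfl

lemma lap_conv {f g : Euc N → ℝ} (hf : TF f) (hg : LocallyIntegrable g) (x : Euc N) :
    lap (f ⋆[ContinuousLinearMap.lsmul ℝ ℝ, volume] g) x = ∫ t, lap f (x - t) * g t := by
  rw [lap_eq]
  have : ∀ i, Blow.pd i (Blow.pd i (f ⋆[ContinuousLinearMap.lsmul ℝ ℝ, volume] g)) x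
      = ∫ t, Blow.pd i (Blow.pd i f) (x - t) * g t := by
    intro i
    rw [pd_conv hf hg, pd_conv hf.pd hg, convolution_eq_swap]
    rfl
  simp only [this, lap_eq, Finset.sum_mul]
  rw [integral_finsetSum]
  intro i _
  have := (HasCompactSupport.convolutionExists_left (ContinuousLinearMap.lsmul ℝ ℝ)
    ((hf.pd (i := i)).pd (i := i)).2 ((hf.pd (i := i)).pd (i := i)).cont hg) x
  exact this.integrable_swap

lemma TF.reflect {f : Euc N → ℝ} (hf : TF f) (x : Euc N) : TF (fun t => f (x - t)) :=
  ⟨hf.1.comp (contDiff_const.sub contDiff_id),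
    hf.2.comp_homeomorph (Homeomorph.subLeft x)⟩

lemma pd_reflect {h : Euc N → ℝ} (hh : ContDiff ℝ 1 h) (i : Fin N) (x : Euc N) :
    pd i (fun t => h (x - t)) = fun t => - pd i h (x - t) := by
  funext t
  simp only [Blow.pd]
  have h1 : HasFDerivAt (fun t : Euc N => x - t) (-(ContinuousLinearMap.id ℝ (Euc N))) t :=
    (hasFDerivAt_id t).const_sub x
  have h2 := (hh.differentiable (by norm_num) (x - t)).hasFDerivAt
  have h3 := (h2.comp t h1).fderiv
  have h4 : (h ∘ fun t : Euc N => x - t) = fun t => h (x - t) := rfl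
  rw [h4] at h3
  rw [h3]
  simp

lemma lap_reflect {f : Euc N → ℝ} (hf : TF f) (x t : Euc N) :
    lap (fun t => f (x - t)) t = lap f (x - t) := by
  simp only [lap_eq]
  refine Finset.sum_congr rfl fun i _ => ?_
  rw [pd_reflect (hf.c2.of_le (by norm_num))]
  have h1 : ContDiff ℝ 1 (fun y => (-1 : ℝ) * Blow.pd i f y) :=
    ((hf.pd (i := i)).smul (-1)).c2.of_le (by norm_num)
  have : (fun t => - Blow.pd i f (x - t)) = fun t => (fun y => (-1 : ℝ) * Blow.pd i f y) (x - t) := by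
    funext t; simp
  rw [this, pd_reflect h1, pd_smul _ ((hf.pd (i := i)).c2.of_le (by norm_num))]
  simp

lemma lap_moll {g F : Euc N → ℝ} (hg : LocallyIntegrable g)
    (h : ∀ φ, TF φ → ∫ x, g x * lap φ x = ∫ x, F x * φ x) (n : ℕ) (x : Euc N) :
    lap (moll n g) x = moll n F x := by
  unfold moll
  rw [lap_conv (ker_TF n) hg, convolution_eq_swap]
  have := h _ ((ker_TF n).reflect x)
  simp only [lap_reflect (ker_TF n)] at this
  simp only [ContinuousLinearMap.lsmul_apply, smul_eq_mul]
  rw [show (∫ t, lap (ker N n) (x - t) * g t) = ∫ t, g t * lap (ker N n) (x - t) from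
    integral_congr_ae (ae_of_all _ fun t => mul_comm _ _), this]
  exact integral_congr_ae (ae_of_all _ fun t => mul_comm _ _)

lemma ker_int (n : ℕ) : Integrable (ker N n) := (bump N n).integrable_normed

lemma moll_int {g : Euc N → ℝ} (hg : Integrable g) (n : ℕ) : Integrable (moll n g) :=
  (ker_int n).integrable_convolution _ hg

lemma moll_norm {g : Euc N → ℝ} (hg : Integrable g) (n : ℕ) : ∫ x, |moll n g x| ≤ ∫ x, |g x| := by
  have h1 : ∀ x, |moll n g x| ≤ moll n (fun y => |g y|) x := by
    intro x
    unfold moll convolution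
    refine (abs_integral_le_integral_abs).trans (le_of_eq ?_)
    refine integral_congr_ae (ae_of_all _ fun t => ?_)
    simp only [ContinuousLinearMap.lsmul_apply, smul_eq_mul, abs_mul]
    rw [abs_of_nonneg (show 0 ≤ ker N n t from (bump N n).nonneg_normed t)]
  calc ∫ x, |moll n g x| ≤ ∫ x, moll n (fun y => |g y|) x :=
        integral_mono (moll_int hg n).abs (moll_int hg.abs n) h1
    _ = ∫ x, |g x| := by
        have := integral_convolution (ContinuousLinearMap.lsmul ℝ ℝ) (ker_int (N := N) n) hg.abs
        unfold moll
        rw [this]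
        have h2 : ∫ x, ker N n x = 1 := (bump N n).integral_normed
        rw [h2]; simp

lemma moll_L1 {g : Euc N → ℝ} (hg : Integrable g) :
    Tendsto (fun n => ∫ x, |moll n g x - g x|) atTop (𝓝 0) := by
  have hb : Tendsto (fun n => ∫ x, (|g x| + |moll n g x| - |moll n g x - g x|)) atTop
      (𝓝 (∫ x, (|g x| + |g x| - |g x - g x|))) := by
    refine tendsto_integral_of_dominated_convergence (fun x => 2 * |g x|) ?_ (hg.abs.const_mul 2) ?_ ?_
    · intro n
      exact ((hg.abs.add (moll_int hg n).abs).sub ((moll_int hg n).sub hg).abs).aestronglyMeasurable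
    · intro n
      refine ae_of_all _ fun x => ?_
      rw [Real.norm_eq_abs, abs_le]
      have h1 := abs_sub (moll n g x) (g x)
      have h2 : |moll n g x| ≤ |moll n g x - g x| + |g x| := by
        have := abs_add_le (moll n g x - g x) (g x)
        simpa using this
      have h3 := abs_nonneg (g x)
      constructor <;> linarith
    · filter_upwards [moll_ae hg.locallyIntegrable] with x hx
      exact (tendsto_const_nhds.add hx.abs).sub (hx.sub tendsto_const_nhds).abs
  simp only [sub_self, abs_zero, sub_zero] at hb
  have e : ∀ n, ∫ x, (|g x| + |moll n g x| - |moll n g x - g x|)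
      = (∫ x, |g x|) + (∫ x, |moll n g x|) - ∫ x, |moll n g x - g x| := by
    intro n
    have a1 : Integrable (fun x => |g x|) := hg.abs
    have a2 : Integrable (fun x => |moll n g x|) := (moll_int hg n).abs
    have a3 : Integrable (fun x => |moll n g x - g x|) := ((moll_int hg n).sub hg).abs
    have b1 := integral_sub (a1.add a2) a3
    have b2 := integral_add a1 a2
    simp only [Pi.add_apply] at b1
    rw [b1, b2]
  have e2 : ∫ x, (|g x| + |g x|) = 2 * ∫ x, |g x| := by
    rw [integral_add hg.abs hg.abs]; ring
  rw [e2] at hb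
  have hz : Tendsto (fun n => (2 * ∫ x, |g x|) - ∫ x, (|g x| + |moll n g x| - |moll n g x - g x|))
      atTop (𝓝 0) := by
    have := (tendsto_const_nhds (x := 2 * ∫ x, |g x|)).sub hb
    simpa using this
  refine squeeze_zero (fun n => integral_nonneg fun x => abs_nonneg _) (fun n => ?_) hz
  rw [e]
  have := moll_norm hg n
  linarith

lemma moll_local {g : Euc N → ℝ} {R : ℝ} {x : Euc N} (hx : x ∈ ball (0 : Euc N) R) (n : ℕ) :
    moll n g x = moll n ((ball (0 : Euc N) (R + 2)).indicator g) x := by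
  unfold moll
  simp only [convolution_eq_swap]
  refine integral_congr_ae (ae_of_all _ fun t => ?_)
  by_cases ht : t ∈ ball (0 : Euc N) (R + 2)
  · simp [ht]
  · have : ker N n (x - t) = 0 := by
      have hs : Function.support (ker N n) = ball 0 (2 / (n + 1 : ℝ)) := (bump N n).support_normed_eq
      have : x - t ∉ Function.support (ker N n) := by
        rw [hs]
        simp only [mem_ball, dist_zero_right, not_lt] at hx ht ⊢
        have h1 : 2 / (n + 1 : ℝ) ≤ 2 := by
          rw [div_le_iff₀ (by positivity)]
          have : (0 : ℝ) ≤ n := by positivity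
          linarith
        have h2 : ‖t‖ ≤ ‖x‖ + ‖x - t‖ := by
          have := norm_sub_le x (x - t)
          simpa using this
        linarith
      simpa using this
    simp [this]

lemma moll_L1loc {g : Euc N → ℝ} (hg : LocallyIntegrable g) (R : ℝ) :
    Tendsto (fun n => ∫ x in ball (0 : Euc N) R, |moll n g x - g x|) atTop (𝓝 0) := by
  have hi : Integrable ((ball (0 : Euc N) (R + 2)).indicator g) := by
    rw [integrable_indicator_iff measurableSet_ball]
    exact (hg.integrableOn_isCompact (isCompact_closedBall 0 (R + 2))).mono_set ball_subset_closedBall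
  refine squeeze_zero (fun n => integral_nonneg fun x => abs_nonneg _) (fun n => ?_) (moll_L1 hi)
  calc _ = ∫ x in ball (0 : Euc N) R, |moll n ((ball (0 : Euc N) (R + 2)).indicator g) x
        - (ball (0 : Euc N) (R + 2)).indicator g x| := by
        refine setIntegral_congr_fun measurableSet_ball fun x hx => ?_
        have : x ∈ ball (0 : Euc N) (R + 2) := ball_subset_ball (by linarith) hx
        show |moll n g x - g x| = _
        rw [moll_local hx n, indicator_of_mem this]
    _ ≤ _ := setIntegral_le_integral ((moll_int hi n).sub hi).abs (ae_of_all _ fun x => abs_nonneg _)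

/-- `∫ a_n b → ∫ a b` for L¹loc converging `a_n` and `b` bounded with support in a ball. -/
lemma ball_of_TF {χ : Euc N → ℝ} (h : HasCompactSupport χ) :
    ∃ R : ℝ, 0 < R ∧ ∀ x, x ∉ ball (0 : Euc N) R → χ x = 0 ∧ lap χ x = 0 := by
  obtain ⟨R, hR⟩ := (h.isCompact.union (lap_support h).isCompact).isBounded.subset_ball (0 : Euc N)
  refine ⟨max R 1, by positivity, fun x hx => ?_⟩
  have hx' : x ∉ tsupport χ ∪ tsupport (lap χ) := fun hc =>
    hx (ball_subset_ball (le_max_left _ _) (hR hc))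
  exact ⟨image_eq_zero_of_notMem_tsupport fun hc => hx' (Or.inl hc),
    image_eq_zero_of_notMem_tsupport fun hc => hx' (Or.inr hc)⟩

lemma TF.bdd {χ : Euc N → ℝ} (h : TF χ) : ∃ C : ℝ, 0 ≤ C ∧ ∀ x, |χ x| ≤ C ∧ |lap χ x| ≤ C := by
  obtain ⟨C1, h1⟩ := h.cont.bounded_above_of_compact_support h.2
  obtain ⟨C2, h2⟩ := (lap_continuous h.c2).bounded_above_of_compact_support (lap_support h.2)
  refine ⟨max C1 C2, ?_, fun x => ⟨(h1 x).trans (le_max_left _ _), (h2 x).trans (le_max_right _ _)⟩⟩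
  exact ((norm_nonneg _).trans (h1 0)).trans (le_max_left _ _)

lemma locInt_mul {g b : Euc N → ℝ} (hg : LocallyIntegrable g) (hb : Continuous b)
    (hc : HasCompactSupport b) : Integrable (fun x => g x * b x) := by
  have := hg.integrable_smul_left_of_hasCompactSupport hb hc
  simpa [mul_comm] using this

/-- Kato inequality, smooth convex version. -/
lemma kato_conv {g F χ : Euc N → ℝ} {j j' j'' : ℝ → ℝ} (hg : LocallyIntegrable g)
    (hF : LocallyIntegrable F) (h : ∀ φ, TF φ → ∫ x, g x * lap φ x = ∫ x, F x * φ x)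
    (hj : ContDiff ℝ 2 j) (h1 : ∀ s, HasDerivAt j (j' s) s) (h2 : ∀ s, HasDerivAt j' (j'' s) s)
    (hb : ∀ s, |j' s| ≤ 1) (hc : ∀ s, 0 ≤ j'' s) (hχ : TF χ) (hχ0 : ∀ x, 0 ≤ χ x) :
    ∫ x, j' (g x) * F x * χ x ≤ ∫ x, j (g x) * lap χ x := by
  have hlip : ∀ a b, |j a - j b| ≤ |a - b| := by
    intro a b
    have := Convex.norm_image_sub_le_of_norm_hasDerivWithin_le (f := j) (f' := j') (s := univ) (C := 1)
      (x := b) (y := a) (fun x _ => (h1 x).hasDerivWithinAt) (fun x _ => hb x) convex_univ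
      (mem_univ _) (mem_univ _)
    simpa using this
  have hj'c : Continuous j' := continuous_iff_continuousAt.2 fun s => (h2 s).continuousAt
  obtain ⟨R, hR, hsupp⟩ := ball_of_TF hχ.2
  obtain ⟨C, hC0, hC⟩ := hχ.bdd
  have hgm : AEStronglyMeasurable g volume := hg.aestronglyMeasurable
  have hFm : AEStronglyMeasurable F volume := hF.aestronglyMeasurable
  have mc := fun n => moll_contDiff hg n
  have mF := fun n => moll_contDiff hF n
  have mc2 : ∀ n, ContDiff ℝ 2 (moll n g) := fun n => (mc n).of_le (WithTop.coe_le_coe.2 le_top)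
  -- inequality for mollified
  have key : ∀ n, ∫ x, j' (moll n g x) * moll n F x * χ x ≤ ∫ x, j (moll n g x) * lap χ x := by
    intro n
    rw [green (u := fun x => j (moll n g x)) (hj.comp (mc2 n)) hχ.c2 hχ.2]
    refine integral_mono ?_ ?_ ?_
    · exact int_mul ((hj'c.comp (mc n).continuous).mul (mF n).continuous) hχ.cont hχ.2
    · exact int_mul (lap_continuous (hj.comp (mc2 n))) hχ.cont hχ.2
    · intro x
      show _ ≤ lap (fun x => j (moll n g x)) x * χ x
      rw [lap_comp (mc2 n) (fun x => h1 _) (fun x => h2 _), lap_moll hg h]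
      refine mul_le_mul_of_nonneg_right ?_ (hχ0 x)
      have : 0 ≤ j'' (moll n g x) * ∑ i, Blow.pd i (moll n g) x ^ 2 :=
        mul_nonneg (hc _) (Finset.sum_nonneg fun i _ => sq_nonneg _)
      linarith
  have iB : ∀ {f : Euc N → ℝ}, LocallyIntegrable f → IntegrableOn f (ball 0 R) := fun hf =>
    (hf.integrableOn_isCompact (isCompact_closedBall 0 R)).mono_set ball_subset_closedBall
  have toB : ∀ f : Euc N → ℝ, (∀ x, x ∉ ball (0 : Euc N) R → f x = 0) →
      ∫ x, f x = ∫ x in ball (0 : Euc N) R, f x := fun f hf =>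
    (setIntegral_eq_integral_of_forall_compl_eq_zero hf).symm
  have sub_bd : ∀ {f : Euc N → ℝ}, LocallyIntegrable f → ∀ n,
      IntegrableOn (fun x => |moll n f x - f x|) (ball 0 R) := fun hf n =>
    ((iB (moll_contDiff hf n).continuous.locallyIntegrable).sub (iB hf)).abs
  have hjg : LocallyIntegrable (fun x => j (g x)) := by
    have hb' : LocallyIntegrable (fun x => |g x| + |j 0|) :=
      LocallyIntegrable.add (fun x => (hg x).norm) (locallyIntegrable_const _)
    refine hb'.mono (hj.continuous.comp_aestronglyMeasurable hgm) (ae_of_all _ fun x => ?_)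
    have e1 := hlip (g x) 0
    rw [sub_zero] at e1
    have e2 := abs_add_le (j (g x) - j 0) (j 0)
    rw [sub_add_cancel] at e2
    rw [Real.norm_eq_abs, Real.norm_eq_abs, abs_of_nonneg (by positivity : 0 ≤ |g x| + |j 0|)]
    linarith
  have hjF : LocallyIntegrable (fun x => j' (g x) * F x) := by
    refine hF.mono ((hj'c.comp_aestronglyMeasurable hgm).mul hFm) (ae_of_all _ fun x => ?_)
    rw [Real.norm_eq_abs, Real.norm_eq_abs, abs_mul]
    exact mul_le_of_le_one_left (abs_nonneg _) (hb _)
  have hlapc := lap_continuous hχ.c2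
  have lim1 : Tendsto (fun n => ∫ x, j (moll n g x) * lap χ x) atTop (𝓝 (∫ x, j (g x) * lap χ x)) := by
    rw [tendsto_iff_norm_sub_tendsto_zero]
    have := (moll_L1loc hg R).const_mul C
    rw [mul_zero] at this
    refine squeeze_zero (fun n => norm_nonneg _) (fun n => ?_) this
    rw [← integral_sub (int_mul (u := fun x => j (moll n g x)) (hj.continuous.comp (mc n).continuous) hlapc (lap_support hχ.2))
      (locInt_mul hjg hlapc (lap_support hχ.2)), toB, ← integral_const_mul]
    · refine norm_integral_le_of_norm_le ((sub_bd hg n).const_mul C) (ae_of_all _ fun x => ?_)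
      rw [Real.norm_eq_abs, ← sub_mul, abs_mul, mul_comm]
      exact mul_le_mul (hC x).2 (hlip _ _) (abs_nonneg _) hC0
    · intro x hx
      simp [(hsupp x hx).2]
  have lim2 : Tendsto (fun n => ∫ x, j' (moll n g x) * moll n F x * χ x) atTop
      (𝓝 (∫ x, j' (g x) * F x * χ x)) := by
    have l2a : Tendsto (fun n => ∫ x, j' (moll n g x) * F x * χ x) atTop
      (𝓝 (∫ x, j' (g x) * F x * χ x)) := by
      refine tendsto_integral_of_dominated_convergence (fun x => |F x * χ x|) ?_
        (locInt_mul hF hχ.cont hχ.2).abs ?_ ?_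
      · intro n
        exact ((hj'c.comp (mc n).continuous).aestronglyMeasurable.mul hFm).mul
          hχ.cont.aestronglyMeasurable
      · intro n
        refine ae_of_all _ fun x => ?_
        rw [Real.norm_eq_abs, mul_assoc, abs_mul]
        exact mul_le_of_le_one_left (abs_nonneg _) (hb _)
      · filter_upwards [moll_ae hg] with x hx
        exact (((hj'c.tendsto _).comp hx).mul_const _).mul_const _
    have l2b : Tendsto (fun n => (∫ x, j' (moll n g x) * moll n F x * χ x) -
        ∫ x, j' (moll n g x) * F x * χ x) atTop (𝓝 0) := by
      rw [tendsto_zero_iff_norm_tendsto_zero]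
      have := (moll_L1loc hF R).const_mul C
      rw [mul_zero] at this
      refine squeeze_zero (fun n => norm_nonneg _) (fun n => ?_) this
      have hl : LocallyIntegrable (fun x => j' (moll n g x) * F x) := by
        refine hF.mono ((hj'c.comp (mc n).continuous).aestronglyMeasurable.mul hFm)
          (ae_of_all _ fun x => ?_)
        rw [Real.norm_eq_abs, Real.norm_eq_abs, abs_mul]
        exact mul_le_of_le_one_left (abs_nonneg _) (hb _)
      rw [← integral_sub (int_mul (u := fun x => j' (moll n g x) * moll n F x) ((hj'c.comp (mc n).continuous).mul (mF n).continuous) hχ.cont hχ.2)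
        (locInt_mul hl hχ.cont hχ.2), toB, ← integral_const_mul]
      · refine norm_integral_le_of_norm_le ((sub_bd hF n).const_mul C) (ae_of_all _ fun x => ?_)
        rw [Real.norm_eq_abs, ← sub_mul, ← mul_sub, abs_mul, mul_comm, abs_mul]
        exact mul_le_mul (hC x).1 (mul_le_of_le_one_left (abs_nonneg _) (hb _)) (by positivity) hC0
      · intro x hx
        simp [(hsupp x hx).1]
    have := l2b.add l2a
    simpa using this
  exact le_of_tendsto_of_tendsto' lim2 lim1 key

lemma sqrt_j (δ : ℝ) (hδ : 0 < δ) :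
    ContDiff ℝ 2 (fun s : ℝ => √(s ^ 2 + δ ^ 2)) ∧
    (∀ s : ℝ, HasDerivAt (fun s : ℝ => √(s ^ 2 + δ ^ 2)) (s / √(s ^ 2 + δ ^ 2)) s) ∧
    (∀ s : ℝ, HasDerivAt (fun s : ℝ => s / √(s ^ 2 + δ ^ 2)) (δ ^ 2 / √(s ^ 2 + δ ^ 2) ^ 3) s) ∧
    (∀ s : ℝ, |s / √(s ^ 2 + δ ^ 2)| ≤ 1) ∧ ∀ s : ℝ, 0 ≤ δ ^ 2 / √(s ^ 2 + δ ^ 2) ^ 3 := by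
  have hp : ∀ s : ℝ, 0 < s ^ 2 + δ ^ 2 := fun s => by positivity
  have hd : ∀ s : ℝ, HasDerivAt (fun s : ℝ => √(s ^ 2 + δ ^ 2)) (s / √(s ^ 2 + δ ^ 2)) s := by
    intro s
    have h1 : HasDerivAt (fun s : ℝ => s ^ 2 + δ ^ 2) (2 * s) s := by
      simpa using (hasDerivAt_pow 2 s).add_const (δ ^ 2)
    have := h1.sqrt (hp s).ne'
    convert this using 1
    rw [mul_div_mul_left _ _ two_ne_zero]
  refine ⟨?_, hd, ?_, ?_, ?_⟩
  · exact ContDiff.sqrt (by fun_prop) fun s => (hp s).ne'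
  · intro s
    have hs : 0 < √(s ^ 2 + δ ^ 2) := Real.sqrt_pos.2 (hp s)
    have := (hasDerivAt_id s).div (hd s) hs.ne'
    refine this.congr_deriv ?_
    have h2 : √(s ^ 2 + δ ^ 2) ^ 2 = s ^ 2 + δ ^ 2 := Real.sq_sqrt (hp s).le
    simp only [id]
    field_simp
    rw [h2]; ring
  · intro s
    have hs : 0 < √(s ^ 2 + δ ^ 2) := Real.sqrt_pos.2 (hp s)
    rw [abs_div, abs_of_pos hs, div_le_one hs]
    exact Real.abs_le_sqrt (by nlinarith [sq_nonneg δ])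
  · intro s; positivity

lemma kato_abs {g F χ : Euc N → ℝ} (hg : LocallyIntegrable g)
    (hF : LocallyIntegrable F) (h : ∀ φ, TF φ → ∫ x, g x * lap φ x = ∫ x, F x * φ x)
    (hχ : TF χ) (hχ0 : ∀ x, 0 ≤ χ x) :
    ∫ x, Real.sign (g x) * F x * χ x ≤ ∫ x, |g x| * lap χ x := by
  have hgm : AEStronglyMeasurable g volume := hg.aestronglyMeasurable
  have hFm : AEStronglyMeasurable F volume := hF.aestronglyMeasurable
  have hlapc := lap_continuous hχ.c2
  let d : ℕ → ℝ := fun n => 1 / (n + 1 : ℝ)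
  have hd0 : ∀ n, 0 < d n := fun n => by positivity
  have hd1 : ∀ n, d n ≤ 1 := fun n => by
    show 1 / (n + 1 : ℝ) ≤ 1
    rw [div_le_one (by positivity)]
    have : (0 : ℝ) ≤ n := by positivity
    linarith
  have hdl : Tendsto d atTop (𝓝 0) := tendsto_one_div_add_atTop_nhds_zero_nat
  have key := fun n => by
    obtain ⟨a1, a2, a3, a4, a5⟩ := sqrt_j (d n) (hd0 n)
    exact kato_conv hg hF h a1 a2 a3 a4 a5 hχ hχ0
  have hsq : ∀ s : ℝ, Tendsto (fun n => √(s ^ 2 + d n ^ 2)) atTop (𝓝 |s|) := by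
    intro s
    have : Tendsto (fun n => s ^ 2 + d n ^ 2) atTop (𝓝 (s ^ 2)) := by
      simpa using tendsto_const_nhds.add (hdl.pow 2)
    have := (Real.continuous_sqrt.tendsto _).comp this
    rwa [Real.sqrt_sq_eq_abs] at this
  have L1 : Tendsto (fun n => ∫ x, g x / √(g x ^ 2 + d n ^ 2) * F x * χ x) atTop
      (𝓝 (∫ x, Real.sign (g x) * F x * χ x)) := by
    refine tendsto_integral_of_dominated_convergence (fun x => |F x * χ x|) ?_
        (locInt_mul hF hχ.cont hχ.2).abs ?_ ?_
    · intro n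
      refine AEStronglyMeasurable.mul (AEStronglyMeasurable.mul ?_ hFm) hχ.cont.aestronglyMeasurable
      exact (continuous_iff_continuousAt.2 fun s =>
        ((sqrt_j (d n) (hd0 n)).2.2.1 s).continuousAt).comp_aestronglyMeasurable hgm
    · intro n
      refine ae_of_all _ fun x => ?_
      rw [Real.norm_eq_abs, mul_assoc, abs_mul]
      exact mul_le_of_le_one_left (abs_nonneg _) ((sqrt_j (d n) (hd0 n)).2.2.2.1 _)
    · refine ae_of_all _ fun x => ?_
      refine Tendsto.mul_const _ (Tendsto.mul_const _ ?_)
      rcases lt_trichotomy (g x) 0 with h0 | h0 | h0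
      · have := (tendsto_const_nhds (x := g x)).div (hsq (g x)) (abs_pos.2 h0.ne).ne'
        rw [abs_of_neg h0, div_neg, div_self h0.ne] at this
        rw [Real.sign_of_neg h0]
        exact this
      · simp [h0]
      · have := (tendsto_const_nhds (x := g x)).div (hsq (g x)) (abs_pos.2 h0.ne').ne'
        rw [abs_of_pos h0, div_self h0.ne'] at this
        rw [Real.sign_of_pos h0]
        exact this
  have L2 : Tendsto (fun n => ∫ x, √(g x ^ 2 + d n ^ 2) * lap χ x) atTop
      (𝓝 (∫ x, |g x| * lap χ x)) := by
    have hb' : LocallyIntegrable (fun x => |g x| + 1) :=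
      LocallyIntegrable.add (fun x => (hg x).norm) (locallyIntegrable_const _)
    refine tendsto_integral_of_dominated_convergence (fun x => |(|g x| + 1) * lap χ x|) ?_
        (locInt_mul hb' hlapc (lap_support hχ.2)).abs ?_ ?_
    · intro n
      refine AEStronglyMeasurable.mul ?_ hlapc.aestronglyMeasurable
      exact (sqrt_j (d n) (hd0 n)).1.continuous.comp_aestronglyMeasurable hgm
    · intro n
      refine ae_of_all _ fun x => ?_
      rw [Real.norm_eq_abs, abs_mul, abs_mul]
      refine mul_le_mul_of_nonneg_right ?_ (abs_nonneg _)
      rw [abs_of_nonneg (Real.sqrt_nonneg _), abs_of_nonneg (by positivity)]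
      refine Real.sqrt_le_iff.2 ⟨by positivity, ?_⟩
      have := hd0 n
      have := hd1 n
      nlinarith [abs_nonneg (g x), sq_abs (g x)]
    · refine ae_of_all _ fun x => (hsq _).mul_const _
  exact le_of_tendsto_of_tendsto' L1 L2 key

/-- positive sign with value 1/2 at 0 -/
def sp (s : ℝ) : ℝ := (1 + Real.sign s) / 2

lemma meas_sign : Measurable Real.sign := by
  have : Real.sign = fun r : ℝ => if r < 0 then (-1 : ℝ) else if 0 < r then 1 else 0 := by
    funext r; rfl
  rw [this]
  exact Measurable.ite measurableSet_Iio measurable_const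
    (Measurable.ite measurableSet_Ioi measurable_const measurable_const)

lemma abs_sign_le (s : ℝ) : |Real.sign s| ≤ 1 := by
  rcases Real.sign_apply_eq s with h | h | h <;> simp [h]

lemma meas_sp : Measurable sp := (measurable_const.add meas_sign).div_const 2

lemma sp_nonneg (s : ℝ) : 0 ≤ sp s := by
  unfold sp; have := (abs_le.1 (abs_sign_le s)).1; linarith

lemma sp_le (s : ℝ) : sp s ≤ 1 := by
  unfold sp; have := (abs_le.1 (abs_sign_le s)).2; linarith

lemma sp_neg {s : ℝ} (h : s < 0) : sp s = 0 := by simp [sp, Real.sign_of_neg h]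

lemma sp_pos {s : ℝ} (h : 0 < s) : sp s = 1 := by simp [sp, Real.sign_of_pos h]

lemma sp_zero : sp 0 = 1 / 2 := by simp [sp]

lemma kato_pos {g F χ : Euc N → ℝ} (hg : LocallyIntegrable g)
    (hF : LocallyIntegrable F) (h : ∀ φ, TF φ → ∫ x, g x * lap φ x = ∫ x, F x * φ x)
    (hχ : TF χ) (hχ0 : ∀ x, 0 ≤ χ x) :
    ∫ x, sp (g x) * F x * χ x ≤ ∫ x, max (g x) 0 * lap χ x := by
  have k := kato_abs hg hF h hχ hχ0
  have e := h χ hχ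
  have hlapc := lap_continuous hχ.c2
  have i1 := locInt_mul hF hχ.cont hχ.2
  have i2 : Integrable (fun x => Real.sign (g x) * F x * χ x) := by
    refine i1.mono (((meas_sign.comp_aemeasurable hg.aestronglyMeasurable.aemeasurable).aestronglyMeasurable.mul
      hF.aestronglyMeasurable).mul hχ.cont.aestronglyMeasurable) (ae_of_all _ fun x => ?_)
    rw [Real.norm_eq_abs, Real.norm_eq_abs, mul_assoc, abs_mul]
    exact mul_le_of_le_one_left (abs_nonneg _) (abs_sign_le _)
  have i3 := locInt_mul hg hlapc (lap_support hχ.2)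
  have i4 : Integrable (fun x => |g x| * lap χ x) :=
    locInt_mul (g := fun x => |g x|) (fun x => (hg x).norm) hlapc (lap_support hχ.2)
  have e1 : ∫ x, sp (g x) * F x * χ x
      = (1 / 2) * ((∫ x, F x * χ x) + ∫ x, Real.sign (g x) * F x * χ x) := by
    rw [← integral_add i1 i2, ← integral_const_mul]
    congr 1; funext x; unfold sp; ring
  have e2 : ∫ x, max (g x) 0 * lap χ x
      = (1 / 2) * ((∫ x, g x * lap χ x) + ∫ x, |g x| * lap χ x) := by
    rw [← integral_add i3 i4, ← integral_const_mul]
    congr 1; funext x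
    rw [show max (g x) 0 = (g x + |g x|) / 2 by
      rcases le_total (g x) 0 with h | h
      · rw [max_eq_right h, abs_of_nonpos h]; ring
      · rw [max_eq_left h, abs_of_nonneg h]; ring]
    ring
  rw [e1, e2, e]
  linarith

end Blow

end

end

section
open MeasureTheory Metric Filter Set ENNReal
open scoped Topology ContDiff

noncomputable section

namespace Blow

variable {N : ℕ}

def sg (x : Euc N) : ℝ := 1 + ‖x‖ ^ 2

lemma sg_pos (x : Euc N) : 0 < sg x := by unfold sg; positivity
lemma sg_one (x : Euc N) : 1 ≤ sg x := by unfold sg; nlinarith [sq_nonneg ‖x‖]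
lemma sg_cont : Continuous (sg (N := N)) := by unfold sg; fun_prop

def theta (s : ℝ) : ℝ := Real.smoothTransition (2 - s)

lemma theta_contDiff {n : ℕ∞} : ContDiff ℝ n theta :=
  Real.smoothTransition.contDiff.comp (contDiff_const.sub contDiff_id)

lemma theta_one {s : ℝ} (h : s ≤ 1) : theta s = 1 :=
  Real.smoothTransition.one_of_one_le (by linarith)

lemma theta_zero {s : ℝ} (h : 2 ≤ s) : theta s = 0 :=
  Real.smoothTransition.zero_of_nonpos (by linarith)

lemma theta_nonneg (s : ℝ) : 0 ≤ theta s := Real.smoothTransition.nonneg _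
lemma theta_le (s : ℝ) : theta s ≤ 1 := Real.smoothTransition.le_one _

lemma theta_derivs : ∃ (t' t'' : ℝ → ℝ) (B : ℝ), 0 ≤ B ∧ (∀ s, HasDerivAt theta (t' s) s) ∧
    (∀ s, HasDerivAt t' (t'' s) s) ∧ (∀ s, |t' s| ≤ B) ∧ (∀ s, |t'' s| ≤ B) ∧
    (∀ s, s < 1 → t' s = 0 ∧ t'' s = 0) ∧ (∀ s, 2 < s → t' s = 0 ∧ t'' s = 0) := by
  have h2 : ContDiff ℝ 2 theta := by
    have := theta_contDiff (n := 2)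
    exact_mod_cast this
  have h1 : ContDiff ℝ 1 (deriv theta) := by
    have : ContDiff ℝ (1 + 1) theta := by norm_num; exact h2
    exact (contDiff_succ_iff_deriv.1 this).2.2
  have h0 : Continuous (deriv (deriv theta)) := h1.continuous_deriv (by norm_num)
  have z1 : ∀ s, s < 1 → deriv theta s = 0 := by
    intro s hs
    have : theta =ᶠ[𝓝 s] fun _ => 1 := by
      filter_upwards [Iio_mem_nhds hs] with y hy using theta_one (le_of_lt hy)
    rw [this.deriv_eq]; simp
  have z2 : ∀ s, 2 < s → deriv theta s = 0 := by
    intro s hs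
    have : theta =ᶠ[𝓝 s] fun _ => 0 := by
      filter_upwards [Ioi_mem_nhds hs] with y hy using theta_zero (le_of_lt hy)
    rw [this.deriv_eq]; simp
  have z1' : ∀ s, s < 1 → deriv (deriv theta) s = 0 := by
    intro s hs
    have : deriv theta =ᶠ[𝓝 s] fun _ => 0 := by
      filter_upwards [Iio_mem_nhds hs] with y hy using z1 _ hy
    rw [this.deriv_eq]; simp
  have z2' : ∀ s, 2 < s → deriv (deriv theta) s = 0 := by
    intro s hs
    have : deriv theta =ᶠ[𝓝 s] fun _ => 0 := by
      filter_upwards [Ioi_mem_nhds hs] with y hy using z2 _ hy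
    rw [this.deriv_eq]; simp
  obtain ⟨B1, hB1⟩ := (isCompact_Icc (a := (1:ℝ)) (b := 2)).exists_bound_of_continuousOn
    h1.continuous.continuousOn
  obtain ⟨B2, hB2⟩ := (isCompact_Icc (a := (1:ℝ)) (b := 2)).exists_bound_of_continuousOn
    h0.continuousOn
  refine ⟨deriv theta, deriv (deriv theta), max 0 (max B1 B2), le_max_left _ _, ?_, ?_, ?_, ?_,
    fun s hs => ⟨z1 s hs, z1' s hs⟩, fun s hs => ⟨z2 s hs, z2' s hs⟩⟩
  · exact fun s => (h2.differentiable (by norm_num) s).hasDerivAt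
  · exact fun s => (h1.differentiable (by norm_num) s).hasDerivAt
  · intro s
    by_cases a : s < 1
    · rw [z1 s a, abs_zero]; exact le_max_left _ _
    by_cases b : 2 < s
    · rw [z2 s b, abs_zero]; exact le_max_left _ _
    exact (hB1 s ⟨not_lt.1 a, not_lt.1 b⟩).trans ((le_max_left _ _).trans (le_max_right _ _))
  · intro s
    by_cases a : s < 1
    · rw [z1' s a, abs_zero]; exact le_max_left _ _
    by_cases b : 2 < s
    · rw [z2' s b, abs_zero]; exact le_max_left _ _
    exact (hB2 s ⟨not_lt.1 a, not_lt.1 b⟩).trans ((le_max_right _ _).trans (le_max_right _ _))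

def cut (p : ℝ) (n : ℕ) (x : Euc N) : ℝ := sg x ^ (-p) * theta (sg x / (n + 1))

/-- Laplacian of `sg ^ (-p)`. -/
def lapL (N : ℕ) (p : ℝ) (x : Euc N) : ℝ :=
  4 * ‖x‖ ^ 2 * (p * (p + 1) * sg x ^ (-p - 2)) + 2 * N * (-p * sg x ^ (-p - 1))

lemma cut_TF (p : ℝ) (n : ℕ) : TF (cut (N := N) p n) := by
  constructor
  · refine ContDiff.mul ?_ ?_
    · exact ContDiff.rpow_const_of_ne (sigma_contDiff) fun x => (sg_pos x).ne'
    · exact theta_contDiff.comp (sigma_contDiff.div_const _)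
  · refine HasCompactSupport.intro (isCompact_closedBall (0 : Euc N) (2 * (n + 1) + 1)) fun x hx => ?_
    unfold cut
    rw [theta_zero, mul_zero]
    rw [le_div_iff₀ (by positivity)]
    simp only [mem_closedBall, dist_zero_right, not_le] at hx
    have : (0 : ℝ) ≤ n := by positivity
    unfold sg; nlinarith

lemma cut_nonneg (p : ℝ) (n : ℕ) (x : Euc N) : 0 ≤ cut p n x :=
  mul_nonneg (Real.rpow_nonneg (sg_pos x).le _) (theta_nonneg _)

lemma cut_le (p : ℝ) (n : ℕ) (x : Euc N) : cut p n x ≤ sg x ^ (-p) :=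
  mul_le_of_le_one_right (Real.rpow_nonneg (sg_pos x).le _) (theta_le _)

lemma cut_tendsto (p : ℝ) (x : Euc N) : Tendsto (fun n => cut p n x) atTop (𝓝 (sg x ^ (-p))) := by
  refine tendsto_const_nhds.congr' ?_
  obtain ⟨n0, hn0⟩ := exists_nat_ge (sg x)
  filter_upwards [eventually_ge_atTop n0] with n hn
  unfold cut
  rw [theta_one, mul_one]
  rw [div_le_one (by positivity)]
  have : (n0 : ℝ) ≤ n := by exact_mod_cast hn
  linarith

lemma rpow_neg_d (p s : ℝ) (hs : 0 < s) : HasDerivAt (fun s : ℝ => s ^ (-p)) (-p * s ^ (-p - 1)) s :=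
  Real.hasDerivAt_rpow_const (Or.inl hs.ne')

lemma cut_lap (p : ℝ) (hp : 0 < p) : ∃ C : ℝ, 0 ≤ C ∧
    (∀ n (x : Euc N), |lap (cut p n) x| ≤ C * sg x ^ (-p - 1)) ∧
    ∀ x : Euc N, Tendsto (fun n => lap (cut p n) x) atTop (𝓝 (lapL N p x)) := by
  obtain ⟨t', t'', B, hB, ht, ht', b1, b2, z1, z2⟩ := theta_derivs
  have form : ∀ (n : ℕ) (x : Euc N), lap (cut p n) x =
      4 * ‖x‖ ^ 2 * (p * (p + 1) * sg x ^ (-p - 2) * theta (sg x / (n + 1))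
        + 2 * (-p * sg x ^ (-p - 1)) * (t' (sg x / (n + 1)) / (n + 1))
        + sg x ^ (-p) * (t'' (sg x / (n + 1)) / (n + 1) ^ 2))
      + 2 * N * (-p * sg x ^ (-p - 1) * theta (sg x / (n + 1))
        + sg x ^ (-p) * (t' (sg x / (n + 1)) / (n + 1))) := by
    intro n x
    have d1 : ∀ s : ℝ, HasDerivAt (fun s => theta (s / (n + 1))) (t' (s / (n + 1)) / (n + 1)) s := by
      intro s
      have := (ht (s / (n + 1))).comp s ((hasDerivAt_id s).div_const (n + 1 : ℝ))
      refine this.congr_deriv ?_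
      ring
    have d2 : ∀ s : ℝ, HasDerivAt (fun s => t' (s / (n + 1)) / (n + 1))
        (t'' (s / (n + 1)) / (n + 1) ^ 2) s := by
      intro s
      have := ((ht' (s / (n + 1))).comp s ((hasDerivAt_id s).div_const (n + 1 : ℝ))).div_const (n + 1 : ℝ)
      refine this.congr_deriv ?_
      field_simp
    have := lap_radial (N := N) (j := fun s => s ^ (-p) * theta (s / (n + 1)))
      (j' := fun s => -p * s ^ (-p - 1) * theta (s / (n + 1)) + s ^ (-p) * (t' (s / (n + 1)) / (n + 1)))
      (j'' := fun s => p * (p + 1) * s ^ (-p - 2) * theta (s / (n + 1))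
        + 2 * (-p * s ^ (-p - 1)) * (t' (s / (n + 1)) / (n + 1))
        + s ^ (-p) * (t'' (s / (n + 1)) / (n + 1) ^ 2)) ?_ ?_ x
    · exact this
    · intro s hs
      exact (rpow_neg_d p s hs).mul (d1 s)
    · intro s hs
      have r1 := rpow_neg_d (p + 1) s hs
      rw [show -(p + 1) = -p - 1 by ring, show -p - 1 - 1 = -p - 2 by ring] at r1
      have := ((r1.const_mul (-p)).mul (d1 s)).add ((rpow_neg_d p s hs).mul (d2 s))
      refine this.congr_deriv ?_
      ring
  refine ⟨4 * (p * (p + 1) + 4 * p * B + 4 * B) + 2 * N * (p + 2 * B), by positivity, ?_, ?_⟩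
  · intro n x
    rw [form]
    set s := sg x with hs
    have s0 : 0 < s := sg_pos x
    have bt : ∀ y, |theta y| ≤ 1 := fun y => by
      rw [abs_of_nonneg (theta_nonneg _)]; exact theta_le _
    have e1 : |t' (s / (n + 1)) / (n + 1)| ≤ 2 * B / s := by
      by_cases hc : 2 < s / (n + 1)
      · rw [(z2 _ hc).1]; simp; positivity
      · rw [abs_div, abs_of_pos (by positivity : (0 : ℝ) < n + 1), div_le_div_iff₀ (by positivity) s0]
        rw [not_lt, div_le_iff₀ (by positivity)] at hc
        have := mul_le_mul (b1 (s / (n + 1))) hc s0.le hB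
        nlinarith
    have e2 : |t'' (s / (n + 1)) / (n + 1) ^ 2| ≤ 4 * B / s ^ 2 := by
      by_cases hc : 2 < s / (n + 1)
      · rw [(z2 _ hc).2]; simp; positivity
      · rw [abs_div, abs_of_pos (by positivity : (0 : ℝ) < (n + 1) ^ 2),
          div_le_div_iff₀ (by positivity) (by positivity)]
        rw [not_lt, div_le_iff₀ (by positivity)] at hc
        have h3 : s ^ 2 ≤ (2 * (n + 1)) ^ 2 := pow_le_pow_left₀ s0.le hc 2
        have := mul_le_mul (b2 (s / (n + 1))) h3 (by positivity) hB
        nlinarith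
    have q1 : s ^ (-p - 1) = s ^ (-p) / s := by rw [Real.rpow_sub_one s0.ne']
    have q2 : s ^ (-p - 2) = s ^ (-p) / s ^ 2 := by
      rw [Real.rpow_sub s0]; norm_num
    rw [q1, q2]
    set w := s ^ (-p) with hw
    have w0 : 0 < w := Real.rpow_pos_of_pos s0 _
    have x2 : ‖x‖ ^ 2 ≤ s := by rw [hs]; unfold sg; linarith
    have A1 : |p * (p + 1) * (w / s ^ 2) * theta (s / (n + 1))| ≤ p * (p + 1) * (w / s ^ 2) := by
      rw [abs_mul, abs_of_pos (by positivity : 0 < p * (p + 1) * (w / s ^ 2))]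
      exact mul_le_of_le_one_right (by positivity) (bt _)
    have A2 : |2 * (-p * (w / s)) * (t' (s / (n + 1)) / (n + 1))| ≤ 4 * p * B * (w / s ^ 2) := by
      rw [abs_mul, show |2 * (-p * (w / s))| = 2 * p * (w / s) by
        rw [show 2 * (-p * (w / s)) = -(2 * p * (w / s)) by ring, abs_neg, abs_of_pos (by positivity)]]
      refine (mul_le_mul_of_nonneg_left e1 (by positivity)).trans (le_of_eq ?_)
      field_simp; ring
    have A3 : |w * (t'' (s / (n + 1)) / (n + 1) ^ 2)| ≤ 4 * B * (w / s ^ 2) := by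
      rw [abs_mul, abs_of_pos w0]
      refine (mul_le_mul_of_nonneg_left e2 (by positivity)).trans (le_of_eq ?_)
      field_simp
    have A4 : |-p * (w / s) * theta (s / (n + 1))| ≤ p * (w / s) := by
      rw [abs_mul, show |-p * (w / s)| = p * (w / s) by
        rw [show -p * (w / s) = -(p * (w / s)) by ring, abs_neg, abs_of_pos (by positivity)]]
      exact mul_le_of_le_one_right (by positivity) (bt _)
    have A5 : |w * (t' (s / (n + 1)) / (n + 1))| ≤ 2 * B * (w / s) := by
      rw [abs_mul, abs_of_pos w0]
      refine (mul_le_mul_of_nonneg_left e1 (by positivity)).trans (le_of_eq ?_)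
      field_simp
    have S1 := (abs_add_le _ _).trans (add_le_add ((abs_add_le _ _).trans (add_le_add A1 A2)) A3)
    have S2 := (abs_add_le _ _).trans (add_le_add A4 A5)
    refine (abs_add_le _ _).trans ?_
    rw [abs_mul, abs_mul (2 * (N : ℝ)), abs_of_nonneg (by positivity : 0 ≤ 4 * ‖x‖ ^ 2),
      abs_of_nonneg (by positivity : 0 ≤ 2 * (N : ℝ))]
    have T1 := mul_le_mul (mul_le_mul_of_nonneg_left x2 (by norm_num : (0:ℝ) ≤ 4)) S1 (abs_nonneg _)
      (by positivity)
    have T2 := mul_le_mul_of_nonneg_left S2 (by positivity : 0 ≤ 2 * (N : ℝ))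
    refine (add_le_add T1 T2).trans (le_of_eq ?_)
    field_simp
  · intro x
    refine tendsto_const_nhds.congr' ?_
    obtain ⟨n0, hn0⟩ := exists_nat_ge (sg x)
    filter_upwards [eventually_ge_atTop n0] with n hn
    have : (n0 : ℝ) ≤ n := by exact_mod_cast hn
    have h1 : sg x / (n + 1) < 1 := by
      rw [div_lt_one (by positivity)]
      linarith
    rw [form, theta_one h1.le, (z1 _ h1).1, (z1 _ h1).2]
    unfold lapL
    ring

lemma lapL_bd (p : ℝ) (hp : 0 < p) : ∃ C : ℝ, 0 ≤ C ∧
    (∀ n (x : Euc N), |lap (cut p n) x| ≤ C * sg x ^ (-p - 1)) ∧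
    ∀ x : Euc N, |lapL N p x| ≤ C * sg x ^ (-p - 1) := by
  obtain ⟨C, h0, h1, h2⟩ := cut_lap (N := N) p hp
  exact ⟨C, h0, h1, fun x => le_of_tendsto (h2 x).abs (Eventually.of_forall fun n => h1 n x)⟩

lemma sgpow_cont (q : ℝ) : Continuous (fun x : Euc N => sg x ^ q) :=
  sg_cont.rpow_const fun x => Or.inl (sg_pos x).ne'

lemma lapL_cont (p : ℝ) : Continuous (lapL N p) := by
  unfold lapL
  have h1 := sgpow_cont (N := N) (-p - 2)
  have h2 := sgpow_cont (N := N) (-p - 1)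
  fun_prop

/-- passing to the limit in cutoffs -/
lemma kato_lim {p : ℝ} (hp : 0 < p) {A F H : Euc N → ℝ} (hA : AEStronglyMeasurable A volume)
    (hA1 : ∀ x, |A x| ≤ 1) (hF : AEStronglyMeasurable F volume) (hH : AEStronglyMeasurable H volume)
    (iF : Integrable (fun x => F x * sg x ^ (-p))) (iH : Integrable (fun x => H x * sg x ^ (-p - 1)))
    (h : ∀ χ, TF χ → (∀ x, 0 ≤ χ x) → ∫ x, A x * F x * χ x ≤ ∫ x, H x * lap χ x) :
    ∫ x, A x * F x * sg x ^ (-p) ≤ ∫ x, H x * lapL N p x := by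
  obtain ⟨C, hC0, hC1, hC2⟩ := cut_lap (N := N) p hp
  have key := fun n => h (cut p n) (cut_TF p n) (cut_nonneg p n)
  refine le_of_tendsto_of_tendsto' (f := fun n => ∫ x, A x * F x * cut p n x)
    (g := fun n => ∫ x, H x * lap (cut p n) x) (b := atTop) ?_ ?_ key
  · refine tendsto_integral_of_dominated_convergence (fun x => |F x * sg x ^ (-p)|) ?_ iF.abs ?_ ?_
    · exact fun n => (hA.mul hF).mul (cut_TF p n).cont.aestronglyMeasurable
    · refine fun n => ae_of_all _ fun x => ?_
      rw [Real.norm_eq_abs, mul_assoc, abs_mul]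
      refine (mul_le_of_le_one_left (abs_nonneg _) (hA1 _)).trans ?_
      rw [abs_mul, abs_mul, abs_of_nonneg (cut_nonneg p n x),
        abs_of_nonneg (Real.rpow_nonneg (sg_pos x).le _)]
      exact mul_le_mul_of_nonneg_left (cut_le p n x) (abs_nonneg _)
    · exact ae_of_all _ fun x => (cut_tendsto p x).const_mul _
  · refine tendsto_integral_of_dominated_convergence (fun x => C * |H x * sg x ^ (-p - 1)|) ?_
      (iH.abs.const_mul C) ?_ ?_
    · exact fun n => hH.mul (lap_continuous (cut_TF p n).c2).aestronglyMeasurable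
    · refine fun n => ae_of_all _ fun x => ?_
      rw [Real.norm_eq_abs, abs_mul, abs_mul, abs_of_nonneg (Real.rpow_nonneg (sg_pos x).le _)]
      have := mul_le_mul_of_nonneg_left (hC1 n x) (abs_nonneg (H x))
      linarith
    · exact ae_of_all _ fun x => (hC2 x).const_mul _

lemma lapL_int_bd {p C : ℝ} {H : Euc N → ℝ}
    (iH : Integrable (fun x => H x * sg x ^ (-p - 1)))
    (hC : ∀ x : Euc N, |lapL N p x| ≤ C * sg x ^ (-p - 1)) :
    |∫ x, H x * lapL N p x| ≤ C * ∫ x, |H x| * sg x ^ (-p - 1) := by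
  rw [← integral_const_mul]
  have : Integrable (fun x => C * (|H x| * sg x ^ (-p - 1))) := by
    refine (iH.abs.congr (ae_of_all _ fun x => ?_)).const_mul C
    simp only [abs_mul, abs_of_nonneg (Real.rpow_nonneg (sg_pos x).le _)]
  rw [← Real.norm_eq_abs]
  refine norm_integral_le_of_norm_le this (ae_of_all _ fun x => ?_)
  rw [Real.norm_eq_abs, abs_mul]
  have := mul_le_mul_of_nonneg_left (hC x) (abs_nonneg (H x))
  linarith

/-- Comparison lemma C. -/
lemma lemmaC (hN : 3 ≤ N) {ρ g F G : Euc N → ℝ} {Cr : ℝ}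
    (hρ : ∀ᵐ x, 0 < ρ x) (hρinv : ∀ᵐ x, 1 ≤ Cr * sg x * ρ x)
    (hg : LocallyIntegrable g) (hF : LocallyIntegrable F)
    (h : ∀ φ, TF φ → ∫ x, g x * lap φ x = ∫ x, F x * φ x)
    (hG : Integrable (fun x => ρ x * G x ^ 2)) (hgG : ∀ᵐ x, max (g x) 0 ≤ G x)
    (h0 : ∀ᵐ x, 0 ≤ g x → 0 ≤ F x) (h1 : ∀ᵐ x, 0 < g x → 0 < F x) : ∀ᵐ x, g x ≤ 0 := by
  set p : ℝ := ((N : ℝ) - 2) / 2 with hp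
  have hN' : (3 : ℝ) ≤ N := by exact_mod_cast hN
  have hp0 : 0 < p := by rw [hp]; linarith
  set H : Euc N → ℝ := fun x => max (g x) 0
  have hgm := hg.aestronglyMeasurable
  have hHm : AEStronglyMeasurable H volume :=
    (hgm.aemeasurable.max aemeasurable_const).aestronglyMeasurable
  have iH : Integrable (fun x => H x * sg x ^ (-p - 1)) := by
    have i2 : Integrable (fun x : Euc N => |Cr| * sg x ^ (-((N : ℝ) - 1))) := by
      have := integrable_rpow_neg_one_add_norm_sq (E := Euc N) (μ := volume) (r := 2 * ((N : ℝ) - 1))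
        (by simp; linarith)
      refine (this.congr (ae_of_all _ fun x => ?_)).const_mul |Cr|
      simp only [sg]
      congr 1; ring
    refine (hG.add i2).mono (hHm.mul (sgpow_cont _).aestronglyMeasurable) ?_
    filter_upwards [hgG, hρ, hρinv] with x a b d
    have s0 := sg_pos x
    have Hx : 0 ≤ H x := le_max_right _ _
    rw [Real.norm_eq_abs, Real.norm_eq_abs, abs_of_nonneg (mul_nonneg Hx (Real.rpow_nonneg s0.le _))]
    refine le_trans ?_ (le_abs_self _)
    show H x * sg x ^ (-p - 1) ≤ ρ x * G x ^ 2 + |Cr| * sg x ^ (-((N : ℝ) - 1))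
    have e1 : sg x ^ (-((N : ℝ) - 1)) = sg x * (sg x ^ (-p - 1)) ^ 2 := by
      rw [← Real.rpow_natCast, ← Real.rpow_mul s0.le]
      nth_rewrite 2 [← Real.rpow_one (sg x)]
      rw [← Real.rpow_add s0]
      congr 1; rw [hp]; push_cast; ring
    rw [e1]
    set w := sg x ^ (-p - 1)
    have w0 : 0 < w := Real.rpow_pos_of_pos s0 _
    have d' : 1 ≤ ρ x * (|Cr| * sg x) := by
      refine d.trans ?_
      have := mul_le_mul_of_nonneg_right (le_abs_self Cr) (mul_pos s0 b).le
      nlinarith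
    have hGx : H x ≤ G x := a
    have k1 : H x * w ≤ G x * w := mul_le_mul_of_nonneg_right hGx w0.le
    have k0 : 0 ≤ G x * w := mul_nonneg (Hx.trans hGx) w0.le
    have k2 : (G x * w) ^ 2 ≤ (ρ x * G x ^ 2) * (|Cr| * (sg x * w ^ 2)) := by
      have := mul_le_mul_of_nonneg_left d' (sq_nonneg (G x * w))
      nlinarith
    have a1 : 0 ≤ ρ x * G x ^ 2 := by positivity
    have a2 : 0 ≤ |Cr| * (sg x * w ^ 2) := by positivity
    have : G x * w ≤ ρ x * G x ^ 2 + |Cr| * (sg x * w ^ 2) := by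
      refine abs_le_of_sq_le_sq' ?_ (by positivity) |>.2
      nlinarith
    linarith
  have hlapL : ∀ x : Euc N, lapL N p x ≤ 0 := by
    intro x
    have s0 := sg_pos x
    have q1 : sg x ^ (-p - 1) = sg x ^ (-p - 2) * sg x := by
      rw [← Real.rpow_add_one s0.ne']; congr 1; ring
    unfold lapL
    rw [q1]
    have w0 : 0 < sg x ^ (-p - 2) := Real.rpow_pos_of_pos s0 _
    have : 4 * ‖x‖ ^ 2 * (p * (p + 1) * sg x ^ (-p - 2)) + 2 * N * (-p * (sg x ^ (-p - 2) * sg x))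
      = -(2 * N * p * sg x ^ (-p - 2)) := by
      rw [show p + 1 = N / 2 by rw [hp]; ring]
      unfold sg; ring
    rw [this]
    have : 0 < 2 * N * p * sg x ^ (-p - 2) := by positivity
    linarith
  -- the limit of the left side via Fatou
  obtain ⟨C, hC0, hC1, hC2⟩ := cut_lap (N := N) p hp0
  have key := fun n => kato_pos hg hF h (cut_TF p n) (cut_nonneg p n)
  have lim : Tendsto (fun n => ∫ x, max (g x) 0 * lap (cut p n) x) atTop
      (𝓝 (∫ x, H x * lapL N p x)) := by
    refine tendsto_integral_of_dominated_convergence (fun x => C * |H x * sg x ^ (-p - 1)|) ?_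
      (iH.abs.const_mul C) ?_ ?_
    · exact fun n => hHm.mul (lap_continuous (cut_TF p n).c2).aestronglyMeasurable
    · refine fun n => ae_of_all _ fun x => ?_
      rw [Real.norm_eq_abs, abs_mul, abs_mul, abs_of_nonneg (Real.rpow_nonneg (sg_pos x).le _)]
      have := mul_le_mul_of_nonneg_left (hC1 n x) (abs_nonneg (H x))
      linarith
    · exact ae_of_all _ fun x => (hC2 x).const_mul _
  have nn : ∀ᵐ x, 0 ≤ sp (g x) * F x := by
    filter_upwards [h0] with x hx
    rcases lt_or_ge (g x) 0 with c | c
    · simp [sp_neg c]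
    · exact mul_nonneg (sp_nonneg _) (hx c)
  have hspF : LocallyIntegrable (fun x => sp (g x) * F x) := by
    refine hF.mono ((meas_sp.comp_aemeasurable hgm.aemeasurable).aestronglyMeasurable.mul
      hF.aestronglyMeasurable) (ae_of_all _ fun x => ?_)
    rw [Real.norm_eq_abs, Real.norm_eq_abs, abs_mul, abs_of_nonneg (sp_nonneg _)]
    exact mul_le_of_le_one_left (abs_nonneg _) (sp_le _)
  have in_ : ∀ n, Integrable (fun x => sp (g x) * F x * cut p n x) := fun n =>
    locInt_mul hspF (cut_TF p n).cont (cut_TF p n).2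
  have mono : ∀ n, ∀ᵐ x, sp (g x) * F x * cut p n x = 0 := by
    intro n
    have le0 : ∫ x, sp (g x) * F x * cut p n x ≤ 0 := by
      have h2 : (∫ x, H x * lapL N p x) ≤ 0 :=
        integral_nonpos fun x => mul_nonpos_of_nonneg_of_nonpos (le_max_right _ _) (hlapL x)
      refine le_trans (ge_of_tendsto lim ?_) h2
      filter_upwards [eventually_ge_atTop (2 * n + 2)] with k hk
      refine le_trans (integral_mono_ae (in_ n) (in_ k) ?_) (key k)
      filter_upwards [nn] with x hx
      refine mul_le_mul_of_nonneg_left ?_ hx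
      by_cases hs : 2 ≤ sg x / (n + 1)
      · rw [cut, theta_zero hs, mul_zero]; exact cut_nonneg _ _ _
      · rw [not_le, div_lt_iff₀ (by positivity)] at hs
        have : cut p k x = sg x ^ (-p) := by
          rw [cut, theta_one, mul_one]
          rw [div_le_one (by positivity)]
          have : ((2 * n + 2 : ℕ) : ℝ) ≤ k := by exact_mod_cast hk
          push_cast at this
          linarith
        rw [this]; exact cut_le _ _ _
    have ge0 : 0 ≤ᵐ[volume] fun x => sp (g x) * F x * cut p n x := by
      filter_upwards [nn] with x hx using mul_nonneg hx (cut_nonneg _ _ _)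
    exact (integral_eq_zero_iff_of_nonneg_ae ge0 (in_ n)).1
      (le_antisymm le0 (integral_nonneg_of_ae ge0))
  filter_upwards [ae_all_iff.2 mono, h1] with x hx hx1
  by_contra hc
  rw [not_le] at hc
  have h3 := cut_tendsto p x
  have h4 : Tendsto (fun n => sp (g x) * F x * cut p n x) atTop (𝓝 (sp (g x) * F x * sg x ^ (-p))) :=
    h3.const_mul _
  simp only [hx] at h4
  have h5 := tendsto_nhds_unique h4 tendsto_const_nhds
  rw [sp_pos hc, one_mul] at h5
  have := mul_pos (hx1 hc) (Real.rpow_pos_of_pos (sg_pos x) (-p))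
  linarith

end Blow

end

end

section
open MeasureTheory Metric Filter Set ENNReal
open scoped Topology ContDiff

noncomputable section

namespace Blow

variable {N : ℕ}

def En (φ : Euc N → ℝ) : ℝ := -∫ x, φ x * lap φ x

lemma En_nonneg {φ : Euc N → ℝ} (h : TF φ) : 0 ≤ En φ := by
  have := green_nonneg h; unfold En; linarith

lemma TF.lin {φ η : Euc N → ℝ} (h : TF φ) (h' : TF η) (a b : ℝ) : TF (fun x => a * φ x + b * η x) :=
  (h.smul a).add (h'.smul b)

lemma En_lin {φ η : Euc N → ℝ} (h : TF φ) (h' : TF η) (a b : ℝ) :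
    En (fun x => a * φ x + b * η x)
      = a ^ 2 * En φ - 2 * a * b * (∫ x, φ x * lap η x) + b ^ 2 * En η := by
  unfold En
  have sym : ∫ x, η x * lap φ x = ∫ x, φ x * lap η x := by
    rw [green h'.c2 h.c2 h.2]
    exact integral_congr_ae (ae_of_all _ fun x => mul_comm _ _)
  have e : ∀ x, lap (fun x => a * φ x + b * η x) x = a * lap φ x + b * lap η x := by
    intro x
    rw [lap_add (h.smul a).c2 (h'.smul b).c2, lap_smul a h.c2, lap_smul b h'.c2]
  have cl := lap_continuous h.c2
  have cl' := lap_continuous h'.c2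
  have i1 := (int_mul h.cont cl (lap_support h.2)).const_mul (a ^ 2)
  have i2 := (int_mul h.cont cl' (lap_support h'.2)).const_mul (a * b)
  have i3 := (int_mul h'.cont cl (lap_support h.2)).const_mul (a * b)
  have i4 := (int_mul h'.cont cl' (lap_support h'.2)).const_mul (b ^ 2)
  have : ∫ x, (a * φ x + b * η x) * lap (fun x => a * φ x + b * η x) x
      = ∫ x, ((a ^ 2 * (φ x * lap φ x) + a * b * (φ x * lap η x)) +
        (a * b * (η x * lap φ x) + b ^ 2 * (η x * lap η x))) := by
    congr 1; funext x; rw [e]; ring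
  have j1 := integral_add (i1.add i2) (i3.add i4)
  simp only [Pi.add_apply] at j1
  rw [this, j1, integral_add i1 i2, integral_add i3 i4]
  simp only [integral_const_mul]
  rw [sym]; ring

/-- data for the variational problem -/
structure VP (N : ℕ) where
  ρ : Euc N → ℝ
  f : Euc N → ℝ
  B : ℝ → ℝ
  b : ℝ → ℝ
  h : ℝ
  ε : ℝ
  L : ℝ
  α : ℝ
  Cr : ℝ
  ρm : Measurable ρ
  ρpos : ∀ᵐ x, 0 < ρ x
  ρloc : LocallyIntegrable ρ
  ρinv : ∀ᵐ x, 1 ≤ Cr * sg x * ρ x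
  fm : AEStronglyMeasurable f volume
  f2 : Integrable (fun x => ρ x * f x ^ 2)
  h0 : 0 < h
  ε0 : 0 < ε
  L0 : 0 ≤ L
  α0 : 0 < α
  α1 : α < 1
  Bc : Continuous B
  bc : Continuous b
  B0 : B 0 = 0
  b0 : b 0 = 0
  conv : ∀ x y, B x + b x * (y - x) ≤ B y
  hol : ∀ x y, |b x - b y| ≤ L * |x - y| ^ α

namespace VP
variable (V : VP N)

lemma intC {g : Euc N → ℝ} (hg : Continuous g) (hc : HasCompactSupport g) :
    Integrable (fun x => V.ρ x * g x) := locInt_mul V.ρloc hg hc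

lemma floc : LocallyIntegrable (fun x => V.ρ x * V.f x) := by
  have : LocallyIntegrable (fun x => V.ρ x + V.ρ x * V.f x ^ 2) := V.ρloc.add V.f2.locallyIntegrable
  refine this.mono (V.ρm.aestronglyMeasurable.mul V.fm) ?_
  filter_upwards [V.ρpos] with x hx
  rw [Real.norm_eq_abs, Real.norm_eq_abs, abs_mul, abs_of_pos hx,
    abs_of_nonneg (by positivity : 0 ≤ V.ρ x + V.ρ x * V.f x ^ 2)]
  have : |V.f x| ≤ 1 + V.f x ^ 2 := by nlinarith [sq_nonneg (|V.f x| - 1), sq_abs (V.f x), abs_nonneg (V.f x)]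
  nlinarith

lemma intf {g : Euc N → ℝ} (hg : Continuous g) (hc : HasCompactSupport g) :
    Integrable (fun x => V.ρ x * V.f x * g x) := locInt_mul V.floc hg hc

lemma B_nonneg (s : ℝ) : 0 ≤ V.B s := by
  have := V.conv 0 s; rw [V.B0, V.b0] at this; linarith

lemma intB {φ : Euc N → ℝ} (h : TF φ) : Integrable (fun x => V.ρ x * V.B (φ x)) :=
  V.intC (V.Bc.comp h.cont) (h.2.comp_left V.B0)

lemma int2 {φ ψ : Euc N → ℝ} (h : TF φ) (h' : TF ψ) : Integrable (fun x => V.ρ x * (φ x * ψ x)) :=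
  V.intC (h.cont.mul h'.cont) h'.2.mul_left

def J (φ : Euc N → ℝ) : ℝ :=
  V.h / 2 * En φ + (∫ x, V.ρ x * V.B (φ x)) + V.ε / 2 * (∫ x, V.ρ x * (φ x * φ x))
    - ∫ x, V.ρ x * V.f x * φ x

lemma q_lin {φ η : Euc N → ℝ} (h : TF φ) (h' : TF η) (a b : ℝ) :
    ∫ x, V.ρ x * ((a * φ x + b * η x) * (a * φ x + b * η x))
      = a ^ 2 * (∫ x, V.ρ x * (φ x * φ x)) + 2 * a * b * (∫ x, V.ρ x * (φ x * η x))
        + b ^ 2 * ∫ x, V.ρ x * (η x * η x) := by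
  have i1 := (V.int2 h h).const_mul (a ^ 2)
  have i2 := (V.int2 h h').const_mul (2 * a * b)
  have i3 := (V.int2 h' h').const_mul (b ^ 2)
  have j := integral_add (i1.add i2) i3
  simp only [Pi.add_apply] at j
  rw [← integral_const_mul, ← integral_const_mul, ← integral_const_mul, ← integral_add i1 i2, ← j]
  congr 1; funext x; ring

lemma f_lin {φ η : Euc N → ℝ} (h : TF φ) (h' : TF η) (a b : ℝ) :
    ∫ x, V.ρ x * V.f x * (a * φ x + b * η x)
      = a * (∫ x, V.ρ x * V.f x * φ x) + b * ∫ x, V.ρ x * V.f x * η x := by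
  have i1 := (V.intf h.cont h.2).const_mul a
  have i2 := (V.intf h'.cont h'.2).const_mul b
  rw [← integral_const_mul, ← integral_const_mul, ← integral_add i1 i2]
  congr 1; funext x; ring

lemma B_conv (x y : ℝ) : V.B (1 / 2 * x + 1 / 2 * y) ≤ 1 / 2 * V.B x + 1 / 2 * V.B y := by
  have h1 := V.conv (1 / 2 * x + 1 / 2 * y) x
  have h2 := V.conv (1 / 2 * x + 1 / 2 * y) y
  nlinarith

lemma J_par {φ ψ : Euc N → ℝ} (h : TF φ) (h' : TF ψ) :
    V.J (fun x => 1 / 2 * φ x + 1 / 2 * ψ x)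
      + V.ε / 8 * (∫ x, V.ρ x * ((1 * φ x + (-1) * ψ x) * (1 * φ x + (-1) * ψ x)))
      ≤ 1 / 2 * V.J φ + 1 / 2 * V.J ψ := by
  unfold J
  rw [V.q_lin h h', V.f_lin h h', En_lin h h', V.q_lin h h']
  have e := En_nonneg (h.lin h' 1 (-1))
  rw [En_lin h h'] at e
  have hB : ∫ x, V.ρ x * V.B (1 / 2 * φ x + 1 / 2 * ψ x)
      ≤ 1 / 2 * (∫ x, V.ρ x * V.B (φ x)) + 1 / 2 * ∫ x, V.ρ x * V.B (ψ x) := by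
    rw [← integral_const_mul, ← integral_const_mul,
      ← integral_add ((V.intB h).const_mul _) ((V.intB h').const_mul _)]
    refine integral_mono_ae (V.intB (h.lin h' _ _)) (((V.intB h).const_mul _).add ((V.intB h').const_mul _)) ?_
    filter_upwards [V.ρpos] with x hx
    have := mul_le_mul_of_nonneg_left (V.B_conv (φ x) (ψ x)) hx.le
    linarith
  have := V.h0
  nlinarith

lemma J_bdd {φ : Euc N → ℝ} (h : TF φ) :
    -(1 / (2 * V.ε)) * (∫ x, V.ρ x * V.f x ^ 2) ≤ V.J φ := by
  unfold J
  have e := En_nonneg h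
  have hB : 0 ≤ ∫ x, V.ρ x * V.B (φ x) := by
    refine integral_nonneg_of_ae ?_
    filter_upwards [V.ρpos] with x hx using mul_nonneg hx.le (V.B_nonneg _)
  have key : (∫ x, V.ρ x * V.f x * φ x) ≤ V.ε / 2 * (∫ x, V.ρ x * (φ x * φ x))
      + 1 / (2 * V.ε) * ∫ x, V.ρ x * V.f x ^ 2 := by
    rw [← integral_const_mul, ← integral_const_mul,
      ← integral_add ((V.int2 h h).const_mul _) (V.f2.const_mul _)]
    refine integral_mono_ae (V.intf h.cont h.2) (((V.int2 h h).const_mul _).add (V.f2.const_mul _)) ?_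
    filter_upwards [V.ρpos] with x hx
    have hε := V.ε0
    have : 0 ≤ V.ρ x * (V.ε * φ x - V.f x) ^ 2 / (2 * V.ε) := by positivity
    have e2 : V.ρ x * (V.ε * φ x - V.f x) ^ 2 / (2 * V.ε) = V.ε / 2 * (V.ρ x * (φ x * φ x))
      + 1 / (2 * V.ε) * (V.ρ x * V.f x ^ 2) - V.ρ x * V.f x * φ x := by
      field_simp; ring
    linarith
  have := mul_nonneg (half_pos V.h0).le e
  linarith

def Lin (w η : Euc N → ℝ) : ℝ :=
  -(V.h * ∫ x, w x * lap η x) + (∫ x, V.ρ x * (V.b (w x) * η x)) + V.ε * (∫ x, V.ρ x * (w x * η x))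
    - ∫ x, V.ρ x * V.f x * η x

lemma J_var {φ η : Euc N → ℝ} (h : TF φ) (h' : TF η) (s : ℝ) :
    V.J (fun x => 1 * φ x + s * η x) ≤ V.J φ + s * V.Lin φ η
      + s ^ 2 * (V.h / 2 * En η + V.ε / 2 * ∫ x, V.ρ x * (η x * η x))
      + |s| ^ (1 + V.α) * (V.L * ∫ x, V.ρ x * |η x| ^ (1 + V.α)) := by
  unfold J Lin
  rw [V.q_lin h h', V.f_lin h h', En_lin h h']
  have ib : Integrable (fun x => V.ρ x * (V.b (φ x) * η x)) :=
    V.intC ((V.bc.comp h.cont).mul h'.cont) h'.2.mul_left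
  have ia : Integrable (fun x => V.ρ x * |η x| ^ (1 + V.α)) := by
    have h1 : 0 < 1 + V.α := by linarith [V.α0]
    refine V.intC (h'.cont.abs.rpow_const fun x => Or.inr h1.le) ?_
    exact h'.2.comp_left (g := fun s : ℝ => |s| ^ (1 + V.α)) (by simp [Real.zero_rpow h1.ne'])
  have hB : ∫ x, V.ρ x * V.B (1 * φ x + s * η x)
      ≤ (∫ x, V.ρ x * V.B (φ x)) + s * (∫ x, V.ρ x * (V.b (φ x) * η x))
        + |s| ^ (1 + V.α) * V.L * ∫ x, V.ρ x * |η x| ^ (1 + V.α) := by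
    rw [← integral_const_mul, ← integral_const_mul,
      ← integral_add (V.intB h) (ib.const_mul _)]
    have j := integral_add ((V.intB h).add (ib.const_mul s)) (ia.const_mul (|s| ^ (1 + V.α) * V.L))
    simp only [Pi.add_apply] at j
    rw [← j]
    refine integral_mono_ae (V.intB (h.lin h' _ _))
      (((V.intB h).add (ib.const_mul s)).add (ia.const_mul (|s| ^ (1 + V.α) * V.L))) ?_
    filter_upwards [V.ρpos] with x hx
    have c1 := V.conv (1 * φ x + s * η x) (φ x)
    have c2 := V.hol (1 * φ x + s * η x) (φ x)
    have c3 : (V.b (1 * φ x + s * η x) - V.b (φ x)) * (s * η x) ≤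
        |s| ^ (1 + V.α) * V.L * |η x| ^ (1 + V.α) := by
      rw [show 1 * φ x + s * η x - φ x = s * η x by ring] at c2
      calc _ ≤ |(V.b (1 * φ x + s * η x) - V.b (φ x)) * (s * η x)| := le_abs_self _
        _ = |V.b (1 * φ x + s * η x) - V.b (φ x)| * |s * η x| := abs_mul _ _
        _ ≤ V.L * |s * η x| ^ V.α * |s * η x| := mul_le_mul_of_nonneg_right c2 (abs_nonneg _)
        _ = V.L * |s * η x| ^ (1 + V.α) := by
          rw [add_comm, Real.rpow_add_one' (abs_nonneg _) (by linarith [V.α0])]; ring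
        _ = _ := by rw [abs_mul, Real.mul_rpow (abs_nonneg _) (abs_nonneg _)]; ring
    have c4 : V.B (1 * φ x + s * η x) ≤ V.B (φ x) + s * (V.b (φ x) * η x)
        + |s| ^ (1 + V.α) * V.L * |η x| ^ (1 + V.α) := by linarith
    have := mul_le_mul_of_nonneg_left c4 hx.le
    linarith
  linarith

/-- a sequential smallness lemma -/
lemma small {d G : ℕ → Euc N → ℝ} {Θ : Euc N → ℝ} {M : ℝ}
    (di : ∀ n, Integrable (fun x => V.ρ x * d n x ^ 2))
    (dl : Tendsto (fun n => ∫ x, V.ρ x * d n x ^ 2) atTop (𝓝 0))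
    (hG : ∀ τ > 0, ∃ C, 0 ≤ C ∧ ∀ n x, |G n x| ≤ τ + C * d n x ^ 2)
    (hM : ∀ᵐ x, |Θ x| ≤ M) (iΘ : Integrable (fun x => V.ρ x * |Θ x|)) :
    Tendsto (fun n => ∫ x, V.ρ x * (G n x * Θ x)) atTop (𝓝 0) := by
  have iΘ0 : 0 ≤ ∫ x, V.ρ x * |Θ x| := by
    refine integral_nonneg_of_ae ?_
    filter_upwards [V.ρpos] with x hx using mul_nonneg hx.le (abs_nonneg _)
  have M0 : 0 ≤ M := by
    obtain ⟨x, hx⟩ := hM.exists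
    exact (abs_nonneg _).trans hx
  rw [Metric.tendsto_atTop]
  intro e he
  set I := ∫ x, V.ρ x * |Θ x|
  obtain ⟨C, hC, hb⟩ := hG (e / (2 * (I + 1))) (by positivity)
  have hev : ∀ᶠ n in atTop, (∫ x, V.ρ x * d n x ^ 2) < e / (2 * (C * M + 1)) :=
    dl.eventually_lt_const (by positivity)
  obtain ⟨n0, hn0⟩ := eventually_atTop.1 hev
  refine ⟨n0, fun n hn => ?_⟩
  rw [dist_zero_right]
  have bd : ‖∫ x, V.ρ x * (G n x * Θ x)‖ ≤
      ∫ x, (e / (2 * (I + 1)) * (V.ρ x * |Θ x|) + C * M * (V.ρ x * d n x ^ 2)) := by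
    refine norm_integral_le_of_norm_le ((iΘ.const_mul _).add ((di n).const_mul _)) ?_
    filter_upwards [V.ρpos, hM] with x hx hMx
    rw [Real.norm_eq_abs, abs_mul, abs_mul, abs_of_pos hx]
    have h1 := mul_le_mul_of_nonneg_right (hb n x) (abs_nonneg (Θ x))
    have h2 : C * d n x ^ 2 * |Θ x| ≤ C * d n x ^ 2 * M :=
      mul_le_mul_of_nonneg_left hMx (by positivity)
    have h3 : |G n x| * |Θ x| ≤ e / (2 * (I + 1)) * |Θ x| + C * d n x ^ 2 * M := by linarith
    have := mul_le_mul_of_nonneg_left h3 hx.le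
    linarith
  rw [integral_add (iΘ.const_mul _) ((di n).const_mul _), integral_const_mul, integral_const_mul] at bd
  have a1 : e / (2 * (I + 1)) * I ≤ e / 2 := by
    rw [div_mul_eq_mul_div, div_le_div_iff₀ (by positivity) (by norm_num)]
    nlinarith
  have a2 : C * M * (∫ x, V.ρ x * d n x ^ 2) < e / 2 := by
    have q0 : 0 ≤ ∫ x, V.ρ x * d n x ^ 2 := by
      refine integral_nonneg_of_ae ?_
      filter_upwards [V.ρpos] with x hx using mul_nonneg hx.le (sq_nonneg _)
    have := hn0 n hn
    rw [lt_div_iff₀ (by positivity)] at this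
    nlinarith [mul_nonneg hC M0]
  linarith

end VP

/-- weighted measure -/
def wm (r : Euc N → ℝ) : Measure (Euc N) := volume.withDensity (fun x => ENNReal.ofReal (r x))

section wm
variable {r : Euc N → ℝ}

lemma wm_ac (hr : Measurable r) (hp : ∀ᵐ x, 0 < r x) : (volume : Measure (Euc N)) ≪ wm r := by
  refine withDensity_absolutelyContinuous' hr.ennreal_ofReal.aemeasurable ?_
  filter_upwards [hp] with x hx
  simpa using hx

lemma wm_ac' : wm r ≪ (volume : Measure (Euc N)) := withDensity_absolutelyContinuous _ _

lemma wm_ae (hr : Measurable r) (hp : ∀ᵐ x, 0 < r x) {P : Euc N → Prop} : (∀ᵐ x ∂wm r, P x) ↔ ∀ᵐ x, P x :=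
  ⟨fun h => (wm_ac hr hp).ae_le h, fun h => (wm_ac' (r := r)).ae_le h⟩

lemma wm_int (hr : Measurable r) (hp : ∀ᵐ x, 0 < r x) {g : Euc N → ℝ} : Integrable g (wm r) ↔ Integrable (fun x => r x * g x) := by
  unfold wm
  rw [integrable_withDensity_iff_integrable_smul' hr.ennreal_ofReal (ae_of_all _ fun x => by simp)]
  refine integrable_congr ?_
  filter_upwards [hp] with x hx
  rw [ENNReal.toReal_ofReal hx.le, smul_eq_mul]

lemma wm_integral (hr : Measurable r) (hp : ∀ᵐ x, 0 < r x) {g : Euc N → ℝ} : ∫ x, g x ∂(wm r) = ∫ x, r x * g x := by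
  unfold wm
  rw [integral_withDensity_eq_integral_toReal_smul hr.ennreal_ofReal (ae_of_all _ fun x => by simp)]
  refine integral_congr_ae ?_
  filter_upwards [hp] with x hx
  rw [ENNReal.toReal_ofReal hx.le, smul_eq_mul]

lemma wm_aesm (hr : Measurable r) (hp : ∀ᵐ x, 0 < r x) {g : Euc N → ℝ} :
    AEStronglyMeasurable g (wm r) ↔ AEStronglyMeasurable g volume :=
  ⟨fun h => h.mono_ac (wm_ac hr hp), fun h => h.mono_ac (wm_ac' (r := r))⟩

/-- completeness of the weighted L² space -/
lemma wm_complete (hr : Measurable r) (hp : ∀ᵐ x, 0 < r x) {φ : ℕ → Euc N → ℝ} (hm : ∀ n, AEStronglyMeasurable (φ n) volume)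
    (hi : ∀ n, Integrable (fun x => r x * φ n x ^ 2)) {e : ℕ → ℝ} (he : Tendsto e atTop (𝓝 0))
    (hc : ∀ n k, ∫ x, r x * (φ n x - φ k x) ^ 2 ≤ e n + e k) :
    ∃ w : Euc N → ℝ, AEStronglyMeasurable w volume ∧ Integrable (fun x => r x * w x ^ 2) ∧
      (∀ n, Integrable (fun x => r x * (φ n x - w x) ^ 2)) ∧
      Tendsto (fun n => ∫ x, r x * (φ n x - w x) ^ 2) atTop (𝓝 0) := by
  have hL : ∀ n, MemLp (φ n) 2 (wm r) := fun n =>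
    (memLp_two_iff_integrable_sq ((wm_aesm hr hp).2 (hm n))).2 ((wm_int hr hp).2 (hi n))
  have nsq : ∀ F : Lp ℝ 2 (wm r), ‖F‖ ^ 2 = ∫ x, r x * (F x) ^ 2 := by
    intro F
    rw [← real_inner_self_eq_norm_sq, L2.inner_def, wm_integral hr hp]
    congr 1; funext x
    simp [sq]
  have dsq : ∀ n (G : Lp ℝ 2 (wm r)), ‖(hL n).toLp - G‖ ^ 2 = ∫ x, r x * (φ n x - G x) ^ 2 := by
    intro n G
    rw [nsq]
    refine integral_congr_ae ?_
    have h1 := (wm_ae hr hp).1 (Lp.coeFn_sub (hL n).toLp G)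
    have h2 := (wm_ae hr hp).1 (hL n).coeFn_toLp
    filter_upwards [h1, h2] with x a b
    rw [a, Pi.sub_apply, b]
  have dsq2 : ∀ n k, ‖(hL n).toLp - (hL k).toLp‖ ^ 2 = ∫ x, r x * (φ n x - φ k x) ^ 2 := by
    intro n k
    rw [dsq]
    refine integral_congr_ae ?_
    filter_upwards [(wm_ae hr hp).1 (hL k).coeFn_toLp] with x b
    rw [b]
  have cs : CauchySeq (fun n => (hL n).toLp) := by
    rw [Metric.cauchySeq_iff]
    intro δ hδ
    obtain ⟨n0, hn0⟩ := eventually_atTop.1 (he.eventually_lt_const (by positivity : 0 < δ ^ 2 / 2))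
    refine ⟨n0, fun n hn k hk => ?_⟩
    rw [dist_eq_norm]
    refine lt_of_pow_lt_pow_left₀ 2 hδ.le ?_
    rw [dsq2]
    have := hc n k
    have := hn0 n hn
    have := hn0 k hk
    linarith
  obtain ⟨w, hw⟩ := cauchySeq_tendsto_of_complete cs
  have iw : ∀ F : Lp ℝ 2 (wm r), Integrable (fun x => r x * F x ^ 2) := fun F =>
    (wm_int hr hp).1 ((memLp_two_iff_integrable_sq (Lp.memLp F).1).1 (Lp.memLp F))
  refine ⟨w, (wm_aesm hr hp).1 (Lp.memLp w).1, iw w, fun n => ?_, ?_⟩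
  · refine (iw ((hL n).toLp - w)).congr ?_
    have h1 := (wm_ae hr hp).1 (Lp.coeFn_sub (hL n).toLp w)
    have h2 := (wm_ae hr hp).1 (hL n).coeFn_toLp
    filter_upwards [h1, h2] with x a b
    rw [a, Pi.sub_apply, b]
  · have : Tendsto (fun n => ‖(hL n).toLp - w‖ ^ 2) atTop (𝓝 0) := by
      have := (tendsto_iff_norm_sub_tendsto_zero.1 hw).pow 2
      simpa using this
    simpa only [dsq] using this

end wm

lemma zero_of_pert {L A A' α : ℝ} (hα : 0 < α)
    (h : ∀ s : ℝ, 0 ≤ s * L + s ^ 2 * A + |s| ^ (1 + α) * A') : L = 0 := by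
  have key : ∀ L' : ℝ, (∀ s : ℝ, 0 < s → 0 ≤ s * L' + s ^ 2 * A + s ^ (1 + α) * A') → 0 ≤ L' := by
    intro L' h'
    have l : Tendsto (fun s : ℝ => L' + s * A + s ^ α * A') (𝓝[>] 0) (𝓝 (L' + 0 * A + 0 ^ α * A')) := by
      refine Tendsto.mono_left ?_ nhdsWithin_le_nhds
      have : Continuous (fun s : ℝ => L' + s * A + s ^ α * A') := by
        have := Real.continuous_rpow_const hα.le
        fun_prop
      exact this.tendsto 0
    rw [Real.zero_rpow hα.ne'] at l
    have : 0 ≤ L' + 0 * A + 0 * A' := by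
      refine ge_of_tendsto l ?_
      filter_upwards [self_mem_nhdsWithin] with s hs
      have hs : 0 < s := hs
      have := h' s hs
      rw [Real.rpow_add hs, Real.rpow_one] at this
      by_contra hc
      rw [not_le] at hc
      have := mul_neg_of_pos_of_neg hs hc
      nlinarith
    simpa using this
  refine le_antisymm ?_ (key L fun s hs => ?_)
  · have := key (-L) fun s hs => ?_
    · linarith
    · have := h (-s)
      rw [abs_neg, abs_of_pos hs] at this
      nlinarith
  · have := h s
    rwa [abs_of_pos hs] at this

namespace VP
variable (V : VP N)

/-- the variational problem has a weak solution -/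
theorem exists_sol : ∃ w : Euc N → ℝ, AEStronglyMeasurable w volume ∧
    Integrable (fun x => V.ρ x * w x ^ 2) ∧
    ∀ η, TF η → V.Lin w η = 0 := by
  set S : Set ℝ := V.J '' {φ | TF φ} with hS
  have Sne : S.Nonempty := ⟨_, (fun _ => 0), ⟨contDiff_const, HasCompactSupport.zero⟩, rfl⟩
  have Sb : BddBelow S := ⟨_, by rintro _ ⟨φ, hφ, rfl⟩; exact V.J_bdd hφ⟩
  set I := sInf S with hI
  have lo : ∀ φ, TF φ → I ≤ V.J φ := fun φ hφ => csInf_le Sb ⟨φ, hφ, rfl⟩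
  have ex : ∀ n : ℕ, ∃ φ, TF φ ∧ V.J φ < I + 1 / (n + 1 : ℝ) := by
    intro n
    obtain ⟨_, ⟨φ, hφ, rfl⟩, h⟩ := exists_lt_of_csInf_lt Sne
      (show sInf S < I + 1 / (n + 1 : ℝ) by
        rw [← hI]
        have : (0 : ℝ) < 1 / (n + 1 : ℝ) := by positivity
        linarith)
    exact ⟨φ, hφ, h⟩
  choose φ hφ hJ using ex
  have hε := V.ε0
  have lim0 : Tendsto (fun n : ℕ => 1 / (n + 1 : ℝ)) atTop (𝓝 0) := tendsto_one_div_add_atTop_nhds_zero_nat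
  obtain ⟨w, wm_, w2, wd, wl⟩ := wm_complete V.ρm V.ρpos (φ := φ)
    (e := fun n => 4 / V.ε * (1 / (n + 1 : ℝ)))
    (fun n => (hφ n).cont.aestronglyMeasurable)
    (fun n => by simpa only [sq] using V.int2 (hφ n) (hφ n))
    (by simpa using lim0.const_mul (4 / V.ε))
    (by
      intro n k
      have h1 := V.J_par (hφ n) (hφ k)
      have h2 := lo _ ((hφ n).lin (hφ k) (1 / 2) (1 / 2))
      have h3 := hJ n
      have h4 := hJ k
      have e1 : (∫ x, V.ρ x * (φ n x - φ k x) ^ 2) =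
          ∫ x, V.ρ x * ((1 * φ n x + -1 * φ k x) * (1 * φ n x + -1 * φ k x)) := by
        congr 1; funext x; ring
      rw [← e1] at h1
      have h5 : V.ε / 8 * (∫ x, V.ρ x * (φ n x - φ k x) ^ 2)
          ≤ 1 / 2 * (1 / (n + 1 : ℝ)) + 1 / 2 * (1 / (k + 1 : ℝ)) := by linarith
      have h6 := mul_le_mul_of_nonneg_left h5 (by positivity : 0 ≤ 8 / V.ε)
      have h7 : 8 / V.ε * (V.ε / 8 * (∫ x, V.ρ x * (φ n x - φ k x) ^ 2))
        = ∫ x, V.ρ x * (φ n x - φ k x) ^ 2 := by field_simp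
      rw [h7] at h6
      refine h6.trans (le_of_eq ?_)
      ring)
  refine ⟨w, wm_, w2, fun η hη => ?_⟩
  obtain ⟨M, M0, hM⟩ := hη.bdd
  obtain ⟨R, R0, hR⟩ := ball_of_TF hη.2
  have hlapc := lap_continuous hη.c2
  -- bound by squares
  have sq1 : ∀ τ > 0, ∃ C, 0 ≤ C ∧ ∀ n x, |φ n x - w x| ≤ τ + C * (φ n x - w x) ^ 2 := by
    intro τ hτ
    refine ⟨1 / τ, by positivity, fun n x => ?_⟩
    set d := |φ n x - w x|
    rw [← sq_abs (φ n x - w x)]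
    rw [← sub_nonneg, show τ + 1 / τ * d ^ 2 - d = ((d - τ / 2) ^ 2 + 3 / 4 * τ ^ 2) / τ by field_simp; ring]
    positivity
  have sq2 : ∀ τ > 0, ∃ C, 0 ≤ C ∧ ∀ n x, |V.b (φ n x) - V.b (w x)| ≤ τ + C * (φ n x - w x) ^ 2 := by
    intro τ hτ
    have hL1 : 0 < V.L + 1 := by linarith [V.L0]
    -- choose δ with L δ^α ≤ τ
    set δ := (τ / (V.L + 1)) ^ (1 / V.α) with hδ
    have δ0 : 0 < δ := Real.rpow_pos_of_pos (by positivity) _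
    have hδα : δ ^ V.α = τ / (V.L + 1) := by
      rw [hδ, ← Real.rpow_mul (by positivity), one_div_mul_cancel V.α0.ne', Real.rpow_one]
    refine ⟨V.L * (τ / (V.L + 1)) / δ ^ 2, by have := V.L0; positivity, fun n x => ?_⟩
    refine (V.hol _ _).trans ?_
    set d := |φ n x - w x| with hd
    have d0 : 0 ≤ d := abs_nonneg _
    rw [← sq_abs (φ n x - w x), ← hd]
    have g1 : V.L * (τ / (V.L + 1)) ≤ τ := by
      rw [mul_div_assoc', div_le_iff₀ hL1]; nlinarith
    rcases le_total d δ with c | c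
    · have h1 : d ^ V.α ≤ δ ^ V.α := Real.rpow_le_rpow d0 c V.α0.le
      rw [hδα] at h1
      have := mul_le_mul_of_nonneg_left h1 V.L0
      have h2 : 0 ≤ V.L * (τ / (V.L + 1)) / δ ^ 2 * d ^ 2 := by have := V.L0; positivity
      linarith
    · have h1 : d ^ V.α ≤ δ ^ V.α * (d / δ) ^ 2 := by
        have r1 : 1 ≤ d / δ := (one_le_div δ0).2 c
        have : d = δ * (d / δ) := by field_simp
        nth_rewrite 1 [this]
        rw [Real.mul_rpow δ0.le (by positivity)]
        refine mul_le_mul_of_nonneg_left ?_ (by positivity)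
        rw [← Real.rpow_natCast]
        exact Real.rpow_le_rpow_of_exponent_le r1 (by push_cast; linarith [V.α1])
      rw [hδα] at h1
      have := mul_le_mul_of_nonneg_left h1 V.L0
      have e : V.L * (τ / (V.L + 1) * (d / δ) ^ 2) = V.L * (τ / (V.L + 1)) / δ ^ 2 * d ^ 2 := by
        field_simp
      linarith
  have iη : Integrable (fun x => V.ρ x * |η x|) := V.intC hη.cont.abs hη.2.abs
  have c1 := V.small (d := fun n x => φ n x - w x) (G := fun n x => φ n x - w x) wd wl sq1
    (ae_of_all _ fun x => (hM x).1) iη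
  have c2 := V.small (d := fun n x => φ n x - w x) (G := fun n x => V.b (φ n x) - V.b (w x)) wd wl sq2
    (ae_of_all _ fun x => (hM x).1) iη
  have c3 := V.small (d := fun n x => φ n x - w x) (G := fun n x => φ n x - w x)
    (Θ := fun x => lap η x / V.ρ x) (M := M * (|V.Cr| * (1 + R ^ 2))) wd wl sq1
    (by
      filter_upwards [V.ρpos, V.ρinv] with x hx hi
      by_cases hxR : x ∈ ball (0 : Euc N) R
      · rw [abs_div, abs_of_pos hx, div_le_iff₀ hx, mul_assoc]
        refine (hM x).2.trans (le_mul_of_one_le_right M0 (hi.trans ?_))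
        refine mul_le_mul_of_nonneg_right ?_ hx.le
        have s1 : sg x ≤ 1 + R ^ 2 := by
          simp only [mem_ball, dist_zero_right] at hxR
          unfold sg
          have := pow_le_pow_left₀ (norm_nonneg x) hxR.le 2
          linarith
        exact mul_le_mul (le_abs_self _) s1 (sg_pos x).le (abs_nonneg _)
      · rw [(hR x hxR).2]; simp; positivity)
    (by
      refine (hlapc.abs.integrable_of_hasCompactSupport (lap_support hη.2).abs).congr ?_
      filter_upwards [V.ρpos] with x hx
      rw [abs_div, abs_of_pos hx]; field_simp)
  have wl1 : LocallyIntegrable (fun x => V.ρ x * w x) := by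
    have : LocallyIntegrable (fun x => V.ρ x + V.ρ x * w x ^ 2) := V.ρloc.add w2.locallyIntegrable
    refine this.mono (V.ρm.aestronglyMeasurable.mul wm_) ?_
    filter_upwards [V.ρpos] with x hx
    rw [Real.norm_eq_abs, Real.norm_eq_abs, abs_mul, abs_of_pos hx,
      abs_of_nonneg (by positivity : 0 ≤ V.ρ x + V.ρ x * w x ^ 2)]
    have : |w x| ≤ 1 + w x ^ 2 := by nlinarith [sq_nonneg (|w x| - 1), sq_abs (w x), abs_nonneg (w x)]
    nlinarith
  have wl2 : LocallyIntegrable (fun x => V.ρ x * V.b (w x)) := by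
    have hL := V.L0
    have : LocallyIntegrable (fun x => V.L * V.ρ x + V.L * (V.ρ x * w x ^ 2)) :=
      LocallyIntegrable.add (V.ρloc.smul V.L) (w2.locallyIntegrable.smul V.L)
    refine this.mono (V.ρm.aestronglyMeasurable.mul (V.bc.comp_aestronglyMeasurable wm_)) ?_
    filter_upwards [V.ρpos] with x hx
    rw [Real.norm_eq_abs, Real.norm_eq_abs, abs_mul, abs_of_pos hx,
      abs_of_nonneg (by positivity : 0 ≤ V.L * V.ρ x + V.L * (V.ρ x * w x ^ 2))]
    have h1 := V.hol (w x) 0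
    rw [V.b0, sub_zero, sub_zero] at h1
    have h2 : |w x| ^ V.α ≤ 1 + w x ^ 2 := by
      rcases le_total |w x| 1 with c | c
      · have := Real.rpow_le_one (abs_nonneg (w x)) c V.α0.le
        nlinarith [sq_nonneg (w x)]
      · have := Real.rpow_le_rpow_of_exponent_le c (show V.α ≤ (2 : ℕ) by push_cast; linarith [V.α1])
        rw [Real.rpow_natCast, sq_abs] at this
        linarith
    have h3 := h1.trans (mul_le_mul_of_nonneg_left h2 hL)
    nlinarith [mul_le_mul_of_nonneg_left h3 hx.le]
  have wl3 : LocallyIntegrable (fun x => V.ρ x * V.f x) := V.floc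
  have wlw : Integrable (fun x => w x * lap η x) := by
    have := (locInt_mul wl1 hlapc (lap_support hη.2)).const_mul (|V.Cr| * (1 + R ^ 2))
    refine this.mono (wm_.mul hlapc.aestronglyMeasurable) ?_
    filter_upwards [V.ρpos, V.ρinv] with x hx hi
    by_cases hxR : x ∈ ball (0 : Euc N) R
    · have s1 : sg x ≤ 1 + R ^ 2 := by
        simp only [mem_ball, dist_zero_right] at hxR
        unfold sg
        have := pow_le_pow_left₀ (norm_nonneg x) hxR.le 2
        linarith
      have s2 : 1 ≤ (|V.Cr| * (1 + R ^ 2)) * V.ρ x := hi.trans <|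
        mul_le_mul_of_nonneg_right (mul_le_mul (le_abs_self _) s1 (sg_pos x).le (abs_nonneg _)) hx.le
      rw [Real.norm_eq_abs, Real.norm_eq_abs,
        show |V.Cr| * (1 + R ^ 2) * (V.ρ x * w x * lap η x)
          = (|V.Cr| * (1 + R ^ 2)) * V.ρ x * (w x * lap η x) by ring, abs_mul (_ * V.ρ x)]
      exact le_mul_of_one_le_left (abs_nonneg _) (s2.trans (le_abs_self _))
    · rw [(hR x hxR).2]; simp
  -- convergence of Lin
  have limL : Tendsto (fun n => V.Lin (φ n) η) atTop (𝓝 (V.Lin w η)) := by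
    have t1 : Tendsto (fun n => ∫ x, V.ρ x * (φ n x * η x)) atTop (𝓝 (∫ x, V.ρ x * (w x * η x))) := by
      rw [← tendsto_sub_nhds_zero_iff]
      refine c1.congr fun n => ?_
      have j2 : Integrable (fun x => V.ρ x * (w x * η x)) := by
        simpa only [mul_assoc] using locInt_mul wl1 hη.cont hη.2
      rw [← integral_sub (V.int2 (hφ n) hη) j2]
      congr 1; funext x; ring
    have t2 : Tendsto (fun n => ∫ x, V.ρ x * (V.b (φ n x) * η x)) atTop
        (𝓝 (∫ x, V.ρ x * (V.b (w x) * η x))) := by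
      rw [← tendsto_sub_nhds_zero_iff]
      refine c2.congr fun n => ?_
      have j2 : Integrable (fun x => V.ρ x * (V.b (w x) * η x)) := by
        simpa only [mul_assoc] using locInt_mul wl2 hη.cont hη.2
      have j1 : Integrable (fun x => V.ρ x * (V.b (φ n x) * η x)) :=
        V.intC ((V.bc.comp (hφ n).cont).mul hη.cont) hη.2.mul_left
      rw [← integral_sub j1 j2]
      congr 1; funext x; ring
    have t3 : Tendsto (fun n => ∫ x, φ n x * lap η x) atTop (𝓝 (∫ x, w x * lap η x)) := by
      rw [← tendsto_sub_nhds_zero_iff]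
      refine c3.congr fun n => ?_
      rw [← integral_sub (int_mul (hφ n).cont hlapc (lap_support hη.2)) wlw]
      refine integral_congr_ae ?_
      filter_upwards [V.ρpos] with x hx
      field_simp
    unfold Lin
    exact (((t3.const_mul V.h).neg.add t2).add (t1.const_mul V.ε)).sub tendsto_const_nhds
  refine zero_of_pert V.α0 (A := V.h / 2 * En η + V.ε / 2 * ∫ x, V.ρ x * (η x * η x))
    (A' := V.L * ∫ x, V.ρ x * |η x| ^ (1 + V.α)) fun s => ?_
  have ineq : ∀ n : ℕ, -(1 / (n + 1 : ℝ)) ≤ s * V.Lin (φ n) η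
      + s ^ 2 * (V.h / 2 * En η + V.ε / 2 * ∫ x, V.ρ x * (η x * η x))
      + |s| ^ (1 + V.α) * (V.L * ∫ x, V.ρ x * |η x| ^ (1 + V.α)) := by
    intro n
    have a1 := V.J_var (hφ n) hη s
    have a2 := lo _ ((hφ n).lin hη 1 s)
    have a3 := hJ n
    linarith
  have l1 : Tendsto (fun n : ℕ => -(1 / (n + 1 : ℝ))) atTop (𝓝 0) := by simpa using lim0.neg
  exact le_of_tendsto_of_tendsto' l1 (((limL.const_mul s).add_const _).add_const _) ineq

end VP

end Blow

end

end

section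
open MeasureTheory Metric Filter Set ENNReal
open scoped Topology ContDiff
noncomputable section
namespace Blow
variable {N : ℕ}

/-- The data of the rescaled problem. -/
structure Dat (N : ℕ) where
  m : ℝ
  c : ℝ
  p : ℝ
  Cr : ℝ
  C1 : ℝ
  ρ : Euc N → ℝ
  W : Euc N → ℝ
  W1 : Euc N → ℝ
  hN : 3 ≤ N
  hm : 1 < m
  hc : 0 < c
  hp : 0 < p
  hC1 : 0 ≤ C1
  ρm : Measurable ρ
  ρpos : ∀ᵐ x, 0 < ρ x
  ρloc : LocallyIntegrable ρ
  ρinv : ∀ᵐ x, 1 ≤ Cr * sg x * ρ x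
  Wm : Measurable W
  W1m : Measurable W1
  Wpos : ∀ x, 0 < W x
  W1pos : ∀ x, 0 < W1 x
  hord : ∀ᵐ x, W1 x ≤ W x
  Wpow : ∀ᵐ x, W x ^ (m - 1) ≤ C1 * sg x * ρ x
  Wint : Integrable (fun x => ρ x * sg x ^ (-p) * W x)
  Wloc : ∀ R : ℝ, ∃ C : ℝ, ∀ᵐ x, x ∈ ball (0 : Euc N) R → W x ≤ C
  Weq : ∀ φ, TF φ → ∫ x, W x ^ m * lap φ x = ∫ x, ρ x * (c * W x) * φ x
  W1eq : ∀ φ, TF φ → ∫ x, W1 x ^ m * lap φ x = ∫ x, ρ x * (c * W1 x) * φ x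

lemma pow_diff {m a b W : ℝ} (hm : 1 < m) (hb : 0 ≤ b) (hab : b ≤ a) (haW : a ≤ W) :
    a ^ m - b ^ m ≤ m * W ^ (m - 1) * (a - b) := by
  rcases eq_or_lt_of_le (hb.trans hab) with h | h
  · have : b = 0 := le_antisymm (by linarith) hb
    rw [← h, this]; simp
  · have h1 := one_add_mul_self_le_rpow_one_add (s := b / a - 1) (p := m)
      (by have : 0 ≤ b / a := by positivity
          linarith) hm.le
    have h2 : b ^ m = a ^ m * (1 + (b / a - 1)) ^ m := by
      rw [← Real.mul_rpow h.le (by simp; positivity)]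
      congr 1; field_simp; ring
    have h3 : a ^ m = a ^ (m - 1) * a := by
      rw [← Real.rpow_add_one h.ne']; congr 1; ring
    have h4 : a ^ (m - 1) ≤ W ^ (m - 1) := Real.rpow_le_rpow h.le haW (by linarith)
    have h5 : a ^ m - b ^ m ≤ m * a ^ (m - 1) * (a - b) := by
      have : a ^ m * (1 + m * (b / a - 1)) ≤ b ^ m := by
        rw [h2]; exact mul_le_mul_of_nonneg_left h1 (by positivity)
      have e : a ^ m * (1 + m * (b / a - 1)) = a ^ m - m * a ^ (m - 1) * (a - b) := by
        rw [h3]; field_simp; ring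
      linarith
    refine h5.trans ?_
    gcongr

lemma loc_of_int {g : Euc N → ℝ} {q : ℝ} (h : Integrable (fun x => g x * sg x ^ q)) :
    LocallyIntegrable g := by
  have h1 := h.locallyIntegrable
  have h2 : LocallyIntegrable (fun x => (sg x ^ (-q)) • (g x * sg x ^ q)) := by
    rw [← locallyIntegrableOn_univ] at h1 ⊢
    exact h1.continuousOn_smul isOpen_univ.isLocallyClosed (sgpow_cont (-q)).continuousOn
  refine h2.congr (ae_of_all _ fun x => ?_)
  have := Real.rpow_pos_of_pos (sg_pos x) q
  simp only [smul_eq_mul]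
  rw [Real.rpow_neg (sg_pos x).le]; field_simp

namespace Dat
variable (D : Dat N)

def w (x : Euc N) : ℝ := D.ρ x * sg x ^ (-D.p)

lemma wmeas : Measurable D.w := D.ρm.mul (sgpow_cont _).measurable
lemma wpos : ∀ᵐ x, 0 < D.w x := by
  filter_upwards [D.ρpos] with x h
  exact mul_pos h (Real.rpow_pos_of_pos (sg_pos x) _)

/-- Sub-range condition. -/
def Rg (v : Euc N → ℝ) : Prop := AEStronglyMeasurable v volume ∧ ∀ᵐ x, 0 ≤ v x ∧ v x ≤ D.W x

structure Pair (v a : Euc N → ℝ) : Prop where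
  rg : D.Rg v
  am : AEStronglyMeasurable a volume
  ai : Integrable (fun x => D.w x * a x)
  eq : ∀ φ, TF φ → ∫ x, v x ^ D.m * lap φ x = ∫ x, D.ρ x * (D.c * v x - a x) * φ x

variable {D}

lemma Rg.int {v : Euc N → ℝ} (h : D.Rg v) : Integrable (fun x => D.w x * v x) := by
  refine D.Wint.mono (D.wmeas.aestronglyMeasurable.mul h.1) ?_
  filter_upwards [h.2, D.wpos] with x hx hw
  have hw' : 0 < D.ρ x * sg x ^ (-D.p) := hw
  rw [Real.norm_of_nonneg (by have := hx.1; positivity), Real.norm_of_nonneg (by have := D.Wpos x; positivity)]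
  exact mul_le_mul_of_nonneg_left hx.2 hw.le

lemma Rg.powm {v : Euc N → ℝ} (h : D.Rg v) : AEStronglyMeasurable (fun x => v x ^ D.m) volume :=
  (h.1.aemeasurable.pow_const _).aestronglyMeasurable

lemma pow_bd {v : Euc N → ℝ} (h : D.Rg v) : ∀ᵐ x, v x ^ D.m ≤ D.C1 * sg x * D.ρ x * D.W x := by
  filter_upwards [h.2, D.Wpow] with x hx hw
  have := Real.rpow_le_rpow hx.1 hx.2 (by have := D.hm; linarith : 0 ≤ D.m)
  refine this.trans ?_
  have e : D.W x ^ D.m = D.W x ^ (D.m - 1) * D.W x := by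
    rw [← Real.rpow_add_one (D.Wpos x).ne']; congr 1; ring
  rw [e]
  exact mul_le_mul_of_nonneg_right hw (D.Wpos x).le

lemma Rg.powint {v : Euc N → ℝ} (h : D.Rg v) :
    Integrable (fun x => v x ^ D.m * sg x ^ (-D.p - 1)) := by
  refine (D.Wint.const_mul D.C1).mono (h.powm.mul (sgpow_cont _).aestronglyMeasurable) ?_
  filter_upwards [h.2, pow_bd h, D.ρpos] with x hx hb hρ
  have s := Real.rpow_pos_of_pos (sg_pos x) (-D.p)
  have s0 := sg_pos x
  have s1 := Real.rpow_pos_of_pos (sg_pos x) (-D.p - 1)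
  have h1 := D.hC1
  have h2 := (D.Wpos x).le
  have h3 := Real.rpow_nonneg hx.1 D.m
  rw [Real.norm_of_nonneg (by positivity), Real.norm_of_nonneg (by positivity)]
  calc v x ^ D.m * sg x ^ (-D.p - 1) ≤ D.C1 * sg x * D.ρ x * D.W x * sg x ^ (-D.p - 1) := by gcongr
    _ = D.C1 * (D.ρ x * (sg x ^ (-D.p - 1) * sg x) * D.W x) := by ring
    _ = _ := by rw [← Real.rpow_add_one s0.ne']; congr 4; ring

lemma Rg.powloc {v : Euc N → ℝ} (h : D.Rg v) : LocallyIntegrable (fun x => v x ^ D.m) :=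
  loc_of_int h.powint

lemma Wloc_of {a : Euc N → ℝ} (h : Integrable (fun x => D.w x * a x)) :
    LocallyIntegrable (fun x => D.ρ x * a x) := by
  refine loc_of_int (q := -D.p) (h.congr (ae_of_all _ fun x => ?_))
  simp only [w]; ring

lemma Pair.Fint {v a : Euc N → ℝ} (h : D.Pair v a) :
    Integrable (fun x => D.ρ x * (D.c * v x - a x) * sg x ^ (-D.p)) := by
  refine ((h.rg.int.const_mul D.c).sub h.ai).congr (ae_of_all _ fun x => ?_)
  simp only [w, Pi.sub_apply]; ring

lemma Pair.Floc {v a : Euc N → ℝ} (h : D.Pair v a) :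
    LocallyIntegrable (fun x => D.ρ x * (D.c * v x - a x)) := loc_of_int h.Fint

lemma RgW : D.Rg D.W := ⟨D.Wm.aestronglyMeasurable, ae_of_all _ fun x => ⟨(D.Wpos x).le, le_rfl⟩⟩
lemma RgW1 : D.Rg D.W1 := ⟨D.W1m.aestronglyMeasurable, by
  filter_upwards [D.hord] with x h using ⟨(D.W1pos x).le, h⟩⟩

lemma pairW : D.Pair D.W (fun _ => 0) where
  rg := RgW
  am := aestronglyMeasurable_const
  ai := by simp
  eq := fun φ hφ => by rw [D.Weq φ hφ]; simp

lemma pairW1 : D.Pair D.W1 (fun _ => 0) where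
  rg := RgW1
  am := aestronglyMeasurable_const
  ai := by simp
  eq := fun φ hφ => by rw [D.W1eq φ hφ]; simp

/-- The accretivity constant. -/
def om (D : Dat N) : ℝ := (lapL_bd (N := N) D.p D.hp).choose * (D.m * D.C1)

lemma om_nonneg : 0 ≤ D.om := by
  have := (lapL_bd (N := N) D.p D.hp).choose_spec.1
  have h1 := D.hm; have h2 := D.hC1
  unfold om
  have : 0 ≤ D.m := by linarith
  positivity

lemma acc_pos {v a v' a' : Euc N → ℝ} (P : D.Pair v a) (P' : D.Pair v' a') :
    -(D.om * ∫ x, D.w x * max (v x - v' x) 0)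
      ≤ ∫ x, D.w x * (sp (v x - v' x) * (a x - a' x)) := by
  obtain ⟨C0, -, hC⟩ := (lapL_bd (N := N) D.p D.hp).choose_spec
  set C := (lapL_bd (N := N) D.p D.hp).choose with hCdef
  set g : Euc N → ℝ := fun x => v x ^ D.m - v' x ^ D.m with hg
  set F : Euc N → ℝ := fun x => D.ρ x * (D.c * v x - a x) - D.ρ x * (D.c * v' x - a' x) with hF
  have gl : LocallyIntegrable g := P.rg.powloc.sub P'.rg.powloc
  have Fl : LocallyIntegrable F := P.Floc.sub P'.Floc
  have hspm : AEStronglyMeasurable (fun x => sp (g x)) volume :=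
    (meas_sp.comp_aemeasurable gl.aestronglyMeasurable.aemeasurable).aestronglyMeasurable
  have weak : ∀ φ, TF φ → ∫ x, g x * lap φ x = ∫ x, F x * φ x := by
    intro φ hφ
    have e1 : ∫ x, g x * lap φ x = (∫ x, v x ^ D.m * lap φ x) - ∫ x, v' x ^ D.m * lap φ x := by
      rw [← integral_sub (locInt_mul P.rg.powloc (lap_continuous hφ.c2) (lap_support hφ.2))
        (locInt_mul P'.rg.powloc (lap_continuous hφ.c2) (lap_support hφ.2))]
      exact integral_congr_ae (ae_of_all _ fun x => by simp only [hg]; ring)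
    have e2 : ∫ x, F x * φ x = (∫ x, D.ρ x * (D.c * v x - a x) * φ x) - ∫ x, D.ρ x * (D.c * v' x - a' x) * φ x := by
      rw [← integral_sub (locInt_mul P.Floc hφ.cont hφ.2) (locInt_mul P'.Floc hφ.cont hφ.2)]
      exact integral_congr_ae (ae_of_all _ fun x => by simp only [hF]; ring)
    rw [e1, e2, P.eq φ hφ, P'.eq φ hφ]
  have iH : Integrable (fun x => max (g x) 0 * sg x ^ (-D.p - 1)) := by
    refine ((P.rg.powint.sub P'.rg.powint).pos_part).congr (ae_of_all _ fun x => ?_)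
    have := Real.rpow_pos_of_pos (sg_pos x) (-D.p - 1)
    simp only [Pi.sub_apply, hg]
    rw [max_mul_of_nonneg _ _ this.le]; ring_nf
  have iF : Integrable (fun x => F x * sg x ^ (-D.p)) := by
    refine (P.Fint.sub P'.Fint).congr (ae_of_all _ fun x => ?_)
    simp only [Pi.sub_apply, hF]; ring
  have k := kato_lim D.hp hspm (fun x => by rw [abs_of_nonneg (sp_nonneg _)]; exact sp_le _)
    Fl.aestronglyMeasurable (gl.aestronglyMeasurable.aemeasurable.max aemeasurable_const).aestronglyMeasurable
    iF iH (fun χ hχ h0 => kato_pos gl Fl weak hχ h0)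
  have k2 := (le_abs_self _).trans (lapL_int_bd iH (C := C) hC)
  have imax : Integrable (fun x => D.w x * max (v x - v' x) 0) := by
    refine ((P.rg.int.sub P'.rg.int).pos_part).congr ?_
    filter_upwards [D.wpos] with x hx
    simp only [Pi.sub_apply]
    rw [mul_max_of_nonneg _ _ hx.le]; ring_nf
  have k3 : ∫ x, |max (g x) 0| * sg x ^ (-D.p - 1) ≤ (D.m * D.C1) * ∫ x, D.w x * max (v x - v' x) 0 := by
    rw [← integral_const_mul]
    refine integral_mono_ae (by simpa only [abs_of_nonneg (le_max_right _ (0:ℝ))] using iH) (imax.const_mul _) ?_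
    filter_upwards [P.rg.2, P'.rg.2, D.ρpos, D.Wpow] with x h h' hρ hw
    rw [abs_of_nonneg (le_max_right _ (0:ℝ))]
    have s1 := Real.rpow_pos_of_pos (sg_pos x) (-D.p - 1)
    have s2 := Real.rpow_pos_of_pos (sg_pos x) (-D.p)
    have m0 : 0 < D.m := by have := D.hm; linarith
    rcases le_total (v x) (v' x) with hl | hl
    · have : g x ≤ 0 := sub_nonpos.2 (Real.rpow_le_rpow h.1 hl m0.le)
      rw [max_eq_right this, max_eq_right (by linarith)]; simp
    · have h0 : 0 ≤ g x := sub_nonneg.2 (Real.rpow_le_rpow h'.1 hl m0.le)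
      rw [max_eq_left h0, max_eq_left (by linarith)]
      have h1 := pow_diff D.hm h'.1 hl h.2
      have h2 : m0.le.trans le_rfl = m0.le := rfl
      calc g x * sg x ^ (-D.p - 1) ≤ D.m * (D.C1 * sg x * D.ρ x) * (v x - v' x) * sg x ^ (-D.p - 1) := by
            refine mul_le_mul_of_nonneg_right (h1.trans ?_) s1.le
            refine mul_le_mul_of_nonneg_right ?_ (by linarith)
            exact mul_le_mul_of_nonneg_left hw m0.le
        _ = D.m * D.C1 * (D.ρ x * (sg x ^ (-D.p - 1) * sg x) * (v x - v' x)) := by ring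
        _ = _ := by rw [← Real.rpow_add_one (sg_pos x).ne', w]; congr 4; ring
  have k4 : ∫ x, sp (g x) * F x * sg x ^ (-D.p) =
      D.c * (∫ x, D.w x * max (v x - v' x) 0) - ∫ x, D.w x * (sp (v x - v' x) * (a x - a' x)) := by
    rw [← integral_const_mul, ← integral_sub (imax.const_mul _)]
    · refine integral_congr_ae ?_
      filter_upwards [P.rg.2, P'.rg.2] with x h h'
      have m0 : 0 < D.m := by have := D.hm; linarith
      simp only [hF, w]
      rcases lt_trichotomy (v x) (v' x) with hl | hl | hl
      · have : g x < 0 := sub_neg.2 (Real.rpow_lt_rpow h.1 hl m0)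
        rw [sp_neg this, sp_neg (by linarith), max_eq_right (by linarith)]; ring
      · have : g x = 0 := by simp only [hg, hl, sub_self]
        rw [this, hl]; simp; ring
      · have : 0 < g x := sub_pos.2 (Real.rpow_lt_rpow h'.1 hl m0)
        rw [sp_pos this, sp_pos (by linarith), max_eq_left (by linarith)]; ring
    · have i := P.ai.sub P'.ai
      have hs : AEStronglyMeasurable (fun x => sp (v x - v' x)) volume :=
        (meas_sp.comp_aemeasurable (P.rg.1.sub P'.rg.1).aemeasurable).aestronglyMeasurable
      refine i.mono (D.wmeas.aestronglyMeasurable.mul (hs.mul (P.am.sub P'.am))) (ae_of_all _ fun x => ?_)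
      simp only [Pi.sub_apply]
      rw [← mul_sub, norm_mul, norm_mul, norm_mul]
      gcongr
      rw [Real.norm_of_nonneg (sp_nonneg _)]
      exact mul_le_of_le_one_left (norm_nonneg _) (sp_le _)
  have e : D.om = C * (D.m * D.C1) := rfl
  rw [k4] at k
  have k5 := mul_le_mul_of_nonneg_left k3 C0
  rw [← mul_assoc, ← e] at k5
  have k6 : 0 ≤ D.c * ∫ x, D.w x * max (v x - v' x) 0 := by
    refine mul_nonneg D.hc.le (integral_nonneg_of_ae ?_)
    filter_upwards [D.wpos] with x hx
    exact mul_nonneg hx.le (le_max_right _ _)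
  linarith

lemma mulint {v b : Euc N → ℝ} (hb : AEStronglyMeasurable b volume) (hb1 : ∀ x, |b x| ≤ 1)
    (hm : AEStronglyMeasurable v volume) (h : Integrable (fun x => D.w x * v x)) :
    Integrable (fun x => D.w x * (b x * v x)) := by
  refine h.mono (D.wmeas.aestronglyMeasurable.mul (hb.mul hm)) (ae_of_all _ fun x => ?_)
  rw [norm_mul, norm_mul, norm_mul]
  gcongr
  exact mul_le_of_le_one_left (norm_nonneg _) (hb1 x)

lemma absint {v : Euc N → ℝ} (h : Integrable (fun x => D.w x * v x)) :
    Integrable (fun x => D.w x * |v x|) := by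
  refine h.abs.congr ?_
  filter_upwards [D.wpos] with x hx
  rw [abs_mul, abs_of_pos hx]

/-- the weighted L1 norm -/
def nm (D : Dat N) (v : Euc N → ℝ) : ℝ := ∫ x, D.w x * |v x|

lemma acc_abs {v a v' a' : Euc N → ℝ} (P : D.Pair v a) (P' : D.Pair v' a') :
    -(D.om * D.nm (fun x => v x - v' x)) ≤ ∫ x, D.w x * (Real.sign (v x - v' x) * (a x - a' x)) := by
  have h1 := acc_pos P P'
  have h2 := acc_pos P' P
  have hs : AEStronglyMeasurable (fun x => sp (v x - v' x)) volume :=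
    (meas_sp.comp_aemeasurable (P.rg.1.sub P'.rg.1).aemeasurable).aestronglyMeasurable
  have hs' : AEStronglyMeasurable (fun x => sp (v' x - v x)) volume :=
    (meas_sp.comp_aemeasurable (P'.rg.1.sub P.rg.1).aemeasurable).aestronglyMeasurable
  have ia : Integrable (fun x => D.w x * (a x - a' x)) := by
    refine (P.ai.sub P'.ai).congr (ae_of_all _ fun x => ?_); simp only [Pi.sub_apply]; ring
  have ia' : Integrable (fun x => D.w x * (a' x - a x)) := by
    refine (P'.ai.sub P.ai).congr (ae_of_all _ fun x => ?_); simp only [Pi.sub_apply]; ring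
  have spb : ∀ s, |sp s| ≤ 1 := fun s => by rw [abs_of_nonneg (sp_nonneg _)]; exact sp_le _
  have e1 : ∫ x, D.w x * (Real.sign (v x - v' x) * (a x - a' x)) =
      (∫ x, D.w x * (sp (v x - v' x) * (a x - a' x))) + ∫ x, D.w x * (sp (v' x - v x) * (a' x - a x)) := by
    rw [← integral_add (mulint (v := fun x => a x - a' x) hs (fun x => spb _) (P.am.sub P'.am) ia)
      (mulint (v := fun x => a' x - a x) hs' (fun x => spb _) (P'.am.sub P.am) ia')]
    refine integral_congr_ae (ae_of_all _ fun x => ?_)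
    have : v' x - v x = -(v x - v' x) := by ring
    simp only [sp, this, Real.sign_neg]; ring
  have imax : ∀ {u u' : Euc N → ℝ}, D.Rg u → D.Rg u' → Integrable (fun x => D.w x * max (u x - u' x) 0) := by
    intro u u' h h'
    refine ((h.int.sub h'.int).pos_part).congr ?_
    filter_upwards [D.wpos] with x hx
    simp only [Pi.sub_apply]
    rw [mul_max_of_nonneg _ _ hx.le]; ring_nf
  have e2 : D.nm (fun x => v x - v' x) =
      (∫ x, D.w x * max (v x - v' x) 0) + ∫ x, D.w x * max (v' x - v x) 0 := by
    rw [← integral_add (imax P.rg P'.rg) (imax P'.rg P.rg)]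
    refine integral_congr_ae (ae_of_all _ fun x => ?_)
    simp only
    rcases le_total (v x) (v' x) with h | h
    · rw [max_eq_right (by linarith), max_eq_left (by linarith), abs_of_nonpos (by linarith)]; ring
    · rw [max_eq_left (by linarith), max_eq_right (by linarith), abs_of_nonneg (by linarith)]; ring
  rw [e1, e2]; linarith

/-- Resolvent relation: `v = J_h u`. -/
def Res (D : Dat N) (h : ℝ) (u v : Euc N → ℝ) : Prop := D.Pair v (fun x => (u x - v x) / h)

lemma sign_mul_le (s t : ℝ) : Real.sign s * t ≤ |t| := by
  refine (le_abs_self _).trans ?_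
  rw [abs_mul]
  exact mul_le_of_le_one_left (abs_nonneg _) (abs_sign_le s)

lemma sign_mul_self' (s : ℝ) : Real.sign s * s = |s| := by
  rcases lt_trichotomy s 0 with h | h | h
  · rw [Real.sign_of_neg h, abs_of_neg h]; ring
  · rw [h]; simp
  · rw [Real.sign_of_pos h, abs_of_pos h]; ring

lemma subint {u v : Euc N → ℝ} (hu : D.Rg u) (hv : D.Rg v) : Integrable (fun x => D.w x * |u x - v x|) := by
  refine absint ((hu.int.sub hv.int).congr (ae_of_all _ fun x => ?_)); simp only [Pi.sub_apply]; ring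

lemma kob {l μ : ℝ} {x y v v' : Euc N → ℝ} (hl : 0 < l) (hμ : 0 < μ) (hx : D.Rg x) (hy : D.Rg y)
    (P : D.Res l x v) (P' : D.Res μ y v') :
    (l + μ - l * μ * D.om) * D.nm (fun z => v z - v' z)
      ≤ l * D.nm (fun z => v z - y z) + μ * D.nm (fun z => x z - v' z) := by
  have h := acc_abs P P'
  have i1 := (subint P.rg hy).const_mul l
  have i2 := (subint hx P'.rg).const_mul μ
  have i3 := (subint P.rg P'.rg).const_mul (l + μ)
  have h2 : l * μ * ∫ z, D.w z * (Real.sign (v z - v' z) * ((x z - v z) / l - (y z - v' z) / μ))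
      ≤ l * D.nm (fun z => v z - y z) + μ * D.nm (fun z => x z - v' z) - (l + μ) * D.nm (fun z => v z - v' z) := by
    simp only [nm]
    have j : Integrable (fun a => l * (D.w a * |v a - y a|) + μ * (D.w a * |x a - v' a|)) := i1.add i2
    simp only [← integral_const_mul]
    rw [← integral_add i1 i2, ← integral_sub j i3]
    refine integral_mono_ae ?_ (j.sub i3) ?_
    · refine Integrable.const_mul ?_ _
      refine mulint ((meas_sign.comp_aemeasurable (P.rg.1.sub P'.rg.1).aemeasurable).aestronglyMeasurable)
        (fun x => abs_sign_le _) (P.am.sub P'.am) ?_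
      refine (P.ai.sub P'.ai).congr (ae_of_all _ fun x => ?_); simp only [Pi.sub_apply]; ring
    · filter_upwards [D.wpos] with z hz
      set s := v z - v' z with hs
      have a1 := sign_mul_le s (v z - y z)
      have a2 := sign_mul_le s (x z - v' z)
      have a3 := sign_mul_self' s
      have e : l * μ * (D.w z * (Real.sign s * ((x z - v z) / l - (y z - v' z) / μ))) =
          D.w z * (l * (Real.sign s * (v z - y z)) + μ * (Real.sign s * (x z - v' z)) - (l + μ) * (Real.sign s * s)) := by
        rw [hs]; field_simp; ring
      rw [e, a3]
      have : l * (Real.sign s * (v z - y z)) + μ * (Real.sign s * (x z - v' z)) - (l + μ) * |s| ≤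
        l * |v z - y z| + μ * |x z - v' z| - (l + μ) * |s| := by gcongr
      calc _ ≤ D.w z * (l * |v z - y z| + μ * |x z - v' z| - (l + μ) * |s|) := mul_le_mul_of_nonneg_left this hz.le
        _ = _ := by ring
  have h3 := mul_le_mul_of_nonneg_left h (mul_pos hl hμ).le
  have h4 := h3.trans h2
  nlinarith [h4]

lemma contr {l : ℝ} {x y v v' : Euc N → ℝ} (hl : 0 < l) (hx : D.Rg x) (hy : D.Rg y)
    (P : D.Res l x v) (P' : D.Res l y v') :
    (1 - l * D.om) * D.nm (fun z => v z - v' z) ≤ D.nm (fun z => x z - y z) := by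
  have h := acc_abs P P'
  have i1 := (subint hx hy)
  have i3 := (subint P.rg P'.rg)
  have h2 : l * ∫ z, D.w z * (Real.sign (v z - v' z) * ((x z - v z) / l - (y z - v' z) / l))
      ≤ D.nm (fun z => x z - y z) - D.nm (fun z => v z - v' z) := by
    simp only [nm]
    rw [← integral_const_mul, ← integral_sub i1 i3]
    refine integral_mono_ae ?_ (i1.sub i3) ?_
    · refine Integrable.const_mul ?_ _
      refine mulint ((meas_sign.comp_aemeasurable (P.rg.1.sub P'.rg.1).aemeasurable).aestronglyMeasurable)
        (fun x => abs_sign_le _) (P.am.sub P'.am) ?_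
      refine (P.ai.sub P'.ai).congr (ae_of_all _ fun x => ?_); simp only [Pi.sub_apply]; ring
    · filter_upwards [D.wpos] with z hz
      set s := v z - v' z with hs
      have a1 := sign_mul_le s (x z - y z)
      have a3 := sign_mul_self' s
      have e : l * (D.w z * (Real.sign s * ((x z - v z) / l - (y z - v' z) / l))) =
          D.w z * ((Real.sign s * (x z - y z)) - (Real.sign s * s)) := by
        rw [hs]; field_simp; ring
      rw [e, a3]
      calc _ ≤ D.w z * (|x z - y z| - |s|) := mul_le_mul_of_nonneg_left (by linarith) hz.le
        _ = _ := by ring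
  have h3 := (mul_le_mul_of_nonneg_left h hl.le).trans h2
  nlinarith [h3]

lemma res_ge {l : ℝ} {x v : Euc N → ℝ} (hl : 0 < l) (hl1 : l * D.om < 1) (hx : D.Rg x)
    (hx1 : ∀ᵐ z, D.W1 z ≤ x z) (P : D.Res l x v) : ∀ᵐ z, D.W1 z ≤ v z := by
  have h := acc_pos pairW1 P
  have imax : Integrable (fun x => D.w x * max (D.W1 x - v x) 0) := by
    refine (((RgW1 (D := D)).int.sub P.rg.int).pos_part).congr ?_
    filter_upwards [D.wpos] with x hx
    simp only [Pi.sub_apply]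
    rw [mul_max_of_nonneg _ _ hx.le]; ring_nf
  set I := ∫ z, D.w z * max (D.W1 z - v z) 0 with hI
  have h2 : l * ∫ z, D.w z * (sp (D.W1 z - v z) * (0 - (x z - v z) / l)) ≤ - I := by
    rw [← integral_const_mul, hI, ← integral_neg]
    refine integral_mono_ae ?_ imax.neg ?_
    · refine Integrable.const_mul ?_ _
      refine mulint ((meas_sp.comp_aemeasurable ((RgW1 (D := D)).1.sub P.rg.1).aemeasurable).aestronglyMeasurable)
        (fun x => by rw [abs_of_nonneg (sp_nonneg _)]; exact sp_le _) (aestronglyMeasurable_const.sub P.am) ?_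
      refine P.ai.neg.congr (ae_of_all _ fun x => ?_); simp only [Pi.neg_apply]; ring
    · filter_upwards [D.wpos, hx1] with z hz hz1
      have e : l * (D.w z * (sp (D.W1 z - v z) * (0 - (x z - v z) / l))) = D.w z * (sp (D.W1 z - v z) * (v z - x z)) := by
        field_simp; ring
      rw [e, ← mul_neg]
      refine mul_le_mul_of_nonneg_left ?_ hz.le
      rcases lt_trichotomy (D.W1 z) (v z) with hl | hl | hl
      · rw [sp_neg (by linarith), max_eq_right (by linarith)]; simp
      · rw [hl, sub_self, sp_zero, max_self]; linarith
      · rw [sp_pos (by linarith), max_eq_left (by linarith)]; linarith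
  have h3 := (mul_le_mul_of_nonneg_left h hl.le).trans h2
  have h4 : 0 ≤ I := by
    refine integral_nonneg_of_ae ?_
    filter_upwards [D.wpos] with x hx
    exact mul_nonneg hx.le (le_max_right _ _)
  have h5 : I = 0 := by nlinarith
  rw [hI, integral_eq_zero_iff_of_nonneg_ae _ imax] at h5
  · filter_upwards [h5, D.wpos] with z hz hw
    simp only [Pi.zero_apply, mul_eq_zero, hw.ne', false_or] at hz
    have := le_max_left (D.W1 z - v z) 0
    linarith
  · filter_upwards [D.wpos] with x hx
    exact mul_nonneg hx.le (le_max_right _ _)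
end Dat
end Blow

end

end

section
open MeasureTheory Metric Filter Set ENNReal
open scoped Topology ContDiff
noncomputable section
namespace Blow
variable {N : ℕ}

/-- signed root -/
def be (α s : ℝ) : ℝ := Real.sign s * |s| ^ α

lemma be_nonneg_eq {α s : ℝ} (hα : 0 < α) (h : 0 ≤ s) : be α s = s ^ α := by
  rcases h.eq_or_lt with h | h
  · rw [← h]; simp [be, Real.zero_rpow hα.ne']
  · simp [be, Real.sign_of_pos h, abs_of_pos h]

lemma be_neg {α s : ℝ} : be α (-s) = - be α s := by simp [be, Real.sign_neg]

lemma be_strictMono {α : ℝ} (hα : 0 < α) : StrictMono (be α) := by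
  have hpos : ∀ {s t : ℝ}, 0 ≤ s → s < t → be α s < be α t := by
    intro s t h0 h
    rw [be_nonneg_eq hα h0, be_nonneg_eq hα (h0.trans h.le)]
    exact Real.rpow_lt_rpow h0 h hα
  have h00 : be α 0 = 0 := by simp [be]
  intro s t h
  rcases le_total 0 s with h0 | h0
  · exact hpos h0 h
  rcases le_total 0 t with h1 | h1
  · have a1 : be α s ≤ 0 := by
      have : 0 ≤ be α (-s) := by rw [be_nonneg_eq hα (by linarith)]; exact Real.rpow_nonneg (by linarith) _
      rw [be_neg] at this; linarith
    have a2 : 0 ≤ be α t := by rw [be_nonneg_eq hα h1]; exact Real.rpow_nonneg h1 _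
    rcases h0.eq_or_lt with h2 | h2
    · rw [h2]; exact hpos le_rfl (h2 ▸ h)
    · have := hpos le_rfl (neg_pos.2 h2)
      rw [be_neg, h00] at this
      linarith
  · have := hpos (neg_nonneg.2 h1) (neg_lt_neg h)
    rw [be_neg, be_neg] at this; linarith

lemma be_hol {α : ℝ} (hα : 0 < α) (hα1 : α < 1) (x y : ℝ) : |be α x - be α y| ≤ 2 * |x - y| ^ α := by
  have same : ∀ {x y : ℝ}, 0 ≤ y → y ≤ x → |be α x - be α y| ≤ 2 * |x - y| ^ α := by
    intro x y h0 h
    rw [be_nonneg_eq hα h0, be_nonneg_eq hα (h0.trans h), abs_of_nonneg (sub_nonneg.2 (Real.rpow_le_rpow h0 h hα.le)),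
      abs_of_nonneg (by linarith : (0:ℝ) ≤ x - y)]
    have := Real.rpow_add_le_add_rpow h0 (by linarith : 0 ≤ x - y) hα.le hα1.le
    rw [show y + (x - y) = x by ring] at this
    have h2 := Real.rpow_nonneg (by linarith : 0 ≤ x - y) α
    linarith
  have opp : ∀ {x y : ℝ}, y ≤ 0 → 0 ≤ x → |be α x - be α y| ≤ 2 * |x - y| ^ α := by
    intro x y h0 h
    have e : be α y = - (-y) ^ α := by
      rw [← be_nonneg_eq hα (by linarith : 0 ≤ -y), be_neg]; ring
    rw [e, be_nonneg_eq hα h, abs_of_nonneg (by linarith : (0:ℝ) ≤ x - y), sub_neg_eq_add, abs_of_nonneg (by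
      have := Real.rpow_nonneg h α
      have := Real.rpow_nonneg (by linarith : 0 ≤ -y) α
      linarith)]
    have a1 := Real.rpow_le_rpow h (by linarith : x ≤ x - y) hα.le
    have a2 := Real.rpow_le_rpow (by linarith : 0 ≤ -y) (by linarith : -y ≤ x - y) hα.le
    linarith
  have main : ∀ {x y : ℝ}, y ≤ x → |be α x - be α y| ≤ 2 * |x - y| ^ α := by
    intro x y h
    rcases le_total 0 y with h0 | h0
    · exact same h0 h
    rcases le_total 0 x with h1 | h1
    · exact opp h0 h1
    · have := same (neg_nonneg.2 h1) (neg_le_neg h)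
      rw [be_neg, be_neg] at this
      rw [show -be α y - -be α x = be α x - be α y by ring, show -y - -x = x - y by ring] at this
      exact this
  rcases le_total y x with h | h
  · exact main h
  · rw [abs_sub_comm, abs_sub_comm x]; exact main h

lemma be_cont {α : ℝ} (hα : 0 < α) (hα1 : α < 1) : Continuous (be α) := by
  rw [continuous_iff_continuousAt]
  intro x
  rw [ContinuousAt, tendsto_iff_norm_sub_tendsto_zero]
  refine squeeze_zero (fun _ => norm_nonneg _) (fun y => be_hol hα hα1 y x) ?_
  have : Continuous (fun y : ℝ => 2 * |y - x| ^ α) :=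
    continuous_const.mul ((continuous_abs.comp (continuous_id.sub continuous_const)).rpow_const (fun _ => Or.inr hα.le))
  have h := this.tendsto x
  simpa [Real.zero_rpow hα.ne'] using h

lemma be_conv {α : ℝ} (hα : 0 < α) (x y : ℝ) :
    |x| ^ (1 + α) / (1 + α) + be α x * (y - x) ≤ |y| ^ (1 + α) / (1 + α) := by
  have hq : (1 + α).HolderConjugate ((1 + α) / α) := by
    rw [Real.holderConjugate_iff]
    refine ⟨by linarith, ?_⟩
    field_simp
  have y1 := Real.young_inequality_of_nonneg (abs_nonneg y) (Real.rpow_nonneg (abs_nonneg x) α) hq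
  have e1 : (|x| ^ α) ^ ((1 + α) / α) = |x| ^ (1 + α) := by
    rw [← Real.rpow_mul (abs_nonneg x)]; congr 1; field_simp
  have e2 : be α x * x = |x| ^ (1 + α) := by
    rcases eq_or_ne x 0 with h | h
    · simp [h, be, Real.zero_rpow (by linarith : 1 + α ≠ 0)]
    · rw [be, add_comm, Real.rpow_add_one (abs_pos.2 h).ne', mul_right_comm, Dat.sign_mul_self']; ring
  have e3 : be α x * y ≤ |y| * |x| ^ α := by
    refine (le_abs_self _).trans ?_
    rw [be, abs_mul, abs_mul, abs_of_nonneg (Real.rpow_nonneg (abs_nonneg x) α)]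
    have := mul_le_mul_of_nonneg_right (abs_sign_le x) (mul_nonneg (Real.rpow_nonneg (abs_nonneg x) α) (abs_nonneg y))
    linarith
  rw [e1] at y1
  have e4 : |x| ^ (1 + α) / ((1 + α) / α) = |x| ^ (1 + α) - |x| ^ (1 + α) / (1 + α) := by
    field_simp; ring
  rw [mul_sub, e2]; linarith

namespace Dat
variable {D : Dat N}

lemma loc2 {w : Euc N → ℝ} (hw : AEStronglyMeasurable w volume) (h : Integrable (fun x => D.ρ x * w x ^ 2)) :
    LocallyIntegrable (fun x => D.ρ x * (1 + |w x|)) := by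
  refine ((D.ρloc.smul (2:ℝ)).add h.locallyIntegrable).mono
    (D.ρm.aestronglyMeasurable.mul (aestronglyMeasurable_const.add hw.norm)) ?_
  filter_upwards [D.ρpos] with x hx
  simp only [Pi.add_apply, Pi.smul_apply, smul_eq_mul]
  have : 0 ≤ w x ^ 2 := sq_nonneg _
  rw [Real.norm_of_nonneg (by positivity), Real.norm_of_nonneg (by positivity)]
  have : 1 + |w x| ≤ 2 + w x ^ 2 := by
    have : w x ^ 2 = |w x| ^ 2 := (sq_abs _).symm
    nlinarith [sq_nonneg (|w x| - 1), abs_nonneg (w x)]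
  nlinarith

lemma loc_inv {w : Euc N → ℝ} (hw : AEStronglyMeasurable w volume) (h : LocallyIntegrable (fun x => D.ρ x * (1 + |w x|))) :
    LocallyIntegrable w := by
  have h2 : LocallyIntegrable (fun x => (D.Cr * sg x) • (D.ρ x * (1 + |w x|))) := by
    rw [← locallyIntegrableOn_univ] at h ⊢
    exact h.continuousOn_smul isOpen_univ.isLocallyClosed (continuous_const.mul sg_cont).continuousOn
  refine h2.mono hw ?_
  filter_upwards [D.ρinv] with x hx
  rw [smul_eq_mul, ← mul_assoc]
  rw [Real.norm_eq_abs, Real.norm_of_nonneg (by positivity)]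
  nlinarith [abs_nonneg (w x)]

structure Sol (D : Dat N) (w Φ : Euc N → ℝ) : Prop where
  wl : LocallyIntegrable w
  Φl : LocallyIntegrable (fun x => D.ρ x * Φ x)
  eq : ∀ φ, TF φ → ∫ x, w x * lap φ x = ∫ x, D.ρ x * Φ x * φ x

lemma Sol.cmp {w Φ w' Φ' G : Euc N → ℝ} (S : D.Sol w Φ) (S' : D.Sol w' Φ')
    (hG : Integrable (fun x => D.ρ x * G x ^ 2)) (hgG : ∀ᵐ x, max (w x - w' x) 0 ≤ G x)
    (h0 : ∀ᵐ x, w' x ≤ w x → Φ' x ≤ Φ x) (h1 : ∀ᵐ x, w' x < w x → Φ' x < Φ x) : ∀ᵐ x, w x ≤ w' x := by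
  have := lemmaC D.hN (g := fun x => w x - w' x) (F := fun x => D.ρ x * Φ x - D.ρ x * Φ' x) D.ρpos D.ρinv
    (S.wl.sub S'.wl) (S.Φl.sub S'.Φl) ?_ hG hgG ?_ ?_
  · filter_upwards [this] with x hx
    linarith
  · intro φ hφ
    simp only [sub_mul]
    rw [integral_sub (locInt_mul S.wl (lap_continuous hφ.c2) (lap_support hφ.2))
        (locInt_mul S'.wl (lap_continuous hφ.c2) (lap_support hφ.2)),
        integral_sub (locInt_mul S.Φl hφ.cont hφ.2) (locInt_mul S'.Φl hφ.cont hφ.2), S.eq φ hφ, S'.eq φ hφ]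
  · filter_upwards [h0, D.ρpos] with x hx hr h
    have := hx (by linarith)
    nlinarith
  · filter_upwards [h1, D.ρpos] with x hx hr h
    have := hx (by linarith)
    nlinarith

/-- the cut-off data -/
def fcut (u : Euc N → ℝ) (n : ℕ) : Euc N → ℝ := indicator (ball 0 (n : ℝ)) u

lemma approx_sol {u : Euc N → ℝ} (hu : D.Rg u) {h : ℝ} (hh : 0 < h) (n : ℕ) :
    ∃ w : Euc N → ℝ, AEStronglyMeasurable w volume ∧ Integrable (fun x => D.ρ x * w x ^ 2) ∧
    D.Sol w (fun x => ((1 + D.c * h) * be (1 / D.m) (w x) + 1 / ((n : ℝ) + 1) * w x - fcut u n x) / h) := by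
  have m0 : 0 < D.m := by have := D.hm; linarith
  have α0 : 0 < 1 / D.m := by positivity
  have α1 : 1 / D.m < 1 := by rw [div_lt_one m0]; exact D.hm
  have κ0 : 0 < 1 + D.c * h := by have := mul_pos D.hc hh; linarith
  have fm : AEStronglyMeasurable (fcut u n) volume := hu.1.indicator measurableSet_ball
  have f2 : Integrable (fun x => D.ρ x * fcut u n x ^ 2) := by
    obtain ⟨C, hC⟩ := D.Wloc n
    have i : Integrable (indicator (ball (0 : Euc N) (n:ℝ)) (fun x => C ^ 2 * D.ρ x)) := by
      rw [integrable_indicator_iff measurableSet_ball]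
      refine Integrable.const_mul ?_ _
      exact (D.ρloc.integrableOn_isCompact (isCompact_closedBall 0 (n:ℝ))).mono_set ball_subset_closedBall
    refine i.mono (D.ρm.aestronglyMeasurable.mul (fm.pow 2)) ?_
    filter_upwards [hC, hu.2, D.ρpos] with x h1 h2 h3
    unfold fcut
    by_cases hx : x ∈ ball (0 : Euc N) (n:ℝ)
    · rw [indicator_of_mem hx, indicator_of_mem hx, Real.norm_of_nonneg (by positivity), Real.norm_of_nonneg (by positivity), mul_comm]
      have := h1 hx
      have : u x ≤ C := h2.2.trans this
      have := h2.1
      gcongr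
    · rw [indicator_of_notMem hx, indicator_of_notMem hx]; simp
  let V : VP N :=
    { ρ := D.ρ, f := fcut u n, B := fun s => (1 + D.c * h) * (|s| ^ (1 + 1 / D.m) / (1 + 1 / D.m)),
      b := fun s => (1 + D.c * h) * be (1 / D.m) s, h := h, ε := 1 / ((n : ℝ) + 1),
      L := (1 + D.c * h) * 2, α := 1 / D.m, Cr := D.Cr, ρm := D.ρm, ρpos := D.ρpos, ρloc := D.ρloc,
      ρinv := D.ρinv, fm := fm, f2 := f2, h0 := hh, ε0 := by positivity, L0 := by positivity, α0 := α0, α1 := α1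
      Bc := continuous_const.mul ((continuous_abs.rpow_const (fun _ => Or.inr (by positivity))).div_const _)
      bc := continuous_const.mul (be_cont α0 α1)
      B0 := by simp [Real.zero_rpow (by positivity : 1 + D.m⁻¹ ≠ 0)]
      b0 := by simp [be]
      conv := fun x y => by
        have := mul_le_mul_of_nonneg_left (be_conv α0 x y) κ0.le
        linarith
      hol := fun x y => by
        rw [← mul_sub, abs_mul, abs_of_pos κ0, mul_assoc]
        exact mul_le_mul_of_nonneg_left (be_hol α0 α1 x y) κ0.le }
  obtain ⟨w, wm, w2, hw⟩ := V.exists_sol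
  have w2' : Integrable (fun x => D.ρ x * w x ^ 2) := w2
  have l2 := loc2 wm w2'
  have bm : AEStronglyMeasurable (fun x => be (1 / D.m) (w x)) volume :=
    (be_cont α0 α1).comp_aestronglyMeasurable wm
  have lb : LocallyIntegrable (fun x => D.ρ x * be (1 / D.m) (w x)) := by
    refine (l2.smul (2:ℝ)).mono (D.ρm.aestronglyMeasurable.mul bm) ?_
    filter_upwards [D.ρpos] with x hx
    simp only [Pi.smul_apply, smul_eq_mul]
    have hh0 : 0 ≤ 2 * (D.ρ x * (1 + |w x|)) := by positivity
    rw [norm_mul, Real.norm_of_nonneg hx.le, Real.norm_of_nonneg hh0]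
    have := be_hol α0 α1 (w x) 0
    rw [show be (1 / D.m) 0 = 0 by simp [be], sub_zero, sub_zero] at this
    have h2 : |w x| ^ (1 / D.m) ≤ 1 + |w x| := by
      have a := Real.rpow_le_rpow (abs_nonneg (w x)) (by linarith : |w x| ≤ 1 + |w x|) α0.le
      refine a.trans ?_
      have := Real.rpow_le_rpow_of_exponent_le (by linarith [abs_nonneg (w x)] : 1 ≤ 1 + |w x|) α1.le
      rwa [Real.rpow_one] at this
    rw [Real.norm_eq_abs]
    nlinarith
  have lw : LocallyIntegrable (fun x => D.ρ x * w x) := by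
    refine l2.mono (D.ρm.aestronglyMeasurable.mul wm) ?_
    filter_upwards [D.ρpos] with x hx
    have hh0 : 0 ≤ D.ρ x * (1 + |w x|) := by positivity
    rw [norm_mul, Real.norm_of_nonneg hx.le, Real.norm_of_nonneg hh0, Real.norm_eq_abs]
    nlinarith
  have lf : LocallyIntegrable (fun x => D.ρ x * fcut u n x) := V.floc
  refine ⟨w, wm, w2, loc_inv wm l2, ?_, ?_⟩
  · refine ((((lb.smul (1 + D.c * h)).add (lw.smul (1 / ((n : ℝ) + 1)))).sub lf).smul (1 / h)).congr (ae_of_all _ fun x => ?_)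
    simp only [Pi.smul_apply, Pi.add_apply, Pi.sub_apply, smul_eq_mul]; ring
  · intro η hη
    have e := hw η hη
    simp only [VP.Lin, V] at e
    have i1 := (locInt_mul lb hη.cont hη.2).const_mul (1 + D.c * h)
    have i2 := (locInt_mul lw hη.cont hη.2).const_mul (1 / ((n : ℝ) + 1))
    have i3 := (locInt_mul lf hη.cont hη.2)
    have i12 : Integrable (fun x => (1 + D.c * h) * (D.ρ x * be (1 / D.m) (w x) * η x) + 1 / ((n : ℝ) + 1) * (D.ρ x * w x * η x)) :=
      i1.add i2
    have e2 : ∫ x, D.ρ x * (((1 + D.c * h) * be (1 / D.m) (w x) + 1 / ((n : ℝ) + 1) * w x - fcut u n x) / h) * η x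
        = (1 / h) * ((∫ x, (1 + D.c * h) * (D.ρ x * be (1 / D.m) (w x) * η x)) +
          (∫ x, 1 / ((n : ℝ) + 1) * (D.ρ x * w x * η x)) - ∫ x, D.ρ x * fcut u n x * η x) := by
      rw [← integral_add i1 i2, ← integral_sub i12 i3, ← integral_const_mul]
      refine integral_congr_ae (ae_of_all _ fun x => ?_)
      simp only; field_simp
    rw [e2, integral_const_mul (1 / ((n : ℝ) + 1))]
    have e3 : ∫ x, D.ρ x * ((1 + D.c * h) * be (1 / D.m) (w x) * η x) = ∫ x, (1 + D.c * h) * (D.ρ x * be (1 / D.m) (w x) * η x) :=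
      integral_congr_ae (ae_of_all _ fun x => by simp only; ring)
    have e4 : ∫ x, D.ρ x * (w x * η x) = ∫ x, (D.ρ x * w x * η x) :=
      integral_congr_ae (ae_of_all _ fun x => by simp only; ring)
    rw [e3, e4] at e
    field_simp
    field_simp at e
    linarith
end Dat
end Blow

end

end

section
open MeasureTheory Metric Filter Set ENNReal
open scoped Topology ContDiff
noncomputable section
namespace Blow
variable {N : ℕ}
namespace Dat
variable {D : Dat N}

lemma m0 : 0 < D.m := by have := D.hm; linarith
lemma α0 : 0 < 1 / D.m := by have := m0 (D := D); positivity

lemma pow_root {s : ℝ} (hs : 0 ≤ s) : (s ^ (1 / D.m)) ^ D.m = s := by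
  rw [← Real.rpow_mul hs, one_div_mul_cancel m0.ne', Real.rpow_one]
lemma root_pow {s : ℝ} (hs : 0 ≤ s) : (s ^ D.m) ^ (1 / D.m) = s := by
  rw [← Real.rpow_mul hs, mul_one_div_cancel m0.ne', Real.rpow_one]

lemma solW {h : ℝ} (hh : 0 < h) : D.Sol (fun x => D.W x ^ D.m) (fun x => ((1 + D.c * h) * D.W x - D.W x) / h) := by
  refine ⟨RgW.powloc, ?_, ?_⟩
  · refine ((Wloc_of (RgW (D := D)).int).smul D.c).congr (ae_of_all _ fun x => ?_)
    simp only [Pi.smul_apply, smul_eq_mul]; field_simp; ring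
  · intro φ hφ
    rw [D.Weq φ hφ]
    refine integral_congr_ae (ae_of_all _ fun x => ?_)
    simp only; field_simp; ring

lemma sol0 : D.Sol (fun _ => 0) (fun _ => 0) := by
  refine ⟨?_, ?_, ?_⟩
  · exact locallyIntegrable_const _
  · simpa using locallyIntegrable_const (0:ℝ)
  · intro φ hφ; simp

theorem res_exists {u : Euc N → ℝ} (hu : D.Rg u) {h : ℝ} (hh : 0 < h) : ∃ v, D.Res h u v := by
  choose w wm w2 S using fun n => approx_sol hu hh n
  have κ0 : 0 < 1 + D.c * h := by have := mul_pos D.hc hh; linarith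
  have bmono := be_strictMono (α0 (D := D))
  have be0 : be (1 / D.m) 0 = 0 := by simp [be]
  have f0 : ∀ n, ∀ᵐ x, 0 ≤ fcut u n x ∧ fcut u n x ≤ D.W x := by
    intro n
    filter_upwards [hu.2] with x hx
    unfold fcut
    by_cases hb : x ∈ ball (0 : Euc N) (n:ℝ)
    · rw [indicator_of_mem hb]; exact hx
    · rw [indicator_of_notMem hb]; exact ⟨le_rfl, (D.Wpos x).le⟩
  have hG : ∀ n, Integrable (fun x => D.ρ x * |w n x| ^ 2) := fun n => by simpa only [sq_abs] using w2 n
  have wnn : ∀ n, ∀ᵐ x, 0 ≤ w n x := by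
    intro n
    refine sol0.cmp (S n) (hG n) ?_ ?_ ?_
    · refine ae_of_all _ fun x => ?_
      rw [zero_sub]; exact max_le (neg_le_abs _) (abs_nonneg _)
    · filter_upwards [f0 n] with x hx hl
      have a := bmono.monotone hl
      rw [be0] at a
      refine div_nonpos_of_nonpos_of_nonneg ?_ hh.le
      have : 1 / ((n:ℝ) + 1) * w n x ≤ 0 := mul_nonpos_of_nonneg_of_nonpos (by positivity) hl
      have := mul_nonpos_of_nonneg_of_nonpos κ0.le a
      linarith [hx.1]
    · filter_upwards [f0 n] with x hx hl
      have a := bmono hl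
      rw [be0] at a
      refine div_neg_of_neg_of_pos ?_ hh
      have : 1 / ((n:ℝ) + 1) * w n x ≤ 0 := mul_nonpos_of_nonneg_of_nonpos (by positivity) hl.le
      have := mul_neg_of_pos_of_neg κ0 a
      linarith [hx.1]
  have wW : ∀ n, ∀ᵐ x, w n x ≤ D.W x ^ D.m := by
    intro n
    refine (S n).cmp (solW hh) (hG n) ?_ ?_ ?_
    · refine ae_of_all _ fun x => ?_
      have := Real.rpow_nonneg (D.Wpos x).le D.m
      exact max_le (by have := le_abs_self (w n x); linarith) (abs_nonneg _)
    · filter_upwards [f0 n, wnn n] with x hx hn hl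
      have a := bmono.monotone hl
      rw [be_nonneg_eq α0 (Real.rpow_nonneg (D.Wpos x).le D.m), root_pow (D.Wpos x).le] at a
      refine div_le_div_of_nonneg_right ?_ hh.le
      have : 0 ≤ 1 / ((n:ℝ) + 1) * w n x := by positivity
      have := mul_le_mul_of_nonneg_left a κ0.le
      linarith [hx.2]
    · filter_upwards [f0 n, wnn n] with x hx hn hl
      have a := bmono hl
      rw [be_nonneg_eq α0 (Real.rpow_nonneg (D.Wpos x).le D.m), root_pow (D.Wpos x).le] at a
      refine div_lt_div_of_pos_right ?_ hh
      have : 0 ≤ 1 / ((n:ℝ) + 1) * w n x := by positivity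
      have := mul_lt_mul_of_pos_left a κ0
      linarith [hx.2]
  have wmono : ∀ n, ∀ᵐ x, w n x ≤ w (n + 1) x := by
    intro n
    have fm : ∀ᵐ x, fcut u n x ≤ fcut u (n + 1) x := by
      filter_upwards [hu.2] with x hx
      refine indicator_le_indicator_apply_of_subset ?_ hx.1
      exact ball_subset_ball (by push_cast; linarith)
    have εm : 1 / (((n + 1 : ℕ) : ℝ) + 1) ≤ 1 / ((n:ℝ) + 1) := by
      push_cast
      exact one_div_le_one_div_of_le (by positivity) (by linarith)
    have εp : 0 ≤ 1 / (((n + 1 : ℕ) : ℝ) + 1) := by positivity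
    refine (S n).cmp (S (n + 1)) (hG n) ?_ ?_ ?_
    · filter_upwards [wnn (n + 1)] with x hx
      exact max_le (by have := le_abs_self (w n x); linarith) (abs_nonneg _)
    · filter_upwards [fm, wnn n, wnn (n + 1)] with x hx hn hn1 hl
      have a := bmono.monotone hl
      refine div_le_div_of_nonneg_right ?_ hh.le
      have := mul_le_mul_of_nonneg_left a κ0.le
      have := mul_le_mul εm hl hn1 (by positivity)
      linarith
    · filter_upwards [fm, wnn n, wnn (n + 1)] with x hx hn hn1 hl
      have a := bmono hl
      refine div_lt_div_of_pos_right ?_ hh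
      have := mul_lt_mul_of_pos_left a κ0
      have := mul_le_mul εm hl.le hn1 (by positivity)
      linarith
  set wl : Euc N → ℝ := fun x => ⨆ n, w n x with hwl
  have wt : ∀ᵐ x, Tendsto (fun n => w n x) atTop (𝓝 (wl x)) := by
    filter_upwards [ae_all_iff.2 wmono, ae_all_iff.2 wW] with x h1 h2
    exact tendsto_atTop_ciSup (monotone_nat_of_le_succ h1) ⟨D.W x ^ D.m, by rintro _ ⟨n, rfl⟩; exact h2 n⟩
  have wlm : AEStronglyMeasurable wl volume := aestronglyMeasurable_of_tendsto_ae atTop wm wt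
  have wl0 : ∀ᵐ x, 0 ≤ wl x ∧ wl x ≤ D.W x ^ D.m := by
    filter_upwards [wt, ae_all_iff.2 wnn, ae_all_iff.2 wW] with x h1 h2 h3
    exact ⟨ge_of_tendsto' h1 h2, le_of_tendsto' h1 h3⟩
  set v : Euc N → ℝ := fun x => wl x ^ (1 / D.m) with hv
  have vm : AEStronglyMeasurable v volume := (wlm.aemeasurable.pow_const _).aestronglyMeasurable
  have vr : D.Rg v := by
    refine ⟨vm, ?_⟩
    filter_upwards [wl0] with x hx
    refine ⟨Real.rpow_nonneg hx.1 _, ?_⟩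
    have := Real.rpow_le_rpow hx.1 hx.2 (α0 (D := D)).le
    rwa [root_pow (D.Wpos x).le] at this
  refine ⟨v, vr, ?_, ?_, ?_⟩
  · exact ((hu.1.sub vm).aemeasurable.div_const h).aestronglyMeasurable
  · refine ((hu.int.sub vr.int).div_const h).congr (ae_of_all _ fun x => ?_)
    simp only [Pi.sub_apply]; ring
  · intro φ hφ
    have e1 : ∫ x, v x ^ D.m * lap φ x = ∫ x, wl x * lap φ x := by
      refine integral_congr_ae ?_
      filter_upwards [wl0] with x hx
      simp only [hv]; rw [pow_root hx.1]
    have t1 : Tendsto (fun n => ∫ x, w n x * lap φ x) atTop (𝓝 (∫ x, wl x * lap φ x)) := by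
      refine tendsto_integral_of_dominated_convergence (fun x => |D.W x ^ D.m * lap φ x|)
        (fun n => (wm n).mul (lap_continuous hφ.c2).aestronglyMeasurable)
        (locInt_mul RgW.powloc (lap_continuous hφ.c2) (lap_support hφ.2)).abs ?_ ?_
      · intro n
        filter_upwards [wnn n, wW n] with x h1 h2
        rw [Real.norm_eq_abs, abs_mul, abs_mul, abs_of_nonneg h1, abs_of_nonneg (h1.trans h2)]
        gcongr
      · filter_upwards [wt] with x hx
        exact hx.mul_const _
    obtain ⟨R, hR, hR'⟩ := ball_of_TF hφ.2
    obtain ⟨C, hC⟩ := D.Wloc R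
    have t2 : Tendsto (fun n : ℕ => ∫ x, D.ρ x * (((1 + D.c * h) * be (1 / D.m) (w n x) + 1 / ((n : ℝ) + 1) * w n x - fcut u n x) / h) * φ x)
        atTop (𝓝 (∫ x, D.ρ x * (D.c * v x - (u x - v x) / h) * φ x)) := by
      set K : ℝ := (((1 + D.c * h) * |C| + |C| ^ D.m + |C|) / h) with hK
      refine tendsto_integral_of_dominated_convergence (fun x => K * |D.ρ x * φ x|)
        (fun n => ?_) ((locInt_mul D.ρloc hφ.cont hφ.2).abs.const_mul _) ?_ ?_
      · exact (S n).Φl.aestronglyMeasurable.mul hφ.cont.aestronglyMeasurable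
      · intro n
        filter_upwards [wnn n, wW n, hC, f0 n] with x h1 h2 h3 h4
        by_cases hb : x ∈ ball (0 : Euc N) R
        · have h5 := (h3 hb).trans (le_abs_self C)
          rw [Real.norm_eq_abs, abs_mul, abs_mul, abs_mul, mul_right_comm, mul_comm]
          refine mul_le_mul_of_nonneg_right ?_ (by positivity)
          rw [abs_div, abs_of_pos hh, hK]
          refine div_le_div_of_nonneg_right ?_ hh.le
          have b1 : be (1 / D.m) (w n x) ≤ |C| := by
            rw [be_nonneg_eq α0 h1]
            have := Real.rpow_le_rpow h1 h2 (α0 (D := D)).le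
            rw [root_pow (D.Wpos x).le] at this
            linarith
          have b2 : 0 ≤ be (1 / D.m) (w n x) := by rw [be_nonneg_eq α0 h1]; positivity
          have b3 : 1 / ((n:ℝ) + 1) * w n x ≤ |C| ^ D.m := by
            have : 1 / ((n:ℝ) + 1) ≤ 1 := by
              rw [div_le_one (by positivity)]; linarith [(Nat.cast_nonneg n : (0:ℝ) ≤ n)]
            have := mul_le_of_le_one_left h1 this
            have := Real.rpow_le_rpow (D.Wpos x).le h5 (m0 (D := D)).le
            linarith
          have b4 : 0 ≤ 1 / ((n:ℝ) + 1) * w n x := by positivity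
          have b5 : (1 + D.c * h) * be (1 / D.m) (w n x) ≤ (1 + D.c * h) * |C| := by gcongr
          have b6 : 0 ≤ (1 + D.c * h) * be (1 / D.m) (w n x) := by positivity
          have b7 : 0 ≤ |C| ^ D.m := by positivity
          rw [abs_le]
          constructor <;> linarith [h4.1, h4.2]
        · rw [(hR' x hb).1]; simp
      · filter_upwards [wt, ae_all_iff.2 wnn] with x hx hn
        have a1 : Tendsto (fun n => be (1 / D.m) (w n x)) atTop (𝓝 (v x)) := by
          have : Tendsto (fun n => (w n x) ^ (1 / D.m)) atTop (𝓝 (v x)) := hx.rpow_const (Or.inr (α0 (D := D)).le)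
          exact this.congr fun n => (be_nonneg_eq α0 (hn n)).symm
        have a2 : Tendsto (fun n : ℕ => 1 / ((n:ℝ) + 1) * w n x) atTop (𝓝 (0 * wl x)) :=
          tendsto_one_div_add_atTop_nhds_zero_nat.mul hx
        have a3 : Tendsto (fun n => fcut u n x) atTop (𝓝 (u x)) := by
          refine tendsto_const_nhds.congr' ?_
          obtain ⟨n0, hn0⟩ := exists_nat_gt ‖x‖
          filter_upwards [eventually_ge_atTop n0] with n hn
          have : x ∈ ball (0 : Euc N) (n : ℝ) := by
            rw [mem_ball_zero_iff]; exact hn0.trans_le (by exact_mod_cast hn)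
          unfold fcut
          rw [indicator_of_mem this]
        have a4 := ((((a1.const_mul (1 + D.c * h)).add a2).sub a3).div_const h).const_mul (D.ρ x) |>.mul_const (φ x)
        convert a4 using 2
        field_simp; ring
    rw [e1]
    refine tendsto_nhds_unique t1 (t2.congr fun n => ?_)
    exact ((S n).eq φ hφ).symm
end Dat
end Blow

end

end

section
open MeasureTheory Metric Filter Set ENNReal
open scoped Topology ContDiff
noncomputable section
namespace Blow
variable {N : ℕ}
namespace Dat
variable {D : Dat N}

lemma dens {f : Euc N → ℝ} (hf : Integrable (fun x => D.ρ x * D.W x * f x)) {ε : ℝ} (hε : 0 < ε) :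
    ∃ φ, TF φ ∧ ∫ x, D.ρ x * D.W x * |f x - φ x| ≤ ε := by
  set r : Euc N → ℝ := fun x => D.ρ x * D.W x with hr
  have rm : Measurable r := D.ρm.mul D.Wm
  have rp : ∀ᵐ x, 0 < r x := by filter_upwards [D.ρpos] with x hx using mul_pos hx (D.Wpos x)
  have rl : LocallyIntegrable r := Wloc_of (RgW (D := D)).int
  haveI : IsFiniteMeasureOnCompacts (wm r) := by
    refine ⟨fun K hK => ?_⟩
    rw [wm, withDensity_apply _ hK.measurableSet]
    have := (rl.integrableOn_isCompact hK).2
    refine lt_of_le_of_lt ?_ this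
    exact lintegral_mono fun x => by rw [Real.enorm_eq_ofReal_abs]; exact ENNReal.ofReal_le_ofReal (le_abs_self _)
  have hi : Integrable f (wm r) := (wm_int rm rp).2 hf
  obtain ⟨φ, h1, h2, h3⟩ := MeasureTheory.MemLp.exist_eLpNorm_sub_le (μ := wm r) one_ne_top le_rfl
    (memLp_one_iff_integrable.2 hi) hε
  refine ⟨φ, ⟨h2, h1⟩, ?_⟩
  have i2 : Integrable (f - φ) (wm r) := hi.sub (h2.continuous.integrable_of_hasCompactSupport h1)
  rw [eLpNorm_one_eq_lintegral_enorm, ← ofReal_integral_norm_eq_lintegral_enorm i2,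
    ENNReal.ofReal_le_ofReal_iff hε.le, wm_integral rm rp] at h3
  exact h3

lemma weak0 {u : Euc N → ℝ} (hu : D.Rg u) {v : ℕ → Euc N → ℝ} {h : ℕ → ℝ} (hp : ∀ n, 0 < h n)
    (ht : Tendsto h atTop (𝓝 0)) (hv : ∀ n, D.Res (h n) u (v n)) {φ : Euc N → ℝ} (hφ : TF φ) :
    Tendsto (fun n => ∫ x, D.ρ x * φ x * (v n x - u x)) atTop (𝓝 0) := by
  have lW := Wloc_of (RgW (D := D)).int
  have iW := (locInt_mul lW hφ.cont hφ.2).abs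
  have iM := (locInt_mul (RgW (D := D)).powloc (lap_continuous hφ.c2) (lap_support hφ.2)).abs
  set K := (∫ x, |D.W x ^ D.m * lap φ x|) + D.c * ∫ x, |D.ρ x * D.W x * φ x| with hK
  refine squeeze_zero_norm (a := fun n => h n * K) (fun n => ?_) (by simpa using ht.mul_const K)
  have P := hv n
  have l1 := Wloc_of P.rg.int
  have la : LocallyIntegrable (fun x => D.ρ x * ((u x - v n x) / h n)) := Wloc_of P.ai
  have i1 := (locInt_mul l1 hφ.cont hφ.2).const_mul D.c
  have i2 := (locInt_mul la hφ.cont hφ.2)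
  have e := P.eq φ hφ
  have e2 : ∫ x, D.ρ x * (D.c * v n x - (u x - v n x) / h n) * φ x =
      D.c * (∫ x, D.ρ x * v n x * φ x) - ∫ x, D.ρ x * ((u x - v n x) / h n) * φ x := by
    rw [← integral_const_mul, ← integral_sub i1 i2]
    exact integral_congr_ae (ae_of_all _ fun x => by simp only; ring)
  have e3 : ∫ x, D.ρ x * φ x * (v n x - u x) = h n * -(∫ x, D.ρ x * ((u x - v n x) / h n) * φ x) := by
    rw [← integral_neg, ← integral_const_mul]
    have := (hp n).ne'
    exact integral_congr_ae (ae_of_all _ fun x => by simp only; field_simp; ring)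
  have e4 : -(∫ x, D.ρ x * ((u x - v n x) / h n) * φ x) = (∫ x, v n x ^ D.m * lap φ x) - D.c * (∫ x, D.ρ x * v n x * φ x) := by
    rw [e, e2]; ring
  rw [e3, e4, norm_mul, Real.norm_of_nonneg (hp n).le]
  refine mul_le_mul_of_nonneg_left ?_ (hp n).le
  refine (norm_sub_le _ _).trans ?_
  rw [hK, norm_mul, Real.norm_of_nonneg D.hc.le]
  refine add_le_add ?_ (mul_le_mul_of_nonneg_left ?_ D.hc.le)
  · refine norm_integral_le_of_norm_le iM ?_
    filter_upwards [P.rg.2] with x hx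
    rw [Real.norm_eq_abs, abs_mul, abs_mul, abs_of_nonneg (Real.rpow_nonneg hx.1 _),
      abs_of_nonneg (Real.rpow_nonneg (D.Wpos x).le _)]
    exact mul_le_mul_of_nonneg_right (Real.rpow_le_rpow hx.1 hx.2 m0.le) (abs_nonneg _)
  · refine norm_integral_le_of_norm_le iW ?_
    filter_upwards [P.rg.2] with x hx
    rw [Real.norm_eq_abs, abs_mul, abs_mul, abs_mul, abs_mul, abs_of_nonneg hx.1, abs_of_nonneg (D.Wpos x).le]
    have := hx.2
    gcongr

lemma weak1 {u : Euc N → ℝ} (hu : D.Rg u) {v : ℕ → Euc N → ℝ} {h : ℕ → ℝ} (hp : ∀ n, 0 < h n)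
    (ht : Tendsto h atTop (𝓝 0)) (hv : ∀ n, D.Res (h n) u (v n)) {b : Euc N → ℝ}
    (hb : AEStronglyMeasurable b volume) (hb1 : ∀ x, |b x| ≤ 1) :
    Tendsto (fun n => ∫ x, D.w x * (b x * (v n x - u x))) atTop (𝓝 0) := by
  have lW := Wloc_of (RgW (D := D)).int
  have ib : Integrable (fun x => D.ρ x * D.W x * (sg x ^ (-D.p) * b x)) := by
    refine (mulint hb hb1 RgW.1 (RgW (D := D)).int).congr (ae_of_all _ fun x => ?_)
    simp only [w]; ring
  rw [Metric.tendsto_atTop]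
  intro ε hε
  obtain ⟨φ, hφ, hφ1⟩ := dens ib (half_pos hε)
  have t := weak0 hu hp ht hv hφ
  rw [Metric.tendsto_atTop] at t
  obtain ⟨n0, hn0⟩ := t (ε / 2) (half_pos hε)
  refine ⟨n0, fun n hn => ?_⟩
  have t1 := hn0 n hn
  rw [dist_zero_right] at t1 ⊢
  have P := hv n
  have id : Integrable (fun x => D.w x * (v n x - u x)) := by
    refine (P.rg.int.sub hu.int).congr (ae_of_all _ fun x => ?_); simp only [Pi.sub_apply]; ring
  have i1 := mulint (v := fun x => v n x - u x) hb hb1 (P.rg.1.sub hu.1) id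
  have ld : LocallyIntegrable (fun x => D.ρ x * (v n x - u x)) := Wloc_of id
  have i2 : Integrable (fun x => D.ρ x * φ x * (v n x - u x)) := by
    refine (locInt_mul ld hφ.cont hφ.2).congr (ae_of_all _ fun x => ?_); simp only; ring
  have i3 : Integrable (fun x => D.ρ x * D.W x * |sg x ^ (-D.p) * b x - φ x|) := by
    refine (ib.sub (locInt_mul lW hφ.cont hφ.2)).abs.congr ?_
    filter_upwards [D.ρpos] with x hx
    have := D.Wpos x
    simp only [Pi.sub_apply]
    rw [← mul_sub, abs_mul, abs_of_pos (mul_pos hx this)]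
  have e : ∫ x, D.w x * (b x * (v n x - u x)) = (∫ x, D.ρ x * φ x * (v n x - u x)) +
      ∫ x, (D.w x * (b x * (v n x - u x)) - D.ρ x * φ x * (v n x - u x)) := by
    rw [integral_sub i1 i2]; simp
  rw [e]
  refine (norm_add_le _ _).trans_lt ?_
  have b2 : ‖∫ x, (D.w x * (b x * (v n x - u x)) - D.ρ x * φ x * (v n x - u x))‖ ≤ ε / 2 := by
    refine le_trans ?_ hφ1
    refine norm_integral_le_of_norm_le i3 ?_
    filter_upwards [P.rg.2, hu.2, D.ρpos] with x h1 h2 h3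
    have e5 : D.w x * (b x * (v n x - u x)) - D.ρ x * φ x * (v n x - u x) =
      D.ρ x * (v n x - u x) * (sg x ^ (-D.p) * b x - φ x) := by simp only [w]; ring
    rw [e5, Real.norm_eq_abs, abs_mul, abs_mul, abs_of_pos h3]
    have : |v n x - u x| ≤ D.W x := by rw [abs_le]; constructor <;> linarith [h1.1, h1.2, h2.1, h2.2]
    gcongr
  linarith

/-- derivative of the truncation function -/
def jp (s : ℝ) : ℝ := s / √(s ^ 2 + 1 ^ 2)

lemma jp_mono : StrictMono jp := by
  obtain ⟨-, -, h3, -, -⟩ := sqrt_j 1 one_pos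
  refine strictMono_of_deriv_pos fun s => ?_
  have : deriv jp s = _ := (h3 s).deriv
  rw [this]; positivity

lemma jp_cont : Continuous jp := by
  obtain ⟨-, -, h3, -, -⟩ := sqrt_j 1 one_pos
  exact continuous_iff_continuousAt.2 fun s => (h3 s).continuousAt

lemma jp_bd (s : ℝ) : |jp s| ≤ 1 := (sqrt_j 1 one_pos).2.2.2.1 s
lemma jp_nonneg {s : ℝ} (h : 0 ≤ s) : 0 ≤ jp s := by unfold jp; positivity

lemma jstep {u v : Euc N → ℝ} (hu : D.Rg u) {h : ℝ} (hh : 0 < h) (P : D.Res h u v) :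
    ∫ x, D.w x * (jp (v x ^ D.m) * (v x - u x)) ≤
      h * ((lapL_bd (N := N) D.p D.hp).choose * ∫ x, D.W x ^ D.m * sg x ^ (-D.p - 1)) := by
  obtain ⟨C0, -, hC⟩ := (lapL_bd (N := N) D.p D.hp).choose_spec
  set C := (lapL_bd (N := N) D.p D.hp).choose with hCdef
  obtain ⟨s1, s2, s3, s4, s5⟩ := sqrt_j 1 one_pos
  set H : Euc N → ℝ := fun x => √((v x ^ D.m) ^ 2 + 1 ^ 2) - 1 with hH
  have jm : AEStronglyMeasurable (fun x => jp (v x ^ D.m)) volume := jp_cont.comp_aestronglyMeasurable P.rg.powm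
  have Hm : AEStronglyMeasurable H volume :=
    ((Real.continuous_sqrt.comp ((continuous_pow 2).add continuous_const)).sub continuous_const).comp_aestronglyMeasurable P.rg.powm
  have Hb : ∀ᵐ x, |H x| ≤ D.W x ^ D.m := by
    filter_upwards [P.rg.2] with x hx
    have h1 := Real.rpow_le_rpow hx.1 hx.2 (m0 (D := D)).le
    have h2 := Real.rpow_nonneg hx.1 D.m
    refine le_trans ?_ h1
    simp only [hH]
    set t := v x ^ D.m
    have a1 : 1 ≤ √(t ^ 2 + 1 ^ 2) := by rw [Real.one_le_sqrt]; nlinarith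
    have a2 : √(t ^ 2 + 1 ^ 2) ≤ t + 1 := by rw [Real.sqrt_le_iff]; constructor <;> nlinarith
    rw [abs_of_nonneg (by linarith)]; linarith
  have iWm := (RgW (D := D)).powint
  have iH : Integrable (fun x => H x * sg x ^ (-D.p - 1)) := by
    refine iWm.mono (Hm.mul (sgpow_cont _).aestronglyMeasurable) ?_
    filter_upwards [Hb] with x hx
    rw [norm_mul, norm_mul]
    refine mul_le_mul_of_nonneg_right ?_ (norm_nonneg _)
    rw [Real.norm_eq_abs]; exact hx.trans (le_abs_self _)
  have k := kato_lim D.hp jm (fun x => jp_bd _) P.Floc.aestronglyMeasurable Hm P.Fint iH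
    (fun χ hχ h0 => kato_conv (j := fun s => √(s ^ 2 + 1 ^ 2) - 1) P.rg.powloc P.Floc P.eq (s1.sub contDiff_const)
      (fun s => (s2 s).sub_const 1) s3 s4 s5 hχ h0)
  have k2 := (le_abs_self _).trans (lapL_int_bd iH (C := C) hC)
  have k3 : ∫ x, |H x| * sg x ^ (-D.p - 1) ≤ ∫ x, D.W x ^ D.m * sg x ^ (-D.p - 1) := by
    refine integral_mono_ae ?_ iWm ?_
    · refine iH.abs.congr (ae_of_all _ fun x => ?_)
      simp only
      rw [abs_mul, abs_of_pos (Real.rpow_pos_of_pos (sg_pos x) _)]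
    · filter_upwards [Hb] with x hx
      exact mul_le_mul_of_nonneg_right hx (Real.rpow_nonneg (sg_pos x).le _)
  have id : Integrable (fun x => D.w x * (v x - u x)) := by
    refine (P.rg.int.sub hu.int).congr (ae_of_all _ fun x => ?_); simp only [Pi.sub_apply]; ring
  have i1 := (mulint (v := fun x => v x - u x) jm (fun x => jp_bd _) (P.rg.1.sub hu.1) id)
  have i2 := (mulint jm (fun x => jp_bd _) P.rg.1 P.rg.int)
  have k4 : ∫ x, D.w x * (jp (v x ^ D.m) * (v x - u x)) ≤
     h * ∫ x, jp (v x ^ D.m) * (D.ρ x * (D.c * v x - (u x - v x) / h)) * sg x ^ (-D.p) := by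
    rw [← integral_const_mul]
    refine integral_mono_ae i1 ?_ ?_
    · refine ((i2.const_mul (h * D.c)).add i1).congr (ae_of_all _ fun x => ?_)
      simp only [Pi.add_apply, Pi.sub_apply, w]; field_simp; ring
    · filter_upwards [P.rg.2, D.wpos] with x hx hw
      have e : h * (jp (v x ^ D.m) * (D.ρ x * (D.c * v x - (u x - v x) / h)) * sg x ^ (-D.p)) =
        D.w x * (jp (v x ^ D.m) * (v x - u x)) + h * D.c * (D.w x * (jp (v x ^ D.m) * v x)) := by
        simp only [w]; field_simp; ring
      rw [e]
      have := jp_nonneg (Real.rpow_nonneg hx.1 D.m)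
      have := hx.1
      have := D.hc
      have : 0 ≤ h * D.c * (D.w x * (jp (v x ^ D.m) * v x)) := by positivity
      linarith
  refine k4.trans (mul_le_mul_of_nonneg_left ?_ hh.le)
  exact (k.trans k2).trans (mul_le_mul_of_nonneg_left k3 C0)

lemma pt_conv {a : ℝ → ℝ} (ha : StrictMonoOn a (Ici 0)) {s : ℕ → ℝ} {t : ℝ} (hs : ∀ n, 0 ≤ s n) (ht : 0 ≤ t)
    (h : Tendsto (fun n => (a (s n) - a t) * (s n - t)) atTop (𝓝 0)) : Tendsto s atTop (𝓝 t) := by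
  rw [tendsto_order]
  constructor
  · intro y hy
    rcases lt_or_ge y 0 with h0 | h0
    · exact Eventually.of_forall fun n => h0.trans_le (hs n)
    have h1 : a y < a t := ha h0 ht hy
    have hpos : 0 < (a t - a y) * (t - y) := mul_pos (by linarith) (by linarith)
    filter_upwards [h.eventually (gt_mem_nhds hpos)] with n hn
    by_contra hc
    push Not at hc
    have h2 : a (s n) ≤ a y := ha.monotoneOn (hs n) h0 hc
    nlinarith
  · intro y hy
    have h0 : 0 ≤ y := ht.trans hy.le
    have h1 : a t < a y := ha ht h0 hy
    have hpos : 0 < (a y - a t) * (y - t) := mul_pos (by linarith) (by linarith)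
    filter_upwards [h.eventually (gt_mem_nhds hpos)] with n hn
    by_contra hc
    push Not at hc
    have h2 : a y ≤ a (s n) := ha.monotoneOn h0 (hs n) hc
    nlinarith

theorem density {u : Euc N → ℝ} (hu : D.Rg u) {v : ℕ → Euc N → ℝ} {h : ℕ → ℝ} (hp : ∀ n, 0 < h n)
    (ht : Tendsto h atTop (𝓝 0)) (hv : ∀ n, D.Res (h n) u (v n)) :
    ∃ ns : ℕ → ℕ, StrictMono ns ∧ Tendsto (fun k => D.nm (fun x => v (ns k) x - u x)) atTop (𝓝 0) := by
  have jm : ∀ {z : Euc N → ℝ}, D.Rg z → AEStronglyMeasurable (fun x => jp (z x ^ D.m)) volume :=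
    fun hz => jp_cont.comp_aestronglyMeasurable hz.powm
  set f : ℕ → Euc N → ℝ := fun n x => D.w x * ((jp (v n x ^ D.m) - jp (u x ^ D.m)) * (v n x - u x)) with hf
  have id : ∀ n, Integrable (fun x => D.w x * (v n x - u x)) := fun n => by
    refine ((hv n).rg.int.sub hu.int).congr (ae_of_all _ fun x => ?_); simp only [Pi.sub_apply]; ring
  have i1 := fun n => (mulint (v := fun x => v n x - u x) (jm (hv n).rg) (fun x => jp_bd _) ((hv n).rg.1.sub hu.1) (id n))
  have i2 := fun n => (mulint (v := fun x => v n x - u x) (jm hu) (fun x => jp_bd _) ((hv n).rg.1.sub hu.1) (id n))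
  have fi : ∀ n, Integrable (f n) := fun n => by
    refine ((i1 n).sub (i2 n)).congr (ae_of_all _ fun x => ?_); simp only [Pi.sub_apply, hf]; ring
  have smon : StrictMonoOn (fun s => jp (s ^ D.m)) (Ici 0) := fun s hs t _ hst =>
    jp_mono (Real.rpow_lt_rpow hs hst m0)
  have fnn : ∀ n, ∀ᵐ x, 0 ≤ f n x := by
    intro n
    filter_upwards [(hv n).rg.2, hu.2, D.wpos] with x h1 h2 h3
    refine mul_nonneg h3.le ?_
    rcases le_total (v n x) (u x) with hl | hl
    · exact mul_nonneg_of_nonpos_of_nonpos (sub_nonpos.2 (smon.monotoneOn h1.1 h2.1 hl)) (by linarith)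
    · exact mul_nonneg (sub_nonneg.2 (smon.monotoneOn h2.1 h1.1 hl)) (by linarith)
  have tf : Tendsto (fun n => ∫ x, f n x) atTop (𝓝 0) := by
    have t1 := weak1 hu hp ht hv (jm hu) (fun x => jp_bd _)
    have t2 := (ht.mul_const ((lapL_bd (N := N) D.p D.hp).choose * ∫ x, D.W x ^ D.m * sg x ^ (-D.p - 1))).sub t1
    rw [zero_mul, sub_zero] at t2
    refine squeeze_zero (fun n => integral_nonneg_of_ae (fnn n)) (fun n => ?_) t2
    have e : ∫ x, f n x = (∫ x, D.w x * (jp (v n x ^ D.m) * (v n x - u x))) - ∫ x, D.w x * (jp (u x ^ D.m) * (v n x - u x)) := by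
      rw [← integral_sub (i1 n) (i2 n)]
      exact integral_congr_ae (ae_of_all _ fun x => by simp only [hf]; ring)
    rw [e]
    exact sub_le_sub_right (jstep hu (hp n) (hv n)) _
  have tm : TendstoInMeasure volume f atTop (0 : Euc N → ℝ) := by
    refine tendstoInMeasure_of_tendsto_eLpNorm one_ne_zero (fun n => (fi n).1) aestronglyMeasurable_const ?_
    have e : ∀ n, eLpNorm (f n - 0) 1 volume = ENNReal.ofReal (∫ x, f n x) := by
      intro n
      rw [sub_zero, eLpNorm_one_eq_lintegral_enorm, ← ofReal_integral_norm_eq_lintegral_enorm (fi n)]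
      congr 1
      refine integral_congr_ae ?_
      filter_upwards [fnn n] with x hx
      exact Real.norm_of_nonneg hx
    simp only [e]
    simpa using ENNReal.tendsto_ofReal tf
  obtain ⟨ns, hns, hae⟩ := tm.exists_seq_tendsto_ae
  refine ⟨ns, hns, ?_⟩
  have : (0:ℝ) = ∫ x : Euc N, (0:ℝ) := by simp
  rw [this]
  refine tendsto_integral_of_dominated_convergence (fun x => D.w x * D.W x) (fun k => ?_) (RgW (D := D)).int ?_ ?_
  · exact (D.wmeas.aestronglyMeasurable.mul ((hv (ns k)).rg.1.sub hu.1).norm)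
  · intro k
    filter_upwards [(hv (ns k)).rg.2, hu.2, D.wpos] with x h1 h2 h3
    rw [Real.norm_of_nonneg (by positivity)]
    refine mul_le_mul_of_nonneg_left ?_ h3.le
    rw [abs_le]; constructor <;> linarith [h1.1, h1.2, h2.1, h2.2]
  · filter_upwards [hae, hu.2, D.wpos, ae_all_iff.2 (fun n => (hv n).rg.2)] with x h1 h2 h3 h4
    have t : Tendsto (fun k => v (ns k) x) atTop (𝓝 (u x)) := by
      refine pt_conv smon (fun k => (h4 _).1) h2.1 ?_
      have := h1.const_mul (D.w x)⁻¹
      simp only [Pi.zero_apply, mul_zero] at this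
      refine this.congr fun k => ?_
      simp only [hf]; field_simp
    have t2 := ((t.sub_const (u x)).abs).const_mul (D.w x)
    simpa using t2
end Dat
end Blow

end

end

section
open MeasureTheory Metric Filter Set ENNReal
open scoped Topology ContDiff
noncomputable section
namespace Blow
section CL
variable {X : Type*} [NormedAddCommGroup X]

/-- Resolvent family hypotheses for the exponential formula. -/
structure RF (C : Set X) (J : ℝ → X → X) (o : ℝ) : Prop where
  om : 0 ≤ o
  maps : ∀ l, 0 < l → l * o < 1 → ∀ x ∈ C, J l x ∈ C
  contr : ∀ l, 0 < l → l * o < 1 → ∀ x ∈ C, ∀ y ∈ C, (1 - l * o) * ‖J l x - J l y‖ ≤ ‖x - y‖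
  kob : ∀ l μ, 0 < l → l * o < 1 → 0 < μ → μ * o < 1 → ∀ x ∈ C, ∀ y ∈ C,
    (l + μ - l * μ * o) * ‖J l x - J μ y‖ ≤ l * ‖J l x - y‖ + μ * ‖x - J μ y‖
  dens : ∀ x ∈ C, ∀ ε > 0, ∃ l, 0 < l ∧ l * o < 1 ∧ ‖J l x - x‖ ≤ ε

variable {C : Set X} {J : ℝ → X → X} {o : ℝ}

lemma RF.it (H : RF C J o) {l : ℝ} (hl : 0 < l) (hlo : l * o < 1) {x : X} (hx : x ∈ C) (i : ℕ) :
    (J l)^[i] x ∈ C := by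
  induction i with
  | zero => simpa
  | succ i ih => rw [Function.iterate_succ_apply']; exact H.maps l hl hlo _ ih

lemma RF.one (H : RF C J o) {d l : ℝ} (hd : 0 < d) (hdo : d * o < 1) (hl : 0 < l) (hlo : l * o < 1)
    {x : X} (hx : x ∈ C) : (1 - l * o) * ‖J l (J d x) - J d x‖ ≤ l * (‖x - J d x‖ / d) := by
  have h := H.kob l d hl hlo hd hdo (J d x) (H.maps d hd hdo x hx) x hx
  have h2 : ‖J l (J d x) - x‖ ≤ ‖J l (J d x) - J d x‖ + ‖x - J d x‖ := by
    rw [norm_sub_rev x]; exact norm_sub_le_norm_sub_add_norm_sub _ _ _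
  simp only [sub_self, norm_zero, mul_zero, add_zero] at h
  set a := ‖J l (J d x) - J d x‖
  set b := ‖x - J d x‖
  have h3 : (l + d - l * d * o) * a ≤ l * (a + b) := h.trans (mul_le_mul_of_nonneg_left h2 hl.le)
  rw [← mul_div_assoc, le_div_iff₀ hd]
  nlinarith

lemma RF.base (H : RF C J o) {d l : ℝ} (hd : 0 < d) (hdo : d * o < 1) (hl : 0 < l) (hlo : l * o < 1)
    {x : X} (hx : x ∈ C) (i : ℕ) :
    ‖(J l)^[i] x - J d x‖ ≤ ((1 - l * o)⁻¹) ^ i * (‖x - J d x‖ + i * l * (‖x - J d x‖ / d)) := by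
  have hp : 0 < 1 - l * o := by linarith
  have hp1 : 1 ≤ (1 - l * o)⁻¹ := (one_le_inv₀ hp).2 (by nlinarith [H.om])
  have hM : 0 ≤ ‖x - J d x‖ / d := by positivity
  set M := ‖x - J d x‖ / d with hMd
  induction i with
  | zero => simp
  | succ i ih =>
    rw [Function.iterate_succ_apply']
    have hz := H.maps d hd hdo x hx
    have h1 := H.contr l hl hlo _ (H.it hl hlo hx i) _ hz
    have h2 := H.one hd hdo hl hlo hx
    have h3 := norm_sub_le_norm_sub_add_norm_sub (J l ((J l)^[i] x)) (J l (J d x)) (J d x)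
    have h4 : (1 - l * o) * ‖J l ((J l)^[i] x) - J d x‖ ≤ ((1 - l * o)⁻¹) ^ i * (‖x - J d x‖ + (i + 1) * l * M) := by
      calc _ ≤ (1 - l * o) * (‖J l ((J l)^[i] x) - J l (J d x)‖ + ‖J l (J d x) - J d x‖) :=
            mul_le_mul_of_nonneg_left h3 hp.le
        _ ≤ ‖(J l)^[i] x - J d x‖ + l * M := by linarith
        _ ≤ ((1 - l * o)⁻¹) ^ i * (‖x - J d x‖ + i * l * M) + ((1 - l * o)⁻¹) ^ i * (l * M) := by
            have : 1 * (l * M) ≤ ((1 - l * o)⁻¹) ^ i * (l * M) :=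
              mul_le_mul_of_nonneg_right (one_le_pow₀ hp1) (by positivity)
            linarith
        _ = _ := by ring
    rw [pow_succ, mul_comm (_ ^ i), mul_assoc, ← div_eq_inv_mul, le_div_iff₀ hp]
    push_cast; linarith

/-- the Kobayashi square root -/
def Dq (l μ : ℝ) (i j : ℕ) : ℝ := √((i * l - j * μ) ^ 2 + i * l ^ 2 + j * μ ^ 2)

lemma Dq_step {l μ o : ℝ} (hl : 0 < l) (hμ : 0 < μ) (ho : 0 ≤ o) (hlo : l * o < 1) (hμo : μ * o < 1) (i j : ℕ) :
    l * (1 - μ * o) * Dq l μ (i + 1) j + μ * (1 - l * o) * Dq l μ i (j + 1) ≤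
      (l + μ - l * μ * o) * Dq l μ (i + 1) (j + 1) := by
  set A := Dq l μ (i + 1) j
  set B := Dq l μ i (j + 1)
  set E := Dq l μ (i + 1) (j + 1)
  have hA : 0 ≤ A := Real.sqrt_nonneg _
  have hB : 0 ≤ B := Real.sqrt_nonneg _
  have hE : 0 ≤ E := Real.sqrt_nonneg _
  have hA2 : A ^ 2 = _ := Real.sq_sqrt (by positivity)
  have hB2 : B ^ 2 = _ := Real.sq_sqrt (by positivity)
  have hE2 : E ^ 2 = _ := Real.sq_sqrt (by positivity)
  push_cast at hA2 hB2 hE2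
  have key : l * A ^ 2 + μ * B ^ 2 = (l + μ) * E ^ 2 := by rw [hA2, hB2, hE2]; ring
  have cs : l * A + μ * B ≤ (l + μ) * E := by
    refine abs_le_of_sq_le_sq' ?_ (by positivity) |>.2
    nlinarith [mul_nonneg (mul_nonneg hl.le hμ.le) (sq_nonneg (A - B))]
  rcases le_total l μ with h | h
  · have h1 : l * (1 - μ * o) * A ≤ l * (1 - l * o) * A := by gcongr
    have h2 : (1 - l * o) * (l * A + μ * B) ≤ (1 - l * o) * ((l + μ) * E) :=
      mul_le_mul_of_nonneg_left cs (by linarith)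
    have h3 : 0 ≤ l * l * o * E := by positivity
    nlinarith
  · have h1 : μ * (1 - l * o) * B ≤ μ * (1 - μ * o) * B := by gcongr
    have h2 : (1 - μ * o) * (l * A + μ * B) ≤ (1 - μ * o) * ((l + μ) * E) :=
      mul_le_mul_of_nonneg_left cs (by linarith)
    have h3 : 0 ≤ μ * μ * o * E := by positivity
    nlinarith

lemma RF.est (H : RF C J o) {d l μ : ℝ} (hd : 0 < d) (hdo : d * o < 1) (hl : 0 < l) (hlo : l * o < 1)
    (hμ : 0 < μ) (hμo : μ * o < 1) {x : X} (hx : x ∈ C) (i j : ℕ) :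
    ‖(J l)^[i] x - (J μ)^[j] x‖ ≤ ((1 - l * o)⁻¹) ^ i * ((1 - μ * o)⁻¹) ^ j *
      (2 * ‖x - J d x‖ + (‖x - J d x‖ / d) * Dq l μ i j) := by
  have hp : 0 < 1 - l * o := by linarith
  have hq : 0 < 1 - μ * o := by linarith
  have hp1 : 1 ≤ (1 - l * o)⁻¹ := (one_le_inv₀ hp).2 (by nlinarith [H.om])
  have hq1 : 1 ≤ (1 - μ * o)⁻¹ := (one_le_inv₀ hq).2 (by nlinarith [H.om])
  have hM : 0 ≤ ‖x - J d x‖ / d := by positivity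
  set M := ‖x - J d x‖ / d with hMd
  set e := ‖x - J d x‖ with he
  have he0 : 0 ≤ e := norm_nonneg _
  have D0 : ∀ i j, 0 ≤ Dq l μ i j := fun _ _ => Real.sqrt_nonneg _
  have left : ∀ i, ‖(J l)^[i] x - x‖ ≤ ((1 - l * o)⁻¹) ^ i * (2 * e + M * Dq l μ i 0) := by
    intro i
    have h1 := H.base hd hdo hl hlo hx i
    have h2 := norm_sub_le_norm_sub_add_norm_sub ((J l)^[i] x) (J d x) x
    rw [norm_sub_rev (J d x) x] at h2
    have h3 : i * l ≤ Dq l μ i 0 := by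
      refine Real.le_sqrt_of_sq_le ?_
      simp; positivity
    have h5 := one_le_pow₀ hp1 (n := i)
    set P := ((1 - l * o)⁻¹) ^ i
    calc _ ≤ P * (e + i * l * M) + P * e := by nlinarith
      _ = P * (2 * e + M * (i * l)) := by ring
      _ ≤ _ := by gcongr
  have right : ∀ j, ‖x - (J μ)^[j] x‖ ≤ ((1 - μ * o)⁻¹) ^ j * (2 * e + M * Dq l μ 0 j) := by
    intro i
    have h1 := H.base hd hdo hμ hμo hx i
    have h2 := norm_sub_le_norm_sub_add_norm_sub ((J μ)^[i] x) (J d x) x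
    rw [norm_sub_rev (J d x) x] at h2
    have h3 : i * μ ≤ Dq l μ 0 i := by
      refine Real.le_sqrt_of_sq_le ?_
      simp; positivity
    have h5 := one_le_pow₀ hq1 (n := i)
    rw [norm_sub_rev]
    set P := ((1 - μ * o)⁻¹) ^ i
    calc _ ≤ P * (e + i * μ * M) + P * e := by nlinarith
      _ = P * (2 * e + M * (i * μ)) := by ring
      _ ≤ _ := by gcongr
  induction i generalizing j with
  | zero => simpa using right j
  | succ i ihi =>
    induction j with
    | zero => simpa using left (i + 1)
    | succ j ihj =>
      have hk := H.kob l μ hl hlo hμ hμo _ (H.it hl hlo hx i) _ (H.it hμ hμo hx j)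
      have h2 := ihi (j + 1)
      rw [Function.iterate_succ_apply'] at ihj h2
      rw [Function.iterate_succ_apply', Function.iterate_succ_apply']
      have hs := Dq_step hl hμ H.om hlo hμo i j
      have hc : 0 < l + μ - l * μ * o := by nlinarith
      set P := ((1 - l * o)⁻¹) with hP
      set Q := ((1 - μ * o)⁻¹) with hQ
      have hPP : P * (1 - l * o) = 1 := inv_mul_cancel₀ hp.ne'
      have hQQ : Q * (1 - μ * o) = 1 := inv_mul_cancel₀ hq.ne'
      have hP0 : 0 < P := by positivity
      have hQ0 : 0 < Q := by positivity
      rw [← mul_le_mul_iff_right₀ hc]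
      refine hk.trans ((add_le_add (mul_le_mul_of_nonneg_left ihj hl.le) (mul_le_mul_of_nonneg_left h2 hμ.le)).trans ?_)
      have e1 : l * (P ^ (i + 1) * Q ^ j * (2 * e + M * Dq l μ (i + 1) j)) +
          μ * (P ^ i * Q ^ (j + 1) * (2 * e + M * Dq l μ i (j + 1))) =
          P ^ (i + 1) * Q ^ (j + 1) * (2 * e * (l * (1 - μ * o) + μ * (1 - l * o)) +
            M * (l * (1 - μ * o) * Dq l μ (i + 1) j + μ * (1 - l * o) * Dq l μ i (j + 1))) := by
        have a1 : P ^ (i + 1) * Q ^ j = P ^ (i + 1) * Q ^ (j + 1) * (1 - μ * o) := by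
          rw [pow_succ Q, mul_assoc, mul_assoc, hQQ, mul_one]
        have a2 : P ^ i * Q ^ (j + 1) = P ^ (i + 1) * Q ^ (j + 1) * (1 - l * o) := by
          rw [pow_succ P, mul_right_comm, mul_assoc (P ^ i), hPP, mul_one]
        rw [a1, a2]; ring
      rw [e1, mul_left_comm]
      refine mul_le_mul_of_nonneg_left ?_ (by positivity)
      have h5 : 2 * e * (l * (1 - μ * o) + μ * (1 - l * o)) ≤ 2 * e * (l + μ - l * μ * o) := by
        refine mul_le_mul_of_nonneg_left ?_ (by positivity)
        have : 0 ≤ l * μ * o := mul_nonneg (by positivity) H.om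
        nlinarith
      have h6 := mul_le_mul_of_nonneg_left hs hM
      nlinarith

lemma inv_pow_bd {l o L : ℝ} (hl : 0 < l) (ho : 0 ≤ o) (hlo : l * o ≤ 1 / 2) (i : ℕ) (hi : i * l ≤ L) :
    ((1 - l * o)⁻¹) ^ i ≤ Real.exp (2 * o * L) := by
  have h0 : 0 ≤ l * o := by positivity
  have h1 : (1 - l * o)⁻¹ ≤ Real.exp (2 * (l * o)) := by
    have h2 := Real.add_one_le_exp (2 * (l * o))
    refine le_trans ?_ h2
    rw [inv_le_iff_one_le_mul₀ (by linarith)]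
    nlinarith
  calc _ ≤ (Real.exp (2 * (l * o))) ^ i := pow_le_pow_left₀ (inv_nonneg.2 (by linarith)) h1 i
    _ = Real.exp (2 * o * (i * l)) := by rw [← Real.exp_nat_mul]; ring_nf
    _ ≤ _ := by gcongr

/-- the step iterates `J_{1/n}^i x` -/
def itn (J : ℝ → X → X) (x : X) (n i : ℕ) : X := (J (1 / n))^[i] x

lemma RF.cauchy (H : RF C J o) {x : X} (hx : x ∈ C) (L : ℝ) {ε : ℝ} (hε : 0 < ε) :
    ∃ n0 : ℕ, ∃ δ > 0, ∀ n k i j : ℕ, n0 ≤ n → n0 ≤ k → (i:ℝ) / n ≤ L → (j:ℝ) / k ≤ L → |(i:ℝ) / n - j / k| ≤ δ →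
      ‖itn J x n i - itn J x k j‖ ≤ ε := by
  set E := Real.exp (2 * o * L) with hE
  have hE0 : 0 < E := Real.exp_pos _
  have hE2 : 0 < E * E := by positivity
  obtain ⟨d, hd, hdo, hdd⟩ := H.dens x hx (ε / (4 * (E * E))) (by positivity)
  rw [norm_sub_rev] at hdd
  set M := ‖x - J d x‖ / d
  have hM : 0 ≤ M := by positivity
  set η := ε / (2 * (E * E) * (M + 1)) with hη
  have hη0 : 0 < η := by positivity
  obtain ⟨n1, hn1⟩ := exists_nat_gt (2 * o)
  obtain ⟨n2, hn2⟩ := exists_nat_gt (4 * |L| / η ^ 2)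
  refine ⟨max (max n1 n2) 1, η / 2, by positivity, fun n k i j hn hk hi hj hij => ?_⟩
  have pos : ∀ n : ℕ, max (max n1 n2) 1 ≤ n → (0:ℝ) < n ∧ (1 / (n:ℝ)) * o ≤ 1 / 2 ∧ |L| / n ≤ η ^ 2 / 4 := by
    intro n hn
    have a1 : (1:ℝ) ≤ n := by exact_mod_cast (le_max_right _ _).trans hn
    have a2 : (n1:ℝ) ≤ n := by exact_mod_cast ((le_max_left _ _).trans (le_max_left _ _)).trans hn
    have a3 : (n2:ℝ) ≤ n := by exact_mod_cast ((le_max_right _ _).trans (le_max_left _ _)).trans hn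
    have a0 : (0:ℝ) < n := by linarith
    refine ⟨a0, ?_, ?_⟩
    · rw [one_div, inv_mul_le_iff₀ a0]; linarith
    · rw [div_le_iff₀ a0]
      have := hn2.trans_le a3
      rw [div_lt_iff₀ (by positivity)] at this
      linarith
  obtain ⟨b1, b2, b3⟩ := pos n hn
  obtain ⟨c1, c2, c3⟩ := pos k hk
  have est := H.est hd hdo (l := 1 / n) (μ := 1 / k) (by positivity) (by linarith) (by positivity) (by linarith) hx i j
  have e1 := inv_pow_bd (l := 1 / n) (L := L) (by positivity) H.om b2 i (by rw [mul_one_div]; exact hi)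
  have e2 := inv_pow_bd (l := 1 / k) (L := L) (by positivity) H.om c2 j (by rw [mul_one_div]; exact hj)
  have hD : Dq (1 / n) (1 / k) i j ≤ η := by
    refine Real.sqrt_le_iff.2 ⟨hη0.le, ?_⟩
    have f1 : (i:ℝ) * (1 / n) ^ 2 ≤ η ^ 2 / 4 := by
      refine le_trans ?_ b3
      have : (i:ℝ) * (1 / n) ^ 2 = (i / n) / n := by field_simp
      rw [this]; gcongr; exact hi.trans (le_abs_self _)
    have f2 : (j:ℝ) * (1 / k) ^ 2 ≤ η ^ 2 / 4 := by
      refine le_trans ?_ c3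
      have : (j:ℝ) * (1 / k) ^ 2 = (j / k) / k := by field_simp
      rw [this]; gcongr; exact hj.trans (le_abs_self _)
    have f3 : ((i:ℝ) * (1 / n) - j * (1 / k)) ^ 2 ≤ η ^ 2 / 4 := by
      rw [mul_one_div, mul_one_div, ← sq_abs]
      calc _ ≤ (η / 2) ^ 2 := by gcongr
        _ = _ := by ring
    nlinarith [sq_nonneg η]
  refine est.trans ?_
  have hg0 : 0 ≤ 1 - 1 / (n:ℝ) * o := by linarith
  have hg1 : 0 ≤ 1 - 1 / (k:ℝ) * o := by linarith
  have hD0 : 0 ≤ Dq (1 / n) (1 / k) i j := Real.sqrt_nonneg _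
  calc _ ≤ E * E * (2 * (ε / (4 * (E * E))) + M * η) := by
        refine mul_le_mul (mul_le_mul e1 e2 (by positivity) hE0.le) ?_ ?_ hE2.le
        · gcongr
        · positivity
    _ ≤ E * E * (2 * (ε / (4 * (E * E))) + (M + 1) * η) := by gcongr; linarith
    _ = ε := by rw [hη]; field_simp; norm_num

variable [CompleteSpace X]

/-- Exponential formula: existence of the limit semigroup orbit. -/
theorem RF.exists_orbit (H : RF C J o) (hC : IsClosed C) {x : X} (hx : x ∈ C) :
    ∃ S : ℝ → X, S 0 = x ∧ (∀ t, 0 ≤ t → S t ∈ C) ∧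
      ∀ L, ∀ ε > 0, ∃ n0 : ℕ, ∃ δ > 0, ∀ (n i : ℕ) (t : ℝ), n0 ≤ n → (i:ℝ) / n ≤ L → 0 ≤ t → t ≤ L → |(i:ℝ) / n - t| ≤ δ →
        ‖itn J x n i - S t‖ ≤ ε := by
  have fl : ∀ (n : ℕ) (t : ℝ), 0 < n → 0 ≤ t → (⌊(n:ℝ) * t⌋₊ : ℝ) / n ≤ t ∧ t - 1 / n < (⌊(n:ℝ) * t⌋₊ : ℝ) / n := by
    intro n t hn ht
    have hn' : (0:ℝ) < n := by exact_mod_cast hn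
    have h1 := Nat.floor_le (mul_nonneg hn'.le ht)
    have h2 := Nat.lt_floor_add_one ((n:ℝ) * t)
    constructor
    · rw [div_le_iff₀ hn']; linarith
    · rw [lt_div_iff₀ hn', sub_mul, one_div, inv_mul_cancel₀ hn'.ne']; linarith
  have small : ∀ δ > (0:ℝ), ∃ n1 : ℕ, ∀ n, n1 ≤ n → 0 < n ∧ 1 / (n:ℝ) ≤ δ := by
    intro δ hδ
    obtain ⟨n1, h1⟩ := exists_nat_gt (1 / δ)
    refine ⟨max n1 1, fun n hn => ?_⟩
    have a1 : 1 ≤ n := (le_max_right _ _).trans hn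
    have a2 : (n1:ℝ) ≤ n := by exact_mod_cast (le_max_left _ _).trans hn
    refine ⟨a1, ?_⟩
    rw [div_le_comm₀ (by exact_mod_cast a1) hδ]; linarith
  have cs : ∀ t, 0 ≤ t → CauchySeq (fun n : ℕ => itn J x n ⌊(n:ℝ) * t⌋₊) := by
    intro t ht
    rw [Metric.cauchySeq_iff']
    intro ε hε
    obtain ⟨n0, δ, hδ, h⟩ := H.cauchy hx t (half_pos hε)
    obtain ⟨n1, h1⟩ := small δ hδ
    refine ⟨max n0 n1, fun n hn => ?_⟩
    obtain ⟨a0, a1⟩ := h1 n ((le_max_right _ _).trans hn)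
    obtain ⟨c0, c1⟩ := h1 (max n0 n1) (le_max_right _ _)
    obtain ⟨d1, d2⟩ := fl n t a0 ht
    obtain ⟨d3, d4⟩ := fl _ t c0 ht
    rw [dist_eq_norm]
    refine (h n _ _ _ ((le_max_left _ _).trans hn) (le_max_left _ _) d1 d3 ?_).trans_lt (half_lt_self hε)
    rw [abs_le]; constructor <;> linarith
  choose! S hS using fun t (ht : 0 ≤ t) => cauchySeq_tendsto_of_complete (cs t ht)
  refine ⟨S, ?_, ?_, ?_⟩
  · have h := hS 0 le_rfl
    have e : (fun n : ℕ => itn J x n ⌊(n:ℝ) * 0⌋₊) = fun _ => x := by funext n; simp [itn]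
    rw [e] at h
    exact (tendsto_nhds_unique h tendsto_const_nhds)
  · intro t ht
    refine hC.mem_of_tendsto (hS t ht) ?_
    obtain ⟨n1, h1⟩ := small (1 / (o + 1)) (by have := H.om; positivity)
    filter_upwards [eventually_ge_atTop n1] with n hn
    obtain ⟨a0, a1⟩ := h1 n hn
    have a0' : (0:ℝ) < n := by exact_mod_cast a0
    refine H.it (by positivity) ?_ hx _
    have := H.om
    calc 1 / (n:ℝ) * o ≤ 1 / (o + 1) * o := by gcongr
      _ < 1 := by rw [one_div, inv_mul_lt_iff₀ (by positivity)]; linarith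
  · intro L ε hε
    obtain ⟨n0, δ, hδ, h⟩ := H.cauchy hx L hε
    obtain ⟨n1, h1⟩ := small (δ / 2) (by positivity)
    refine ⟨n0, δ / 2, by positivity, fun n i t hn hi ht htL hit => ?_⟩
    refine le_of_tendsto ((hS t ht).const_sub (itn J x n i)).norm ?_
    filter_upwards [eventually_ge_atTop (max n0 n1)] with k hk
    obtain ⟨a0, a1⟩ := h1 k ((le_max_right _ _).trans hk)
    obtain ⟨d1, d2⟩ := fl k t a0 ht
    refine h n k i _ hn ((le_max_left _ _).trans hk) hi (d1.trans htL) ?_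
    rw [abs_le] at hit ⊢; constructor <;> linarith [hit.1, hit.2]
end CL
end Blow

end

end

section
open MeasureTheory Metric Filter Set ENNReal
open scoped Topology
noncomputable section
namespace Blow
section CL
variable {X : Type*} [NormedAddCommGroup X]
variable {C : Set X} {J : ℝ → X → X} {o : ℝ}

/-- uniform approximation of `S` by step iterates -/
def Appx (J : ℝ → X → X) (x : X) (S : ℝ → X) : Prop :=
  ∀ L, ∀ ε > 0, ∃ n0 : ℕ, ∃ δ > 0, ∀ (n i : ℕ) (t : ℝ), n0 ≤ n → (i:ℝ) / n ≤ L → 0 ≤ t → t ≤ L → |(i:ℝ) / n - t| ≤ δ →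
        ‖itn J x n i - S t‖ ≤ ε

lemma fl_le {n : ℕ} {t : ℝ} (hn : 0 < n) (ht : 0 ≤ t) :
    (⌊t * (n:ℝ)⌋₊ : ℝ) / n ≤ t ∧ t - 1 / n < (⌊t * (n:ℝ)⌋₊ : ℝ) / n := by
  have hn' : (0:ℝ) < n := by exact_mod_cast hn
  have h1 := Nat.floor_le (mul_nonneg ht hn'.le)
  have h2 := Nat.lt_floor_add_one (t * (n:ℝ))
  constructor
  · rw [div_le_iff₀ hn']; linarith
  · rw [lt_div_iff₀ hn', sub_mul, one_div, inv_mul_cancel₀ hn'.ne']; linarith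

lemma fl_tendsto {t : ℝ} (ht : 0 ≤ t) : Tendsto (fun n : ℕ => (⌊t * (n:ℝ)⌋₊ : ℝ) / n) atTop (𝓝 t) :=
  (tendsto_nat_floor_mul_div_atTop ht).comp tendsto_natCast_atTop_atTop

lemma Appx.tendsto {x : X} {S : ℝ → X} (h : Appx J x S) {t : ℝ} (ht : 0 ≤ t) :
    Tendsto (fun n : ℕ => itn J x n ⌊t * (n:ℝ)⌋₊) atTop (𝓝 (S t)) := by
  rw [tendsto_iff_norm_sub_tendsto_zero, Metric.tendsto_atTop]
  intro ε hε
  obtain ⟨n0, δ, hδ, h1⟩ := h t (ε / 2) (half_pos hε)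
  obtain ⟨n1, h2⟩ := (Metric.tendsto_atTop.1 (fl_tendsto ht)) δ hδ
  refine ⟨max (max n0 n1) 1, fun n hn => ?_⟩
  have a0 : 0 < n := (le_max_right _ _).trans hn
  have a1 : n0 ≤ n := ((le_max_left _ _).trans (le_max_left _ _)).trans hn
  have a2 : n1 ≤ n := ((le_max_right _ _).trans (le_max_left _ _)).trans hn
  have := h1 n _ t a1 (fl_le a0 ht).1 ht le_rfl (h2 n a2).le
  rw [dist_zero_right, norm_norm]
  linarith

lemma Appx.unif {x : X} {S : ℝ → X} (h : Appx J x S) (L : ℝ) {ε : ℝ} (hε : 0 < ε) :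
    ∃ δ > 0, ∀ s t, 0 ≤ s → 0 ≤ t → s ≤ L → t ≤ L → |s - t| ≤ δ → ‖S s - S t‖ ≤ ε := by
  obtain ⟨n0, δ, hδ, h1⟩ := h L ε hε
  refine ⟨δ / 2, by positivity, fun s t hs ht hsL htL hst => ?_⟩
  refine le_of_tendsto ((h.tendsto hs).sub_const (S t)).norm ?_
  obtain ⟨n1, h2⟩ := (Metric.tendsto_atTop.1 (fl_tendsto hs)) (δ / 2) (by positivity)
  filter_upwards [eventually_ge_atTop (max (max n0 n1) 1)] with n hn
  have a0 : 0 < n := (le_max_right _ _).trans hn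
  have a1 : n0 ≤ n := ((le_max_left _ _).trans (le_max_left _ _)).trans hn
  have a2 : n1 ≤ n := ((le_max_right _ _).trans (le_max_left _ _)).trans hn
  refine h1 n _ t a1 ((fl_le a0 hs).1.trans hsL) ht htL ?_
  have := (h2 n a2).le
  rw [Real.dist_eq] at this
  rw [abs_le] at *; constructor <;> linarith

lemma small_inv {δ : ℝ} (hδ : 0 < δ) : ∃ n1 : ℕ, ∀ n, n1 ≤ n → 0 < n ∧ 1 / (n:ℝ) ≤ δ := by
  obtain ⟨n1, h1⟩ := exists_nat_gt (1 / δ)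
  refine ⟨max n1 1, fun n hn => ?_⟩
  have a1 : 1 ≤ n := (le_max_right _ _).trans hn
  have a2 : (n1:ℝ) ≤ n := by exact_mod_cast (le_max_left _ _).trans hn
  refine ⟨a1, ?_⟩
  rw [div_le_comm₀ (by exact_mod_cast a1) hδ]; linarith

lemma RF.small (H : RF C J o) : ∃ n1 : ℕ, ∀ n : ℕ, n1 ≤ n → 0 < n ∧ 1 / (n:ℝ) * o < 1 := by
  have := H.om
  obtain ⟨n1, h1⟩ := small_inv (δ := 1 / (o + 1)) (by positivity)
  refine ⟨n1, fun n hn => ⟨(h1 n hn).1, ?_⟩⟩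
  calc 1 / (n:ℝ) * o ≤ 1 / (o + 1) * o := by have := (h1 n hn).2; gcongr
      _ < 1 := by rw [one_div, inv_mul_lt_iff₀ (by positivity)]; linarith

theorem RF.orbit_deriv (H : RF C J o) {x : X} (hx : x ∈ C) {S : ℝ → X} (h : Appx J x S)
    (hSC : ∀ t, 0 ≤ t → S t ∈ C) {ℓ F : X → ℝ} (hℓ : ContinuousOn ℓ C) (hF : ContinuousOn F C)
    (step : ∀ l, 0 < l → l * o < 1 → ∀ y ∈ C, ℓ (J l y) - ℓ y = l * F (J l y)) {t0 : ℝ} (ht0 : 0 ≤ t0) {ε : ℝ} (hε : 0 < ε) :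
    ∃ δ > 0, ∀ t s, 0 ≤ t → t ≤ s → |t - t0| ≤ δ → |s - t0| ≤ δ →
      |ℓ (S s) - ℓ (S t) - (s - t) * F (S t0)| ≤ ε * (s - t) := by
  obtain ⟨η, hη, hF1⟩ := Metric.continuousOn_iff.1 hF (S t0) (hSC t0 ht0) ε hε
  obtain ⟨n0, δ, hδ, h1⟩ := h (t0 + 1) (η / 2) (half_pos hη)
  obtain ⟨n1, hn1⟩ := small_inv (half_pos hδ)
  obtain ⟨n2, hn2⟩ := H.small
  refine ⟨min (δ / 2) 1, by positivity, fun t s ht hts htt hst => ?_⟩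
  have hs := ht.trans hts
  have hd1 := min_le_left (δ / 2) 1
  have hd2 := min_le_right (δ / 2) 1
  rw [abs_le] at htt hst
  have lt := (hℓ (S t) (hSC t ht)).tendsto.comp (tendsto_nhdsWithin_iff.2 ⟨h.tendsto ht, by
    filter_upwards [eventually_ge_atTop n2] with n hn
    exact H.it (by have := (hn2 n hn).1; positivity) (hn2 n hn).2 hx _⟩)
  have ls := (hℓ (S s) (hSC s hs)).tendsto.comp (tendsto_nhdsWithin_iff.2 ⟨h.tendsto hs, by
    filter_upwards [eventually_ge_atTop n2] with n hn
    exact H.it (by have := (hn2 n hn).1; positivity) (hn2 n hn).2 hx _⟩)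
  have ft := fl_tendsto ht
  have fs := fl_tendsto hs
  refine le_of_tendsto_of_tendsto ((ls.sub lt).sub ((fs.sub ft).mul_const (F (S t0)))).abs
    ((fs.sub ft).const_mul ε) ?_
  filter_upwards [eventually_ge_atTop (max (max n0 n1) n2)] with n hn
  have a0 : n2 ≤ n := (le_max_right _ _).trans hn
  have a1 : n0 ≤ n := ((le_max_left _ _).trans (le_max_left _ _)).trans hn
  have a2 : n1 ≤ n := ((le_max_right _ _).trans (le_max_left _ _)).trans hn
  obtain ⟨b0, b1⟩ := hn1 n a2
  obtain ⟨-, b2⟩ := hn2 n a0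
  have b0' : (0:ℝ) < n := by exact_mod_cast b0
  set p := ⌊t * (n:ℝ)⌋₊ with hp
  have main : ∀ q : ℕ, p ≤ q → (q:ℝ) / n ≤ s →
      |ℓ (itn J x n q) - ℓ (itn J x n p) - ((q:ℝ) / n - p / n) * F (S t0)| ≤ ε * ((q:ℝ) / n - p / n) := by
    intro q hq
    induction q, hq using Nat.le_induction with
    | base => intro _; simp
    | succ q hq ih =>
      intro hqs
      push_cast at hqs
      have c1 : (q:ℝ) / n ≤ s := le_trans (by gcongr; linarith) hqs
      have ih' := ih c1
      have c2 : (p:ℝ) / n ≤ ((q:ℝ) + 1) / n := by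
        gcongr; have : (p:ℝ) ≤ q := by exact_mod_cast hq
        linarith
      have c3 := (fl_le b0 ht).2
      have mem : itn J x n q ∈ C := H.it (by positivity) b2 hx _
      have mem2 : itn J x n (q + 1) ∈ C := H.it (by positivity) b2 hx _
      have e1 : itn J x n (q + 1) = J (1 / n) (itn J x n q) := Function.iterate_succ_apply' _ _ _
      have st := step (1 / n) (by positivity) b2 _ mem
      rw [← e1] at st
      have cl := h1 n (q + 1) t0 a1 (by push_cast; linarith [hst.2]) ht0 (by linarith) (by
        push_cast
        rw [abs_le]; constructor
        · linarith [htt.1]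
        · linarith [hst.2])
      have cF := (hF1 _ mem2 (by rw [dist_eq_norm]; linarith)).le
      rw [Real.dist_eq] at cF
      have e2 : ℓ (itn J x n (q + 1)) - ℓ (itn J x n p) - (((q + 1 : ℕ):ℝ) / n - p / n) * F (S t0) =
        (ℓ (itn J x n q) - ℓ (itn J x n p) - ((q:ℝ) / n - p / n) * F (S t0)) +
          1 / n * (F (itn J x n (q + 1)) - F (S t0)) := by
        push_cast
        rw [mul_sub (1 / (n:ℝ)), ← st]; ring
      rw [e2]
      refine (abs_add_le _ _).trans ?_
      rw [abs_mul, abs_of_pos (by positivity : (0:ℝ) < 1 / n)]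
      have : 1 / (n:ℝ) * |F (itn J x n (q + 1)) - F (S t0)| ≤ 1 / n * ε := by gcongr
      push_cast
      calc _ ≤ _ := add_le_add ih' this
        _ = _ := by ring
  exact main _ (Nat.floor_mono (by gcongr)) (fl_le b0 hs).1
end CL
end Blow

end

end

section
open MeasureTheory Metric Filter Set ENNReal
open scoped Topology
noncomputable section
namespace Blow
variable {N : ℕ}
namespace Dat
variable {D : Dat N}

/-- the weighted `L¹` space -/
abbrev LX (D : Dat N) := Lp ℝ 1 (wm D.w)

/-- the order interval -/
def CS (D : Dat N) : Set D.LX := {f | ∀ᵐ x, D.W1 x ≤ f x ∧ f x ≤ D.W x}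

lemma lx_aesm (f : D.LX) : AEStronglyMeasurable f volume :=
  (wm_aesm D.wmeas D.wpos).1 (Lp.aestronglyMeasurable f)

lemma CS.rg {f : D.LX} (hf : f ∈ D.CS) : D.Rg f := by
  refine ⟨lx_aesm f, ?_⟩
  filter_upwards [hf] with x hx
  exact ⟨(D.W1pos x).le.trans hx.1, hx.2⟩

lemma lx_norm (f g : D.LX) : ‖f - g‖ = D.nm (fun x => f x - g x) := by
  rw [L1.norm_eq_integral_norm, wm_integral D.wmeas D.wpos]
  refine integral_congr_ae ?_
  have := (wm_ae D.wmeas D.wpos).1 (Lp.coeFn_sub f g)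
  filter_upwards [this] with x hx
  rw [hx]; rfl

lemma exists_lx {v : Euc N → ℝ} (hv : D.Rg v) : ∃ f : D.LX, ∀ᵐ x, f x = v x := by
  have hi : Integrable v (wm D.w) := (wm_int D.wmeas D.wpos).2 hv.int
  exact ⟨hi.toL1 v, (wm_ae D.wmeas D.wpos).1 hi.coeFn_toL1⟩

lemma CS_closed : IsClosed D.CS := by
  obtain ⟨f, hf⟩ := exists_lx (RgW (D := D))
  obtain ⟨g, hg⟩ := exists_lx (RgW1 (D := D))
  have : D.CS = Icc g f := by
    ext h
    rw [mem_Icc, ← Lp.coeFn_le, ← Lp.coeFn_le]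
    constructor
    · intro hh
      refine ⟨(wm_ae D.wmeas D.wpos).2 ?_, (wm_ae D.wmeas D.wpos).2 ?_⟩
      · filter_upwards [hh, hg] with x h1 h2; rw [h2]; exact h1.1
      · filter_upwards [hh, hf] with x h1 h2; rw [h2]; exact h1.2
    · rintro ⟨h1, h2⟩
      have h1 := (wm_ae D.wmeas D.wpos).1 h1
      have h2 := (wm_ae D.wmeas D.wpos).1 h2
      show ∀ᵐ x, _
      filter_upwards [h1, h2, hf, hg] with x a b c d
      rw [c] at b; rw [d] at a; exact ⟨a, b⟩
  rw [this]; exact isClosed_Icc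

lemma Res.congr_right {h : ℝ} {u v v' : Euc N → ℝ} (P : D.Res h u v) (e : ∀ᵐ x, v' x = v x) : D.Res h u v' := by
  have ea : (fun x => (u x - v' x) / h) =ᵐ[volume] fun x => (u x - v x) / h := by
    filter_upwards [e] with x hx; rw [hx]
  refine ⟨⟨P.rg.1.congr (EventuallyEq.symm e), ?_⟩, P.am.congr ea.symm, P.ai.congr ?_, fun φ hφ => ?_⟩
  · filter_upwards [e, P.rg.2] with x h1 h2; rw [h1]; exact h2
  · filter_upwards [e] with x hx; rw [hx]
  · have := P.eq φ hφ
    refine Eq.trans (integral_congr_ae ?_) (this.trans (integral_congr_ae ?_))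
    · filter_upwards [e] with x hx; rw [hx]
    · filter_upwards [e] with x hx; rw [hx]

lemma exists_J (l : ℝ) (f : D.LX) : ∃ g : D.LX, 0 < l → l * D.om < 1 → f ∈ D.CS → g ∈ D.CS ∧ D.Res l f g := by
  by_cases h : 0 < l ∧ l * D.om < 1 ∧ f ∈ D.CS
  · obtain ⟨h1, h2, h3⟩ := h
    obtain ⟨v, hv⟩ := res_exists (CS.rg h3) h1
    obtain ⟨g, hg⟩ := exists_lx hv.rg
    refine ⟨g, fun _ _ _ => ⟨?_, hv.congr_right hg⟩⟩
    have h4 := res_ge h1 h2 (CS.rg h3) (by filter_upwards [h3] with x hx using hx.1) hv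
    show ∀ᵐ x, _
    filter_upwards [h4, hg, hv.rg.2] with x a b c
    rw [b]; exact ⟨a, c.2⟩
  · exact ⟨0, fun h1 h2 h3 => absurd ⟨h1, h2, h3⟩ h⟩

/-- the resolvent on the weighted `L¹` space -/
def Jr (D : Dat N) (l : ℝ) (f : D.LX) : D.LX := (exists_J l f).choose
lemma Jr_mem {l : ℝ} {f : D.LX} (hl : 0 < l) (hlo : l * D.om < 1) (hf : f ∈ D.CS) : D.Jr l f ∈ D.CS :=
  ((exists_J l f).choose_spec hl hlo hf).1
lemma Jr_res {l : ℝ} {f : D.LX} (hl : 0 < l) (hlo : l * D.om < 1) (hf : f ∈ D.CS) : D.Res l f (D.Jr l f) :=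
  ((exists_J l f).choose_spec hl hlo hf).2

lemma rf : RF D.CS D.Jr D.om where
  om := om_nonneg
  maps := fun l hl hlo f hf => Jr_mem hl hlo hf
  contr := fun l hl hlo f hf g hg => by
    rw [lx_norm, lx_norm]
    exact Dat.contr hl (CS.rg hf) (CS.rg hg) (Jr_res hl hlo hf) (Jr_res hl hlo hg)
  kob := fun l μ hl hlo hμ hμo f hf g hg => by
    rw [lx_norm, lx_norm, lx_norm]
    exact Dat.kob hl hμ (CS.rg hf) (CS.rg hg) (Jr_res hl hlo hf) (Jr_res hμ hμo hg)
  dens := fun f hf ε hε => by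
    have ho := om_nonneg (D := D)
    set h : ℕ → ℝ := fun n => (1 / (D.om + 1)) * (1 / ((n:ℝ) + 1)) with hh
    have hp : ∀ n, 0 < h n := fun n => by positivity
    have ho1 : ∀ n, h n * D.om < 1 := fun n => by
      have : h n ≤ 1 / (D.om + 1) := by
        refine mul_le_of_le_one_right (by positivity) ?_
        rw [div_le_one (by positivity)]; linarith [Nat.cast_nonneg (α := ℝ) n]
      calc h n * D.om ≤ 1 / (D.om + 1) * D.om := by gcongr
        _ < 1 := by rw [one_div, inv_mul_lt_iff₀ (by positivity)]; linarith
    have ht : Tendsto h atTop (𝓝 0) := by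
      simpa [hh] using (tendsto_one_div_add_atTop_nhds_zero_nat (𝕜 := ℝ)).const_mul (1 / (D.om + 1))
    obtain ⟨ns, -, hns⟩ := density (CS.rg hf) hp ht (fun n => Jr_res (hp n) (ho1 n) hf)
    obtain ⟨k, hk⟩ := ((hns.eventually (gt_mem_nhds hε))).exists
    refine ⟨h (ns k), hp _, ho1 _, ?_⟩
    rw [lx_norm]; exact hk.le

lemma pow_lip {a b W m : ℝ} (hm : 1 < m) (ha : 0 ≤ a) (hb : 0 ≤ b) (haW : a ≤ W) (hbW : b ≤ W) :
    |a ^ m - b ^ m| ≤ m * W ^ (m - 1) * |a - b| := by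
  rcases le_total a b with h | h
  · have h1 := Real.rpow_le_rpow ha h (by linarith : 0 ≤ m)
    rw [abs_sub_comm, abs_sub_comm a, abs_of_nonneg (by linarith), abs_of_nonneg (by linarith)]
    exact pow_diff hm ha h hbW
  · have h1 := Real.rpow_le_rpow hb h (by linarith : 0 ≤ m)
    rw [abs_of_nonneg (by linarith), abs_of_nonneg (by linarith)]
    exact pow_diff hm hb h haW

lemma sg_bd {b : Euc N → ℝ} (hb : Continuous b) (hs : HasCompactSupport b) (q : ℝ) :
    ∃ C, 0 ≤ C ∧ ∀ x, sg x ^ q * |b x| ≤ C := by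
  obtain ⟨C, hC⟩ := (hs.mul_left (f := fun x => sg x ^ q)).exists_bound_of_continuous ((sgpow_cont q).mul hb)
  refine ⟨C, (norm_nonneg _).trans (hC 0), fun x => ?_⟩
  have := hC x
  simp only [Pi.mul_apply, Real.norm_eq_abs, abs_mul, abs_of_pos (Real.rpow_pos_of_pos (sg_pos x) q)] at this
  exact this

lemma lip1 {φ : Euc N → ℝ} (hb : Continuous φ) (hs : HasCompactSupport φ) :
    ∃ C, 0 ≤ C ∧ ∀ u v, D.Rg u → D.Rg v →
      |(∫ x, D.ρ x * u x * φ x) - ∫ x, D.ρ x * v x * φ x| ≤ C * D.nm (fun x => u x - v x) := by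
  obtain ⟨C, hC0, hC⟩ := sg_bd hb hs D.p
  refine ⟨C, hC0, fun u v hu hv => ?_⟩
  rw [← integral_sub (locInt_mul (Wloc_of hu.int) hb hs) (locInt_mul (Wloc_of hv.int) hb hs),
    ← Real.norm_eq_abs, nm, ← integral_const_mul]
  refine norm_integral_le_of_norm_le ((subint hu hv).const_mul C) ?_
  filter_upwards [D.ρpos] with x hx
  have e : D.ρ x * u x * φ x - D.ρ x * v x * φ x = D.ρ x * (sg x ^ (-D.p) * sg x ^ D.p) * (u x - v x) * φ x := by
    rw [← Real.rpow_add (sg_pos x)]; simp; ring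
  have s1 := Real.rpow_pos_of_pos (sg_pos x) (-D.p)
  have s2 := Real.rpow_pos_of_pos (sg_pos x) (D.p)
  rw [e, Real.norm_eq_abs, abs_mul, abs_mul, abs_of_pos (by positivity)]
  calc _ = (sg x ^ D.p * |φ x|) * (D.w x * |u x - v x|) := by simp only [w]; ring
    _ ≤ _ := mul_le_mul_of_nonneg_right (hC x) (by unfold w; positivity)

lemma lip2 {b : Euc N → ℝ} (hb : Continuous b) (hs : HasCompactSupport b) :
    ∃ C, 0 ≤ C ∧ ∀ u v, D.Rg u → D.Rg v →
      |(∫ x, u x ^ D.m * b x) - ∫ x, v x ^ D.m * b x| ≤ C * D.nm (fun x => u x - v x) := by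
  obtain ⟨C, hC0, hC⟩ := sg_bd hb hs (D.p + 1)
  have hC1 := D.hC1
  have hm := D.hm
  refine ⟨D.m * D.C1 * C, by have : 0 ≤ D.m := by linarith
                             positivity, fun u v hu hv => ?_⟩
  rw [← integral_sub (locInt_mul hu.powloc hb hs) (locInt_mul hv.powloc hb hs),
    ← Real.norm_eq_abs, nm, ← integral_const_mul]
  refine norm_integral_le_of_norm_le ((subint hu hv).const_mul _) ?_
  filter_upwards [D.ρpos, hu.2, hv.2, D.Wpow] with x hx h1 h2 h3
  have hp := pow_lip D.hm h1.1 h2.1 h1.2 h2.2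
  have hsg := sg_pos x
  have s1 := Real.rpow_pos_of_pos (sg_pos x) (-D.p)
  have s2 := Real.rpow_pos_of_pos (sg_pos x) (D.p)
  have e : sg x = sg x ^ (-D.p) * sg x ^ (D.p + 1) := by
    rw [← Real.rpow_add (sg_pos x)]; simp
  rw [← sub_mul, Real.norm_eq_abs, abs_mul]
  calc _ ≤ (D.m * (D.C1 * sg x * D.ρ x) * |u x - v x|) * |b x| := by
        refine mul_le_mul_of_nonneg_right (hp.trans ?_) (abs_nonneg _)
        refine mul_le_mul_of_nonneg_right ?_ (abs_nonneg _)
        exact mul_le_mul_of_nonneg_left h3 (by linarith)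
    _ = (D.m * D.C1 * (sg x ^ (D.p + 1) * |b x|)) * (D.w x * |u x - v x|) := by
        simp only [w]
        nth_rewrite 1 [e]; ring
    _ ≤ _ := by
        refine mul_le_mul_of_nonneg_right ?_ (by unfold w; positivity)
        exact mul_le_mul_of_nonneg_left (hC x) (by have : 0 ≤ D.m := by linarith
                                                   positivity)

lemma contOn_of_lip {G : D.LX → ℝ} {C : ℝ} (h : ∀ f ∈ D.CS, ∀ g ∈ D.CS, |G f - G g| ≤ C * ‖f - g‖) (hC : 0 ≤ C) :
    ContinuousOn G D.CS := by
  refine LipschitzOnWith.continuousOn (K := C.toNNReal) (LipschitzOnWith.of_dist_le_mul fun f hf g hg => ?_)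
  rw [Real.dist_eq, dist_eq_norm, Real.coe_toNNReal C hC]
  exact h f hf g hg

/-- orbit in `L¹` -/
theorem orbit_lx {u0 : Euc N → ℝ} (hm : AEStronglyMeasurable u0 volume) (hu : ∀ᵐ x, D.W1 x ≤ u0 x ∧ u0 x ≤ D.W x) :
    ∃ S : ℝ → D.LX, (∀ᵐ x, S 0 x = u0 x) ∧ (∀ t, 0 ≤ t → S t ∈ D.CS) ∧
      (∀ L, ∀ ε > 0, ∃ δ > 0, ∀ s t, 0 ≤ s → 0 ≤ t → s ≤ L → t ≤ L → |s - t| ≤ δ → ‖S s - S t‖ ≤ ε) ∧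
      (∀ φ, TF φ → ∀ t0, 0 ≤ t0 → ∀ ε > 0, ∃ δ > 0, ∀ t s, 0 ≤ t → t ≤ s → |t - t0| ≤ δ → |s - t0| ≤ δ →
        |(∫ x, D.ρ x * S s x * φ x) - (∫ x, D.ρ x * S t x * φ x) -
          (s - t) * ((∫ x, S t0 x ^ D.m * lap φ x) - D.c * ∫ x, D.ρ x * S t0 x * φ x)| ≤ ε * (s - t)) := by
  have hr : D.Rg u0 := ⟨hm, by filter_upwards [hu] with x hx using ⟨(D.W1pos x).le.trans hx.1, hx.2⟩⟩
  obtain ⟨f, hf⟩ := exists_lx hr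
  have hfC : f ∈ D.CS := by
    show ∀ᵐ x, _
    filter_upwards [hu, hf] with x a b; rw [b]; exact a
  obtain ⟨S, S0, SC, SA⟩ := (rf (D := D)).exists_orbit CS_closed hfC
  have SA : Appx D.Jr f S := SA
  refine ⟨S, by rw [S0]; exact hf, SC, fun L ε hε => SA.unif L hε, fun φ hφ t0 ht0 ε hε => ?_⟩
  obtain ⟨C, hC0, hC⟩ := lip1 (D := D) hφ.cont hφ.2
  obtain ⟨C', hC0', hC'⟩ := lip2 (D := D) (lap_continuous hφ.c2) (lap_support hφ.2)
  have c1 : ContinuousOn (fun f : D.LX => ∫ x, D.ρ x * f x * φ x) D.CS :=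
    contOn_of_lip (C := C) (fun f hf g hg => by rw [lx_norm]; exact hC f g (CS.rg hf) (CS.rg hg)) hC0
  have c2 : ContinuousOn (fun f : D.LX => ∫ x, f x ^ D.m * lap φ x) D.CS :=
    contOn_of_lip (C := C') (fun f hf g hg => by rw [lx_norm]; exact hC' f g (CS.rg hf) (CS.rg hg)) hC0'
  refine (rf (D := D)).orbit_deriv hfC SA SC (ℓ := fun f : D.LX => ∫ x, D.ρ x * f x * φ x)
    (F := fun f : D.LX => (∫ x, f x ^ D.m * lap φ x) - D.c * ∫ x, D.ρ x * f x * φ x) c1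
    (c2.sub (continuousOn_const.mul c1)) (fun l hl hlo g hg => ?_) ht0 hε
  have P := Jr_res hl hlo hg
  have i1 := locInt_mul (Wloc_of (CS.rg hg).int) hφ.cont hφ.2
  have i2 := locInt_mul (Wloc_of P.rg.int) hφ.cont hφ.2
  rw [P.eq φ hφ, ← integral_sub i2 i1, ← integral_const_mul]
  have i3 : Integrable (fun x => D.ρ x * (D.c * D.Jr l g x - (g x - D.Jr l g x) / l) * φ x) :=
    locInt_mul P.Floc hφ.cont hφ.2
  have i4 : Integrable (fun x => D.c * (D.ρ x * D.Jr l g x * φ x)) := i2.const_mul _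
  rw [← integral_sub i3 i4, ← integral_const_mul]
  refine integral_congr_ae (ae_of_all _ fun x => ?_)
  field_simp; ring
end Dat
end Blow

end

end

section
open MeasureTheory Metric Filter Set ENNReal
open scoped Topology
noncomputable section
namespace Blow
variable {N : ℕ}
namespace Dat
variable {D : Dat N}

lemma joint {S : ℝ → D.LX} (hC : ∀ t, 0 ≤ t → S t ∈ D.CS)
    (hU : ∀ L, ∀ ε > 0, ∃ δ > 0, ∀ s t, 0 ≤ s → 0 ≤ t → s ≤ L → t ≤ L → |s - t| ≤ δ → ‖S s - S t‖ ≤ ε) :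
    ∃ v : Euc N → ℝ → ℝ, Measurable (fun p : Euc N × ℝ => v p.1 p.2) ∧ ∀ t, 0 ≤ t → ∀ᵐ x, v x t = S t x := by
  choose δ hδ hS using fun k : ℕ => hU k ((1 / 2 : ℝ) ^ k) (by positivity)
  set G : ℕ → Euc N × ℝ → ℝ := fun k p => S (⌊p.2 / δ k⌋₊ * δ k) p.1 with hG
  have Gm : ∀ k, Measurable (G k) := by
    intro k
    have h1 : Measurable (fun q : ℕ × Euc N => S (q.1 * δ k) q.2) :=
      measurable_from_prod_countable_right fun j => (Lp.stronglyMeasurable (S (j * δ k))).measurable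
    have h2 : Measurable (fun p : Euc N × ℝ => ((⌊p.2 / δ k⌋₊ : ℕ), p.1)) :=
      (Nat.measurable_floor.comp (measurable_snd.div_const _)).prodMk measurable_fst
    exact h1.comp h2
  refine ⟨fun x t => (limsup (fun k => ENNReal.ofReal (G k (x, t))) atTop).toReal,
    (Measurable.limsup fun k => (Gm k).ennreal_ofReal).ennreal_toReal, fun t ht => ?_⟩
  obtain ⟨K, hK⟩ := exists_nat_ge t
  have fl : ∀ k, 0 ≤ (⌊t / δ k⌋₊ : ℝ) * δ k ∧ (⌊t / δ k⌋₊ : ℝ) * δ k ≤ t ∧ |(⌊t / δ k⌋₊ : ℝ) * δ k - t| ≤ δ k := by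
    intro k
    have h0 := hδ k
    have h1 := Nat.floor_le (div_nonneg ht h0.le)
    have h2 := Nat.lt_floor_add_one (t / δ k)
    rw [le_div_iff₀ h0] at h1
    rw [div_lt_iff₀ h0] at h2
    refine ⟨by positivity, h1, ?_⟩
    rw [abs_le]; constructor <;> linarith
  have ed : ∀ k, ∫⁻ x, edist (S (⌊t / δ (k + K)⌋₊ * δ (k + K)) x) (S t x) ∂(wm D.w) ≤ ENNReal.ofReal ((1 / 2 : ℝ) ^ (k + K)) := by
    intro k
    rw [← L1.edist_def, edist_dist, dist_eq_norm]
    refine ENNReal.ofReal_le_ofReal ?_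
    obtain ⟨f1, f2, f3⟩ := fl (k + K)
    have : t ≤ ((k + K : ℕ):ℝ) := by push_cast; linarith [Nat.cast_nonneg (α := ℝ) k]
    exact hS (k + K) _ _ f1 ht (f2.trans this) this f3
  have ms : ∀ k, AEMeasurable (fun x => edist (S (⌊t / δ (k + K)⌋₊ * δ (k + K)) x) (S t x)) (wm D.w) := fun k =>
    ((Lp.aestronglyMeasurable _).edist (Lp.aestronglyMeasurable _))
  have fin : ∫⁻ x, ∑' k, edist (S (⌊t / δ (k + K)⌋₊ * δ (k + K)) x) (S t x) ∂(wm D.w) ≠ ⊤ := by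
    rw [lintegral_tsum ms]
    refine ne_top_of_le_ne_top ?_ (ENNReal.tsum_le_tsum ed)
    rw [← ENNReal.ofReal_tsum_of_nonneg (fun k => by positivity)]
    · exact ofReal_ne_top
    · exact (summable_nat_add_iff K).2 summable_geometric_two
  have ae1 := ae_lt_top' (AEMeasurable.tsum ms) fin
  have ae2 := (wm_ae D.wmeas D.wpos).1 ae1
  filter_upwards [ae2, hC t ht] with x hx hc
  have t1 := ENNReal.tendsto_atTop_zero_of_tsum_ne_top hx.ne
  have t2 : Tendsto (fun k => S (⌊t / δ (k + K)⌋₊ * δ (k + K)) x) atTop (𝓝 (S t x)) :=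
    tendsto_iff_edist_tendsto_0.2 t1
  have t3 : Tendsto (fun k => G k (x, t)) atTop (𝓝 (S t x)) := (tendsto_add_atTop_iff_nat K).1 t2
  rw [(ENNReal.tendsto_ofReal t3).limsup_eq, ENNReal.toReal_ofReal ((D.W1pos x).le.trans hc.1)]

/-- orbit with a jointly measurable representative -/
theorem orbit {u0 : Euc N → ℝ} (hm : AEStronglyMeasurable u0 volume) (hu : ∀ᵐ x, D.W1 x ≤ u0 x ∧ u0 x ≤ D.W x) :
    ∃ v : Euc N → ℝ → ℝ, Measurable (fun p : Euc N × ℝ => v p.1 p.2) ∧ (∀ᵐ x, v x 0 = u0 x) ∧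
      (∀ t, 0 ≤ t → ∀ᵐ x, D.W1 x ≤ v x t ∧ v x t ≤ D.W x) ∧
      (∀ L, ∀ ε > 0, ∃ δ > 0, ∀ s t, 0 ≤ s → 0 ≤ t → s ≤ L → t ≤ L → |s - t| ≤ δ → D.nm (fun x => v x s - v x t) ≤ ε) ∧
      (∀ φ, TF φ → ∀ t0, 0 ≤ t0 → ∀ ε > 0, ∃ δ > 0, ∀ t s, 0 ≤ t → t ≤ s → |t - t0| ≤ δ → |s - t0| ≤ δ →
        |(∫ x, D.ρ x * v x s * φ x) - (∫ x, D.ρ x * v x t * φ x) -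
          (s - t) * ((∫ x, v x t0 ^ D.m * lap φ x) - D.c * ∫ x, D.ρ x * v x t0 * φ x)| ≤ ε * (s - t)) := by
  obtain ⟨S, S0, SC, SU, SD⟩ := orbit_lx hm hu
  obtain ⟨v, vm, hv⟩ := joint SC SU
  have e1 : ∀ φ : Euc N → ℝ, ∀ t, 0 ≤ t → ∫ x, D.ρ x * v x t * φ x = ∫ x, D.ρ x * S t x * φ x := fun φ t ht =>
    integral_congr_ae (by filter_upwards [hv t ht] with x hx; rw [hx])
  have e2 : ∀ φ : Euc N → ℝ, ∀ t, 0 ≤ t → ∫ x, v x t ^ D.m * lap φ x = ∫ x, S t x ^ D.m * lap φ x := fun φ t ht =>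
    integral_congr_ae (by filter_upwards [hv t ht] with x hx; rw [hx])
  refine ⟨v, vm, ?_, ?_, ?_, ?_⟩
  · filter_upwards [hv 0 le_rfl, S0] with x a b; rw [a, b]
  · intro t ht
    filter_upwards [hv t ht, SC t ht] with x a b; rw [a]; exact b
  · intro L ε hε
    obtain ⟨δ, hδ, h⟩ := SU L ε hε
    refine ⟨δ, hδ, fun s t hs ht hsL htL hst => ?_⟩
    have := h s t hs ht hsL htL hst
    rw [lx_norm] at this
    refine le_trans (le_of_eq ?_) this
    refine integral_congr_ae ?_
    filter_upwards [hv t ht, hv s hs] with x a b; simp only [a, b]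
  · intro φ hφ t0 ht0 ε hε
    obtain ⟨δ, hδ, h⟩ := SD φ hφ t0 ht0 ε hε
    refine ⟨δ, hδ, fun t s ht hts h1 h2 => ?_⟩
    rw [e1 φ t ht, e1 φ s (ht.trans hts), e1 φ t0 ht0, e2 φ t0 ht0]
    exact h t s ht hts h1 h2
end Dat
end Blow

end

end

section
open MeasureTheory Metric Filter Set ENNReal
open scoped Topology ContDiff
noncomputable section
namespace Blow
variable {N : ℕ}

/-- space-time test functions -/
def TF2 (Φ : Euc N × ℝ → ℝ) : Prop := ContDiff ℝ (⊤ : ℕ∞) Φ ∧ HasCompactSupport Φ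

/-- directional derivative on space-time -/
def pd2 (e : Euc N × ℝ) (Φ : Euc N × ℝ → ℝ) (p : Euc N × ℝ) : ℝ := fderiv ℝ Φ p e

lemma TF2.d {Φ : Euc N × ℝ → ℝ} (h : TF2 Φ) (e : Euc N × ℝ) : TF2 (pd2 e Φ) :=
  ⟨(h.1.fderiv_right (m := (⊤ : ℕ∞)) (by simp)).clm_apply contDiff_const, h.2.fderiv_apply ℝ e⟩

lemma pd2_tsupport {Φ : Euc N × ℝ → ℝ} (e : Euc N × ℝ) : tsupport (pd2 e Φ) ⊆ tsupport Φ := by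
  refine closure_minimal (fun p hp => ?_) (isClosed_tsupport _)
  by_contra h
  refine hp ?_
  have : fderiv ℝ Φ p = 0 := by
    have := support_fderiv_subset ℝ (f := Φ)
    by_contra h2
    exact h (this h2)
  simp [pd2, this]

lemma slice_t {Φ : Euc N × ℝ → ℝ} (h : TF2 Φ) (x : Euc N) (t : ℝ) :
    HasDerivAt (fun s => Φ (x, s)) (pd2 (0, 1) Φ (x, t)) t := by
  have h1 : HasFDerivAt Φ (fderiv ℝ Φ (x, t)) (x, t) := (h.1.differentiable (by simp) _).hasFDerivAt
  have h2 : HasDerivAt (fun s : ℝ => ((x, s) : Euc N × ℝ)) ((0 : Euc N), (1:ℝ)) t :=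
    (hasDerivAt_const t x).prodMk (hasDerivAt_id t)
  exact h1.comp_hasDerivAt t h2

lemma slice_x {Φ : Euc N × ℝ → ℝ} (h : TF2 Φ) (x e : Euc N) (t : ℝ) :
    fderiv ℝ (fun y => Φ (y, t)) x e = pd2 (e, 0) Φ (x, t) := by
  have h1 : HasFDerivAt Φ (fderiv ℝ Φ (x, t)) (x, t) := (h.1.differentiable (by simp) _).hasFDerivAt
  have h2 := (hasFDerivAt_id x (𝕜 := ℝ)).prodMk (hasFDerivAt_const t x)
  have h3 := h1.comp x h2
  have h4 : fderiv ℝ (fun y => Φ (y, t)) x = _ := h3.fderiv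
  rw [h4]; simp [pd2]

/-- space Laplacian of a space-time function -/
def lap2 (Φ : Euc N × ℝ → ℝ) (p : Euc N × ℝ) : ℝ :=
  ∑ i : Fin N, pd2 (EuclideanSpace.single i 1, 0) (pd2 (EuclideanSpace.single i 1, 0) Φ) p

lemma lap_slice {Φ : Euc N × ℝ → ℝ} (h : TF2 Φ) (x : Euc N) (t : ℝ) :
    lap (fun y => Φ (y, t)) x = lap2 Φ (x, t) := by
  unfold lap lap2
  refine Finset.sum_congr rfl fun i _ => ?_
  have : (fun y => fderiv ℝ (fun z => Φ (z, t)) y (EuclideanSpace.single i (1:ℝ))) =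
      fun y => pd2 (EuclideanSpace.single i 1, 0) Φ (y, t) := by
    funext y; exact slice_x h y _ t
  rw [this]
  exact slice_x (h.d _) x _ t

lemma lap2_cont {Φ : Euc N × ℝ → ℝ} (h : TF2 Φ) : Continuous (lap2 Φ) :=
  continuous_finsetSum _ fun i _ => ((h.d _).d _).1.continuous

lemma zero_off {Φ : Euc N × ℝ → ℝ} {p : Euc N × ℝ} (hp : p ∉ tsupport Φ) : Φ p = 0 ∧ lap2 Φ p = 0 ∧ pd2 (0, 1) Φ p = 0 := by
  refine ⟨image_eq_zero_of_notMem_tsupport hp, ?_, image_eq_zero_of_notMem_tsupport fun h => hp (pd2_tsupport _ h)⟩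
  exact Finset.sum_eq_zero fun i _ =>
    image_eq_zero_of_notMem_tsupport fun h => hp (pd2_tsupport _ (pd2_tsupport _ h))

lemma lap2_supp {Φ : Euc N × ℝ → ℝ} (h : TF2 Φ) : HasCompactSupport (lap2 Φ) :=
  HasCompactSupport.intro h.2 fun p hp => (zero_off hp).2.1

lemma slice_TF {Φ : Euc N × ℝ → ℝ} (h : TF2 Φ) (t : ℝ) : TF (fun y => Φ (y, t)) := by
  refine ⟨h.1.comp (contDiff_id.prodMk contDiff_const), ?_⟩
  refine HasCompactSupport.intro (h.2.isCompact.image continuous_fst) fun x hx => ?_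
  exact (zero_off fun hp => hx ⟨_, hp, rfl⟩).1

lemma TF2.bdd {Φ : Euc N × ℝ → ℝ} (h : TF2 Φ) : ∃ C, 0 ≤ C ∧ ∀ p, |pd2 (0, 1) Φ p| ≤ C ∧ |lap2 Φ p| ≤ C := by
  obtain ⟨C1, h1⟩ := (h.d (0, 1)).2.exists_bound_of_continuous (h.d (0, 1)).1.continuous
  obtain ⟨C2, h2⟩ := (lap2_supp h).exists_bound_of_continuous (lap2_cont h)
  refine ⟨max C1 C2, ((norm_nonneg _).trans (h1 0)).trans (le_max_left _ _), fun p => ⟨(h1 p).trans (le_max_left _ _), (h2 p).trans (le_max_right _ _)⟩⟩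

lemma TF2.box {Φ : Euc N × ℝ → ℝ} (h : TF2 Φ) {T : ℝ} (hT : 0 < T) (hs : ∀ p ∈ tsupport Φ, p.2 ∈ Ioo 0 T) :
    ∃ R a b, 0 < R ∧ 0 < a ∧ a ≤ b ∧ b < T ∧ ∀ p ∈ tsupport Φ, p.1 ∈ ball (0 : Euc N) R ∧ p.2 ∈ Icc a b := by
  rcases (tsupport Φ).eq_empty_or_nonempty with he | he
  · exact ⟨1, T / 2, T / 2, one_pos, by positivity, le_rfl, by linarith, fun p hp => by rw [he] at hp; exact hp.elim⟩
  have hK := h.2.isCompact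
  obtain ⟨pa, pa1, pa2⟩ := hK.exists_isMinOn he continuous_snd.continuousOn
  obtain ⟨pb, pb1, pb2⟩ := hK.exists_isMaxOn he continuous_snd.continuousOn
  obtain ⟨R, hR, hR2⟩ := (hK.image continuous_fst).isBounded.subset_ball_lt 0 0
  exact ⟨R, pa.2, pb.2, hR, (hs _ pa1).1, pa2 pb1, (hs _ pb1).2, fun p hp =>
    ⟨hR2 ⟨p, hp, rfl⟩, pa2 hp, pb2 hp⟩⟩

lemma prod_int {h : Euc N × ℝ → ℝ} (hm : AEStronglyMeasurable h (volume : Measure (Euc N × ℝ))) {A : Euc N → ℝ} {R a b : ℝ}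
    (hA : LocallyIntegrable A) (hb : ∀ᵐ p : Euc N × ℝ, |h p| ≤ A p.1)
    (h0 : ∀ p : Euc N × ℝ, ¬ (p.1 ∈ ball (0 : Euc N) R ∧ p.2 ∈ Icc a b) → h p = 0) : Integrable h := by
  have i1 : Integrable ((ball (0 : Euc N) R).indicator A) :=
    (integrable_indicator_iff measurableSet_ball).2
      ((hA.integrableOn_isCompact (isCompact_closedBall 0 R)).mono_set ball_subset_closedBall)
  have i2 : Integrable ((Icc a b).indicator (fun _ : ℝ => (1:ℝ))) :=
    (integrable_indicator_iff measurableSet_Icc).2 (integrableOn_const (by simp))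
  have i3 : Integrable (fun p : Euc N × ℝ => (ball (0 : Euc N) R).indicator A p.1 * (Icc a b).indicator (fun _ : ℝ => (1:ℝ)) p.2) :=
    i1.mul_prod i2
  refine i3.mono hm ?_
  filter_upwards [hb] with p hp
  by_cases hc : p.1 ∈ ball (0 : Euc N) R ∧ p.2 ∈ Icc a b
  · rw [indicator_of_mem hc.1, indicator_of_mem hc.2, mul_one]
    exact hp.trans (le_abs_self _)
  · rw [h0 p hc, norm_zero]; exact norm_nonneg _
end Blow

end

end

section
open MeasureTheory Metric Filter Set ENNReal
open scoped Topology ContDiff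
noncomputable section
namespace Blow
variable {N : ℕ}
namespace Dat
variable {D : Dat N}

/-- hypotheses on a candidate solution -/
structure Cand (D : Dat N) (T : ℝ) (θ : ℝ → ℝ) (u : Euc N → ℝ → ℝ) : Prop where
  hT : 0 < T
  um : Measurable (fun p : Euc N × ℝ => u p.1 p.2)
  θ0 : ∀ t ∈ Ico 0 T, 0 < θ t
  θm : ∀ s ∈ Ico 0 T, ∀ t ∈ Ico 0 T, s ≤ t → θ s ≤ θ t
  ub : ∀ t ∈ Ico 0 T, ∀ᵐ x, 0 ≤ u x t ∧ u x t ≤ θ t * D.W x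
  uc : ∀ s ∈ Ico 0 T, ∀ R, 0 < R → Tendsto (fun t => ∫ x in ball (0 : Euc N) R, |u x t - u x s| * D.ρ x) (𝓝[Ico 0 T] s) (𝓝 0)
  ud : ∀ t ∈ Ioo 0 T, ∀ φ, TF φ → HasDerivAt (fun s => ∫ x, D.ρ x * u x s * φ x) (∫ x, u x t ^ D.m * lap φ x) t

variable {T : ℝ} {θ : ℝ → ℝ} {u : Euc N → ℝ → ℝ}

lemma Cand.ux (H : D.Cand T θ u) (t : ℝ) : Measurable (fun x => u x t) :=
  H.um.comp (measurable_id.prodMk measurable_const)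

lemma ρWloc : LocallyIntegrable (fun x => D.ρ x * D.W x) := Wloc_of (RgW (D := D)).int

lemma Cand.uloc (H : D.Cand T θ u) {t : ℝ} (ht : t ∈ Ico 0 T) : LocallyIntegrable (fun x => D.ρ x * u x t) := by
  refine ((ρWloc (D := D)).smul (θ t)).mono (D.ρm.mul (H.ux t)).aestronglyMeasurable ?_
  filter_upwards [H.ub t ht, D.ρpos] with x h1 h2
  have := D.Wpos x
  have := H.θ0 t ht
  rw [Pi.smul_apply, smul_eq_mul, Real.norm_of_nonneg (mul_nonneg h2.le h1.1), Real.norm_of_nonneg (by positivity)]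
  calc _ ≤ D.ρ x * (θ t * D.W x) := mul_le_mul_of_nonneg_left h1.2 h2.le
    _ = _ := by ring

/-- bounds almost everywhere in space-time -/
lemma ae_prod {P : Euc N × ℝ → Prop} (hP : MeasurableSet {p | P p}) (h : ∀ t, ∀ᵐ x, P (x, t)) :
    ∀ᵐ p : Euc N × ℝ, P p := by
  rw [Measure.volume_eq_prod]
  rw [Measure.ae_prod_iff_ae_ae hP, Measure.ae_ae_comm hP]
  exact ae_of_all _ h

lemma Cand.ubp (H : D.Cand T θ u) {b : ℝ} (hb : b < T) :
    ∀ᵐ p : Euc N × ℝ, p.2 ∈ Icc 0 b → 0 ≤ u p.1 p.2 ∧ u p.1 p.2 ≤ θ b * D.W p.1 := by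
  refine ae_prod (P := fun p => p.2 ∈ Icc 0 b → 0 ≤ u p.1 p.2 ∧ u p.1 p.2 ≤ θ b * D.W p.1) ?_ fun t => ?_
  · have m1 : MeasurableSet {p : Euc N × ℝ | p.2 ∈ Icc 0 b} := measurable_snd measurableSet_Icc
    have m2 : MeasurableSet {p : Euc N × ℝ | 0 ≤ u p.1 p.2} := measurableSet_le measurable_const H.um
    have m3 : MeasurableSet {p : Euc N × ℝ | u p.1 p.2 ≤ θ b * D.W p.1} :=
      measurableSet_le H.um ((D.Wm.comp measurable_fst).const_mul _)
    have := m1.compl.union (m2.inter m3)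
    convert this using 1
    ext p
    simp only [mem_ofPred_eq, mem_union, mem_compl_iff, mem_inter_iff]
    tauto
  · by_cases ht : t ∈ Icc 0 b
    · have ht' : t ∈ Ico 0 T := ⟨ht.1, ht.2.trans_lt hb⟩
      filter_upwards [H.ub t ht'] with x hx _
      refine ⟨hx.1, hx.2.trans ?_⟩
      exact mul_le_mul_of_nonneg_right (H.θm t ht' b ⟨ht.1.trans ht.2, hb⟩ ht.2) (D.Wpos x).le
    · exact ae_of_all _ fun x h => absurd h ht

lemma spow_eq {m s : ℝ} (hm : 1 < m) (hs : 0 ≤ s) : spow m s = s ^ m := by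
  unfold spow
  rw [abs_of_nonneg hs]
  rcases eq_or_lt_of_le hs with h | h
  · rw [← h, Real.zero_rpow (by linarith : m ≠ 0), mul_zero]
  · rw [← Real.rpow_add_one h.ne']; congr 1; ring

lemma spow_meas {m : ℝ} : Measurable (spow m) := by
  unfold spow
  exact (measurable_abs.pow_const _).mul measurable_id

lemma Cand.powbd (H : D.Cand T θ u) {b : ℝ} (hb : b < T) (hb0 : 0 ≤ b) :
    ∀ᵐ p : Euc N × ℝ, p.2 ∈ Icc 0 b → |spow D.m (u p.1 p.2)| ≤ θ b ^ D.m * D.W p.1 ^ D.m := by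
  filter_upwards [H.ubp hb] with p hp hp2
  obtain ⟨h1, h2⟩ := hp hp2
  rw [spow_eq D.hm h1, abs_of_nonneg (Real.rpow_nonneg h1 _), ← Real.mul_rpow (H.θ0 b ⟨hb0, hb⟩).le (D.Wpos _).le]
  exact Real.rpow_le_rpow h1 h2 m0.le

lemma Cand.int4 (H : D.Cand T θ u) {R a b : ℝ} (ha : 0 < a) (hab : a ≤ b) (hb : b < T) :
    IntegrableOn (fun p : Euc N × ℝ => spow D.m (u p.1 p.2)) (ball (0 : Euc N) R ×ˢ Icc a b) := by
  rw [← integrable_indicator_iff (measurableSet_ball.prod measurableSet_Icc)]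
  have ms : Measurable (fun p : Euc N × ℝ => spow D.m (u p.1 p.2)) := spow_meas.comp H.um
  refine prod_int (R := R) (a := a) (b := b) (A := fun x => θ b ^ D.m * D.W x ^ D.m)
    (ms.indicator (measurableSet_ball.prod measurableSet_Icc)).aestronglyMeasurable
    ((RgW (D := D)).powloc.smul (θ b ^ D.m)) ?_ ?_
  · filter_upwards [H.powbd hb (ha.le.trans hab)] with p hp
    by_cases hc : p ∈ ball (0 : Euc N) R ×ˢ Icc a b
    · rw [indicator_of_mem hc]
      exact hp ⟨ha.le.trans hc.2.1, hc.2.2⟩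
    · rw [indicator_of_notMem hc, abs_zero]
      exact mul_nonneg (Real.rpow_nonneg (H.θ0 b ⟨ha.le.trans hab, hb⟩).le _) (Real.rpow_nonneg (D.Wpos _).le _)
  · intro p hp
    exact indicator_of_notMem (s := ball (0 : Euc N) R ×ˢ Icc a b) (fun h => hp ⟨h.1, h.2⟩)
      (fun p : Euc N × ℝ => spow D.m (u p.1 p.2))

section weak
variable {Φ : Euc N × ℝ → ℝ}

lemma Cand.i1 (H : D.Cand T θ u) (hΦ : TF2 Φ) {R a b : ℝ} (ha : 0 < a) (hab : a ≤ b) (hb : b < T)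
    (hs : ∀ p ∈ tsupport Φ, p.1 ∈ ball (0 : Euc N) R ∧ p.2 ∈ Icc a b) :
    Integrable (fun p : Euc N × ℝ => u p.1 p.2 * pd2 (0, 1) Φ p * D.ρ p.1) := by
  obtain ⟨C, hC0, hC⟩ := hΦ.bdd
  refine prod_int (R := R) (a := a) (b := b) (A := fun x => (θ b * C) * (D.ρ x * D.W x))
    ((H.um.mul (hΦ.d _).1.continuous.measurable).mul (D.ρm.comp measurable_fst)).aestronglyMeasurable
    ((ρWloc (D := D)).smul (θ b * C)) ?_ ?_
  · have hθ := H.θ0 b ⟨ha.le.trans hab, hb⟩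
    have hρ : ∀ᵐ p : Euc N × ℝ, 0 < D.ρ p.1 := ae_prod (measurableSet_lt measurable_const (D.ρm.comp measurable_fst)) fun t => D.ρpos
    filter_upwards [H.ubp hb, hρ] with p hp hr
    have hW := D.Wpos p.1
    by_cases hc : p ∈ tsupport Φ
    · obtain ⟨h1, h2⟩ := hp ⟨ha.le.trans (hs p hc).2.1, (hs p hc).2.2⟩
      rw [abs_mul, abs_mul, abs_of_nonneg h1, abs_of_pos hr]
      calc _ ≤ θ b * D.W p.1 * C * D.ρ p.1 := by have := (hC p).1; gcongr
        _ = _ := by ring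
    · rw [(zero_off hc).2.2]; simp only [mul_zero, zero_mul, abs_zero]; positivity
  · intro p hp
    rw [(zero_off fun h => hp (hs p h)).2.2]; simp

lemma Cand.i2 (H : D.Cand T θ u) (hΦ : TF2 Φ) {R a b : ℝ} (ha : 0 < a) (hab : a ≤ b) (hb : b < T)
    (hs : ∀ p ∈ tsupport Φ, p.1 ∈ ball (0 : Euc N) R ∧ p.2 ∈ Icc a b) :
    Integrable (fun p : Euc N × ℝ => spow D.m (u p.1 p.2) * lap2 Φ p) := by
  obtain ⟨C, hC0, hC⟩ := hΦ.bdd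
  refine prod_int (R := R) (a := a) (b := b) (A := fun x => (θ b ^ D.m * C) * D.W x ^ D.m)
    ((spow_meas.comp H.um).mul (lap2_cont hΦ).measurable).aestronglyMeasurable
    ((RgW (D := D)).powloc.smul (θ b ^ D.m * C)) ?_ ?_
  · have hθ := H.θ0 b ⟨ha.le.trans hab, hb⟩
    filter_upwards [H.powbd hb (ha.le.trans hab)] with p hp
    have hW := D.Wpos p.1
    by_cases hc : p ∈ tsupport Φ
    · have h1 := hp ⟨ha.le.trans (hs p hc).2.1, (hs p hc).2.2⟩
      rw [abs_mul]
      calc _ ≤ (θ b ^ D.m * D.W p.1 ^ D.m) * C := by have := (hC p).2; gcongr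
        _ = _ := by ring
    · rw [(zero_off hc).2.1]; simp only [mul_zero, abs_zero]; positivity
  · intro p hp
    rw [(zero_off fun h => hp (hs p h)).2.1]; simp

lemma Cand.dA (H : D.Cand T θ u) (hΦ : TF2 Φ) {t : ℝ} (ht : t ∈ Ioo 0 T) :
    HasDerivAt (fun s => ∫ x, D.ρ x * u x s * Φ (x, t)) (∫ x, spow D.m (u x t) * lap2 Φ (x, t)) t := by
  have ht' : t ∈ Ico 0 T := ⟨ht.1.le, ht.2⟩
  have dA := H.ud t ht _ (slice_TF hΦ t)
  have eA : ∫ x, u x t ^ D.m * lap (fun y => Φ (y, t)) x = ∫ x, spow D.m (u x t) * lap2 Φ (x, t) := by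
    refine integral_congr_ae ?_
    filter_upwards [H.ub t ht'] with x hx
    rw [spow_eq D.hm hx.1, lap_slice hΦ]
  rw [eA] at dA
  exact dA

lemma Cand.dB (H : D.Cand T θ u) (hΦ : TF2 Φ) {R a b : ℝ}
    (hs : ∀ p ∈ tsupport Φ, p.1 ∈ ball (0 : Euc N) R ∧ p.2 ∈ Icc a b) {t : ℝ} (ht' : t ∈ Ico 0 T) :
    HasDerivAt (fun s => ∫ x, D.ρ x * u x t * Φ (x, s)) (∫ x, u x t * pd2 (0, 1) Φ (x, t) * D.ρ x) t := by
  obtain ⟨C, hC0, hC⟩ := hΦ.bdd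
  have tf := slice_TF hΦ
  have z1 : ∀ x s, x ∉ ball (0 : Euc N) R → pd2 (0, 1) Φ (x, s) = 0 := fun x s hx => (zero_off (p := (x, s)) fun h => hx (hs (x, s) h).1).2.2
  have ib : Integrable ((ball (0 : Euc N) R).indicator (fun x => |D.ρ x * u x t| * C)) :=
    (integrable_indicator_iff measurableSet_ball).2
      ((((H.uloc ht').integrableOn_isCompact (isCompact_closedBall 0 R)).mono_set ball_subset_closedBall).abs.mul_const C)
  have mu : Measurable (fun x => D.ρ x * u x t) := D.ρm.mul (H.ux t)
  have dB : HasDerivAt (fun s => ∫ x, D.ρ x * u x t * Φ (x, s)) (∫ x, D.ρ x * u x t * pd2 (0, 1) Φ (x, t)) t := by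
    refine (hasDerivAt_integral_of_dominated_loc_of_deriv_le (F := fun s x => D.ρ x * u x t * Φ (x, s))
      (F' := fun s x => D.ρ x * u x t * pd2 (0, 1) Φ (x, s)) (s := univ) univ_mem
      (bound := (ball (0 : Euc N) R).indicator (fun x => |D.ρ x * u x t| * C)) ?_ ?_ ?_ ?_ ib ?_).2
    · exact Eventually.of_forall fun s => (mu.mul (tf s).cont.measurable).aestronglyMeasurable
    · exact locInt_mul (H.uloc ht') (tf t).cont (tf t).2
    · have m2 : Measurable (fun x : Euc N => pd2 (0, 1) Φ (x, t)) :=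
        (hΦ.d (0, 1)).1.continuous.measurable.comp (measurable_id.prodMk measurable_const)
      exact (mu.mul m2).aestronglyMeasurable
    · refine ae_of_all _ fun x s _ => ?_
      by_cases hx : x ∈ ball (0 : Euc N) R
      · rw [indicator_of_mem hx, norm_mul, Real.norm_eq_abs]
        exact mul_le_mul_of_nonneg_left (hC _).1 (abs_nonneg _)
      · rw [indicator_of_notMem hx, z1 x s hx]; simp
    · exact ae_of_all _ fun x s _ => (slice_t hΦ x s).const_mul _
  have eB : ∫ x, D.ρ x * u x t * pd2 (0, 1) Φ (x, t) = ∫ x, u x t * pd2 (0, 1) Φ (x, t) * D.ρ x :=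
    integral_congr_ae (ae_of_all _ fun x => by simp only; ring)
  rw [eB] at dB
  exact dB

lemma Cand.dE (H : D.Cand T θ u) (hΦ : TF2 Φ) {R a b : ℝ} (hR : 0 < R)
    (hs : ∀ p ∈ tsupport Φ, p.1 ∈ ball (0 : Euc N) R ∧ p.2 ∈ Icc a b) {t : ℝ} (ht : t ∈ Ioo 0 T) :
    HasDerivAt (fun s => ∫ x, D.ρ x * (u x s - u x t) * (Φ (x, s) - Φ (x, t))) 0 t := by
  obtain ⟨C, hC0, hC⟩ := hΦ.bdd
  have ht' : t ∈ Ico 0 T := ⟨ht.1.le, ht.2⟩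
  have hnb : Ico 0 T ∈ 𝓝 t := Ico_mem_nhds ht.1 ht.2
  have lip : ∀ x s s', |Φ (x, s) - Φ (x, s')| ≤ C * |s - s'| := by
    intro x s s'
    have := Convex.norm_image_sub_le_of_norm_hasDerivWithin_le (f := fun s => Φ (x, s)) (f' := fun s => pd2 (0, 1) Φ (x, s))
      (s := univ) (C := C) (x := s') (y := s) (fun y _ => (slice_t hΦ x y).hasDerivWithinAt)
      (fun y _ => (hC (x, y)).1) convex_univ trivial trivial
    simpa [Real.norm_eq_abs] using this
  have z0 : ∀ x s, x ∉ ball (0 : Euc N) R → Φ (x, s) = 0 := fun x s hx => (zero_off (p := (x, s)) fun h => hx (hs (x, s) h).1).1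
  rw [hasDerivAt_iff_isLittleO]
  have E0 : ∫ x, D.ρ x * (u x t - u x t) * (Φ (x, t) - Φ (x, t)) = 0 := by simp
  simp only [E0, sub_zero, smul_zero]
  rw [Asymptotics.isLittleO_iff]
  intro ε hε
  have tc : Tendsto (fun s => C * ∫ x in ball (0 : Euc N) R, |u x s - u x t| * D.ρ x) (𝓝 t) (𝓝 0) := by
    have := (H.uc t ht' R hR).const_mul C
    rw [mul_zero, nhdsWithin_eq_nhds.2 hnb] at this
    exact this
  filter_upwards [tc.eventually (gt_mem_nhds hε), hnb] with s hs1 hs2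
  have j : IntegrableOn (fun x => |u x s - u x t| * D.ρ x) (ball (0 : Euc N) R) := by
    have := (((H.uloc hs2).sub (H.uloc ht')).integrableOn_isCompact (isCompact_closedBall 0 R)).mono_set ball_subset_closedBall
    refine this.abs.congr ?_
    filter_upwards [ae_restrict_of_ae D.ρpos] with x hx
    simp only [Pi.sub_apply]
    rw [← mul_sub, abs_mul, abs_of_pos hx, mul_comm]
  have hle : ‖∫ x, D.ρ x * (u x s - u x t) * (Φ (x, s) - Φ (x, t))‖ ≤ ∫ x, (ball (0 : Euc N) R).indicator (fun x => (C * |s - t|) * (|u x s - u x t| * D.ρ x)) x := by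
    refine norm_integral_le_of_norm_le ((integrable_indicator_iff measurableSet_ball).2 (j.const_mul _)) ?_
    filter_upwards [D.ρpos] with x hx
    by_cases hb : x ∈ ball (0 : Euc N) R
    · rw [indicator_of_mem hb, norm_mul, norm_mul, Real.norm_of_nonneg hx.le, Real.norm_eq_abs, Real.norm_eq_abs]
      calc _ ≤ D.ρ x * |u x s - u x t| * (C * |s - t|) := by have := lip x s t; gcongr
        _ = _ := by ring
    · rw [indicator_of_notMem hb, z0 x s hb, z0 x t hb]; simp
  rw [integral_indicator measurableSet_ball, integral_const_mul] at hle
  refine hle.trans ?_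
  rw [Real.norm_eq_abs]
  calc _ = (C * ∫ x in ball (0 : Euc N) R, |u x s - u x t| * D.ρ x) * |s - t| := by ring
    _ ≤ _ := mul_le_mul_of_nonneg_right hs1.le (abs_nonneg _)

lemma Cand.dI (H : D.Cand T θ u) (hΦ : TF2 Φ) {t s : ℝ} (ht' : t ∈ Ico 0 T) (hs2 : s ∈ Ico 0 T) :
    ∫ x, D.ρ x * u x s * Φ (x, s) = (∫ x, D.ρ x * u x t * Φ (x, s)) + (∫ x, D.ρ x * u x s * Φ (x, t)) +
      (∫ x, D.ρ x * (u x s - u x t) * (Φ (x, s) - Φ (x, t))) - ∫ x, D.ρ x * u x t * Φ (x, t) := by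
  have tf := slice_TF hΦ
  have j1 : Integrable (fun x => D.ρ x * u x s * Φ (x, s)) := locInt_mul (H.uloc hs2) (tf s).cont (tf s).2
  have j2 : Integrable (fun x => D.ρ x * u x t * Φ (x, s)) := locInt_mul (H.uloc ht') (tf s).cont (tf s).2
  have j3 : Integrable (fun x => D.ρ x * u x s * Φ (x, t)) := locInt_mul (H.uloc hs2) (tf t).cont (tf t).2
  have j4 : Integrable (fun x => D.ρ x * u x t * Φ (x, t)) := locInt_mul (H.uloc ht') (tf t).cont (tf t).2
  have j5 : Integrable (fun x => D.ρ x * u x s * Φ (x, s) - D.ρ x * u x t * Φ (x, s)) := j1.sub j2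
  have j6 : Integrable (fun x => D.ρ x * u x s * Φ (x, t) - D.ρ x * u x t * Φ (x, t)) := j3.sub j4
  have eE : ∫ x, D.ρ x * (u x s - u x t) * (Φ (x, s) - Φ (x, t)) = ((∫ x, D.ρ x * u x s * Φ (x, s)) - ∫ x, D.ρ x * u x t * Φ (x, s)) -
      ((∫ x, D.ρ x * u x s * Φ (x, t)) - ∫ x, D.ρ x * u x t * Φ (x, t)) := by
    rw [← integral_sub j1 j2, ← integral_sub j3 j4, ← integral_sub j5 j6]
    exact integral_congr_ae (ae_of_all _ fun x => by simp only; ring)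
  rw [eE]; ring

lemma Cand.deriv_in (H : D.Cand T θ u) (hΦ : TF2 Φ) {R a b : ℝ} (hR : 0 < R)
    (hs : ∀ p ∈ tsupport Φ, p.1 ∈ ball (0 : Euc N) R ∧ p.2 ∈ Icc a b) {t : ℝ} (ht : t ∈ Ioo 0 T) :
    HasDerivAt (fun s => ∫ x, D.ρ x * u x s * Φ (x, s))
      ((∫ x, u x t * pd2 (0, 1) Φ (x, t) * D.ρ x) + ∫ x, spow D.m (u x t) * lap2 Φ (x, t)) t := by
  have ht' : t ∈ Ico 0 T := ⟨ht.1.le, ht.2⟩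
  have hnb : Ico 0 T ∈ 𝓝 t := Ico_mem_nhds ht.1 ht.2
  have tot := (((H.dB hΦ hs ht').add (H.dA hΦ ht)).add (H.dE hΦ hR hs ht)).sub_const (∫ x, D.ρ x * u x t * Φ (x, t))
  rw [add_zero] at tot
  refine tot.congr_of_eventuallyEq ?_
  filter_upwards [hnb] with s hs2
  simp only [Pi.add_apply]
  exact H.dI hΦ ht' hs2

theorem Cand.weak (H : D.Cand T θ u) (hΦ : TF2 Φ) (hs : ∀ p ∈ tsupport Φ, p.2 ∈ Ioo 0 T) :
    -(∫ p : Euc N × ℝ in (univ : Set (Euc N)) ×ˢ Ioo 0 T, u p.1 p.2 * deriv (fun s => Φ (p.1, s)) p.2 * D.ρ p.1) =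
      ∫ p : Euc N × ℝ in (univ : Set (Euc N)) ×ˢ Ioo 0 T, spow D.m (u p.1 p.2) * lap (fun y => Φ (y, p.2)) p.1 := by
  obtain ⟨R, a, b, hR, ha, hab, hb, hbox⟩ := hΦ.box H.hT hs
  have e1 : ∀ p : Euc N × ℝ, u p.1 p.2 * deriv (fun s => Φ (p.1, s)) p.2 * D.ρ p.1 = u p.1 p.2 * pd2 (0, 1) Φ p * D.ρ p.1 :=
    fun p => by rw [(slice_t hΦ p.1 p.2).deriv]
  have e2 : ∀ p : Euc N × ℝ, spow D.m (u p.1 p.2) * lap (fun y => Φ (y, p.2)) p.1 = spow D.m (u p.1 p.2) * lap2 Φ p :=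
    fun p => by rw [lap_slice hΦ]
  simp only [e1, e2]
  have off : ∀ p : Euc N × ℝ, p ∉ (univ : Set (Euc N)) ×ˢ Ioo 0 T → p ∉ tsupport Φ := fun p hp h => hp ⟨trivial, hs p h⟩
  rw [setIntegral_eq_integral_of_forall_compl_eq_zero (fun p hp => by rw [(zero_off (off p hp)).2.2]; simp),
    setIntegral_eq_integral_of_forall_compl_eq_zero (fun p hp => by rw [(zero_off (off p hp)).2.1]; simp)]
  have I1 := H.i1 hΦ ha hab hb hbox
  have I2 := H.i2 hΦ ha hab hb hbox
  rw [Measure.volume_eq_prod] at I1 I2 ⊢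
  rw [integral_prod_symm _ I1, integral_prod_symm _ I2, neg_eq_iff_add_eq_zero]
  have k1 := I1.integral_prod_right
  have k2 := I2.integral_prod_right
  rw [← integral_add k1 k2]
  set f : ℝ → ℝ := fun s => ∫ x, D.ρ x * u x s * Φ (x, s) with hf
  have fz : ∀ t, t ∉ Icc a b → f t = 0 := by
    intro t ht
    have : ∀ x, Φ (x, t) = 0 := fun x => (zero_off fun h => ht (hbox _ h).2).1
    simp [hf, this]
  have hd : ∀ t, HasDerivAt f ((∫ x, u x t * pd2 (0, 1) Φ (x, t) * D.ρ x) + ∫ x, spow D.m (u x t) * lap2 Φ (x, t)) t := by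
    intro t
    by_cases ht : t ∈ Icc a b
    · exact H.deriv_in hΦ hR hbox ⟨ha.trans_le ht.1, ht.2.trans_lt hb⟩
    · have z1 : ∀ x, pd2 (0, 1) Φ (x, t) = 0 := fun x => (zero_off fun h => ht (hbox _ h).2).2.2
      have z2 : ∀ x, lap2 Φ (x, t) = 0 := fun x => (zero_off fun h => ht (hbox _ h).2).2.1
      simp only [z1, z2, mul_zero, zero_mul, integral_zero, add_zero]
      refine (hasDerivAt_const t (0:ℝ)).congr_of_eventuallyEq ?_
      filter_upwards [isClosed_Icc.isOpen_compl.mem_nhds ht] with s hs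
      exact fz s hs
  have lb : Tendsto f atBot (𝓝 0) := by
    refine tendsto_const_nhds.congr' ?_
    filter_upwards [eventually_lt_atBot a] with s hs
    exact (fz s fun h => absurd h.1 (not_le.2 hs)).symm
  have lt : Tendsto f atTop (𝓝 0) := by
    refine tendsto_const_nhds.congr' ?_
    filter_upwards [eventually_gt_atTop b] with s hs
    exact (fz s fun h => absurd h.2 (not_le.2 hs)).symm
  have := integral_of_hasDerivAt_of_tendsto hd (k1.add k2) lb lt
  rw [this, sub_zero]
end weak
end Dat
end Blow

end

end

section
open MeasureTheory Metric Filter Set ENNReal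
open scoped Topology ContDiff
noncomputable section
namespace Blow
variable {N : ℕ}

/-- growth factor -/
def th (m T t : ℝ) : ℝ := (1 - t / T) ^ (-(1 / (m - 1)))
/-- new time -/
def ta (T t : ℝ) : ℝ := -T * Real.log (1 - t / T)

section scal
variable {m T : ℝ}

lemma sc_pos (hT : 0 < T) {t : ℝ} (ht : t < T) : 0 < 1 - t / T := by
  have : t / T < 1 := (div_lt_one hT).2 ht
  linarith

lemma th_pos (hT : 0 < T) {t : ℝ} (ht : t < T) : 0 < th m T t := Real.rpow_pos_of_pos (sc_pos hT ht) _

lemma th_zero : th m T 0 = 1 := by simp [th]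
lemma ta_zero : ta T 0 = 0 := by simp [ta]

lemma ta_nonneg (hT : 0 < T) {t : ℝ} (h0 : 0 ≤ t) (ht : t < T) : 0 ≤ ta T t := by
  have h1 := sc_pos hT ht
  have h2 : 1 - t / T ≤ 1 := by have := div_nonneg h0 hT.le; linarith
  have := Real.log_nonpos h1.le h2
  unfold ta; nlinarith

lemma ta_pos (hT : 0 < T) {t : ℝ} (h0 : 0 < t) (ht : t < T) : 0 < ta T t := by
  have h1 := sc_pos hT ht
  have h2 : 1 - t / T < 1 := by have := div_pos h0 hT; linarith
  have := Real.log_neg h1 h2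
  unfold ta; nlinarith

lemma th_mono (hm : 1 < m) (hT : 0 < T) {s t : ℝ} (ht : t < T) (hst : s ≤ t) : th m T s ≤ th m T t := by
  unfold th
  have h1 := sc_pos hT ht
  have h2 : 0 < 1 / (m - 1) := by have : 0 < m - 1 := by linarith
                                  positivity
  refine Real.rpow_le_rpow_of_nonpos h1 ?_ (by linarith)
  have : s / T ≤ t / T := by gcongr
  linarith

lemma ta_deriv (hT : 0 < T) {t : ℝ} (ht : t < T) : HasDerivAt (ta T) ((1 - t / T)⁻¹) t := by
  have h1 := sc_pos hT ht
  have d : HasDerivAt (fun t => 1 - t / T) (-(1 / T)) t := ((hasDerivAt_id t).div_const T).const_sub 1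
  have := (d.log h1.ne').const_mul (-T)
  refine this.congr_deriv ?_
  field_simp

lemma th_deriv (hT : 0 < T) {t : ℝ} (ht : t < T) :
    HasDerivAt (th m T) ((1 / (T * (m - 1))) * th m T t * (1 - t / T)⁻¹) t := by
  have h1 := sc_pos hT ht
  have d : HasDerivAt (fun t => 1 - t / T) (-(1 / T)) t := ((hasDerivAt_id t).div_const T).const_sub 1
  have := d.rpow_const (p := -(1 / (m - 1))) (Or.inl h1.ne')
  refine this.congr_deriv ?_
  rw [Real.rpow_sub_one h1.ne']
  unfold th
  simp only [one_div, mul_inv]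
  ring

lemma th_pow (hm : 1 < m) (hT : 0 < T) {t : ℝ} (ht : t < T) :
    th m T t ^ m = th m T t * (1 - t / T)⁻¹ := by
  have h1 := sc_pos hT ht
  have h2 : m - 1 ≠ 0 := by linarith
  unfold th
  rw [← Real.rpow_mul h1.le, ← Real.rpow_neg_one (1 - t / T), ← Real.rpow_add h1]
  congr 1
  field_simp
  ring

lemma th_top (hm : 1 < m) (hT : 0 < T) (M : ℝ) : ∃ δ, 0 < δ ∧ δ ≤ T ∧ ∀ t ∈ Ioo (T - δ) T, M ≤ th m T t := by
  have h2 : 0 < 1 / (m - 1) := by have : 0 < m - 1 := by linarith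
                                  positivity
  have h3 : Tendsto (fun y : ℝ => y ^ (-(1 / (m - 1)))) (𝓝[>] 0) atTop := tendsto_rpow_neg_nhdsGT_zero (by linarith)
  have := h3.eventually_ge_atTop M
  obtain ⟨η, hη, h⟩ := mem_nhdsGT_iff_exists_Ioo_subset.1 this
  refine ⟨min T (η * T), lt_min hT (mul_pos hη hT), min_le_left _ _, fun t ht => ?_⟩
  refine h ⟨sc_pos hT ht.2, ?_⟩
  have h5 : T - t < η * T := by have := ht.1; have := min_le_right T (η * T); linarith
  have h6 : 1 - t / T = (T - t) / T := by field_simp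
  rw [h6, div_lt_iff₀ hT]; exact h5
end scal

namespace Dat
variable {D : Dat N}

lemma ball_nm {R : ℝ} {f : Euc N → ℝ} (hf : Integrable (fun x => D.w x * |f x|)) :
    ∫ x in ball (0 : Euc N) R, |f x| * D.ρ x ≤ (1 + R ^ 2) ^ D.p * D.nm f := by
  have hi : Integrable (fun x => (1 + R ^ 2) ^ D.p * (D.w x * |f x|)) := hf.const_mul _
  have hR : 0 ≤ (1 + R ^ 2) ^ D.p := by positivity
  have hnn : ∀ᵐ x, 0 ≤ (1 + R ^ 2) ^ D.p * (D.w x * |f x|) := by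
    filter_upwards [D.wpos] with x hx
    exact mul_nonneg hR (mul_nonneg hx.le (abs_nonneg _))
  calc _ ≤ ∫ x in ball (0 : Euc N) R, (1 + R ^ 2) ^ D.p * (D.w x * |f x|) := by
        refine integral_mono_of_nonneg ?_ hi.integrableOn ?_
        · filter_upwards [ae_restrict_of_ae D.ρpos] with x hx
          exact mul_nonneg (abs_nonneg _) hx.le
        · filter_upwards [ae_restrict_of_ae D.ρpos, ae_restrict_mem measurableSet_ball] with x hx hb
          have h1 : sg x ≤ 1 + R ^ 2 := by
            rw [mem_ball_zero_iff] at hb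
            have := norm_nonneg x
            unfold sg; nlinarith
          have h2 : sg x ^ D.p ≤ (1 + R ^ 2) ^ D.p := Real.rpow_le_rpow (sg_pos x).le h1 D.hp.le
          have h3 : sg x ^ D.p * sg x ^ (-D.p) = 1 := by rw [← Real.rpow_add (sg_pos x)]; simp
          have h4 : 0 < sg x ^ (-D.p) := Real.rpow_pos_of_pos (sg_pos x) _
          have h5 : 1 ≤ (1 + R ^ 2) ^ D.p * sg x ^ (-D.p) := by
            have := mul_le_mul_of_nonneg_right h2 h4.le
            linarith
          have h6 : 0 ≤ |f x| * D.ρ x := mul_nonneg (abs_nonneg _) hx.le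
          calc |f x| * D.ρ x ≤ (|f x| * D.ρ x) * ((1 + R ^ 2) ^ D.p * sg x ^ (-D.p)) := le_mul_of_one_le_right h6 h5
            _ = _ := by simp only [w]; ring
    _ ≤ ∫ x, (1 + R ^ 2) ^ D.p * (D.w x * |f x|) := setIntegral_le_integral hi hnn
    _ = _ := by rw [integral_const_mul]; rfl

lemma orbit_hasDeriv {v : Euc N → ℝ → ℝ} {φ : Euc N → ℝ} {t0 A : ℝ} (h0 : 0 < t0)
    (h : ∀ ε > 0, ∃ δ > 0, ∀ t s, 0 ≤ t → t ≤ s → |t - t0| ≤ δ → |s - t0| ≤ δ →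
        |(∫ x, D.ρ x * v x s * φ x) - (∫ x, D.ρ x * v x t * φ x) - (s - t) * A| ≤ ε * (s - t)) :
    HasDerivAt (fun t => ∫ x, D.ρ x * v x t * φ x) A t0 := by
  rw [hasDerivAt_iff_isLittleO, Asymptotics.isLittleO_iff]
  intro ε hε
  obtain ⟨δ, hδ, H⟩ := h ε hε
  filter_upwards [Metric.ball_mem_nhds t0 hδ, lt_mem_nhds h0] with y hy hy0
  rw [Metric.mem_ball, Real.dist_eq] at hy
  rw [smul_eq_mul, Real.norm_eq_abs, Real.norm_eq_abs]
  rcases le_total t0 y with hc | hc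
  · have := H t0 y h0.le hc (by simp [hδ.le]) hy.le
    rwa [abs_of_nonneg (sub_nonneg.2 hc)]
  · have := H y t0 hy0.le hc hy.le (by simp [hδ.le])
    rw [abs_sub_comm y, abs_of_nonneg (sub_nonneg.2 hc), ← abs_neg]
    refine le_trans (le_of_eq ?_) this
    congr 1; ring

lemma nm_le_W {f : Euc N → ℝ} (hf : D.Rg f) : D.nm f ≤ D.nm D.W := by
  have h0 : Integrable (fun x => D.w x * |D.W x|) := by
    refine (RgW (D := D)).int.congr (ae_of_all _ fun x => ?_)
    simp only [abs_of_pos (D.Wpos x)]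
  refine integral_mono_of_nonneg ?_ h0 ?_
  · filter_upwards [D.wpos] with x hx using mul_nonneg hx.le (abs_nonneg _)
  · filter_upwards [D.wpos, hf.2] with x hx hb
    rw [abs_of_nonneg hb.1, abs_of_pos (D.Wpos x)]
    exact mul_le_mul_of_nonneg_left hb.2 hx.le

theorem mkCand {T : ℝ} (hT : 0 < T) (hc : D.c = 1 / (T * (D.m - 1))) {v : Euc N → ℝ → ℝ}
    (vm : Measurable (fun p : Euc N × ℝ => v p.1 p.2))
    (vb : ∀ t, 0 ≤ t → ∀ᵐ x, D.W1 x ≤ v x t ∧ v x t ≤ D.W x)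
    (vc : ∀ L, ∀ ε > 0, ∃ δ > 0, ∀ s t, 0 ≤ s → 0 ≤ t → s ≤ L → t ≤ L → |s - t| ≤ δ → D.nm (fun x => v x s - v x t) ≤ ε)
    (vd : ∀ φ, TF φ → ∀ t0, 0 ≤ t0 → ∀ ε > 0, ∃ δ > 0, ∀ t s, 0 ≤ t → t ≤ s → |t - t0| ≤ δ → |s - t0| ≤ δ →
        |(∫ x, D.ρ x * v x s * φ x) - (∫ x, D.ρ x * v x t * φ x) -
          (s - t) * ((∫ x, v x t0 ^ D.m * lap φ x) - D.c * ∫ x, D.ρ x * v x t0 * φ x)| ≤ ε * (s - t)) :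
    D.Cand T (th D.m T) (fun x t => th D.m T t * v x (ta T t)) := by
  have thm : Measurable (th D.m T) := by
    unfold th; fun_prop
  have tam : Measurable (ta T) := by
    unfold ta; fun_prop
  have vx : ∀ t, Measurable (fun x => v x t) := fun t => vm.comp (measurable_id.prodMk measurable_const)
  have rg : ∀ t, 0 ≤ t → D.Rg (fun x => v x t) := fun t ht => ⟨(vx t).aestronglyMeasurable, by
    filter_upwards [vb t ht] with x hx using ⟨(D.W1pos x).le.trans hx.1, hx.2⟩⟩
  constructor
  · exact hT
  · have m1 : Measurable (fun p : Euc N × ℝ => v p.1 (ta T p.2)) :=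
      vm.comp (measurable_fst.prodMk (tam.comp measurable_snd))
    exact (thm.comp measurable_snd).mul m1
  · exact fun t ht => th_pos hT ht.2
  · exact fun s hs t ht hst => th_mono D.hm hT ht.2 hst
  · intro t ht
    have h1 := th_pos (m := D.m) hT ht.2
    filter_upwards [(rg _ (ta_nonneg hT ht.1 ht.2)).2] with x hx
    exact ⟨mul_nonneg h1.le hx.1, mul_le_mul_of_nonneg_left hx.2 h1.le⟩
  · intro s hs R hR
    have ts0 := ta_nonneg hT hs.1 hs.2
    have ctm : Tendsto (th D.m T) (𝓝[Ico 0 T] s) (𝓝 (th D.m T s)) :=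
      (th_deriv hT hs.2).continuousAt.tendsto.mono_left nhdsWithin_le_nhds
    have cta : Tendsto (ta T) (𝓝[Ico 0 T] s) (𝓝 (ta T s)) :=
      (ta_deriv hT hs.2).continuousAt.tendsto.mono_left nhdsWithin_le_nhds
    have nm0 : ∀ f, 0 ≤ D.nm f := fun f => integral_nonneg_of_ae (by
      filter_upwards [D.wpos] with x hx using mul_nonneg hx.le (abs_nonneg _))
    have cn : Tendsto (fun t => D.nm (fun x => v x (ta T t) - v x (ta T s))) (𝓝[Ico 0 T] s) (𝓝 0) := by
      rw [Metric.tendsto_nhds]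
      intro ε hε
      obtain ⟨δ, hδ, H⟩ := vc (ta T s + 1) (ε / 2) (by positivity)
      filter_upwards [cta.eventually (Metric.ball_mem_nhds _ (lt_min hδ one_pos)), self_mem_nhdsWithin] with t ht ht2
      rw [Real.dist_eq] at ht
      have h1 := ht.trans_le (min_le_left _ _)
      have h2 := (abs_lt.1 (ht.trans_le (min_le_right _ _))).2
      have := H (ta T t) (ta T s) (ta_nonneg hT ht2.1 ht2.2) ts0 (by linarith) (by linarith) h1.le
      rw [Real.dist_eq, sub_zero, abs_of_nonneg (nm0 _)]
      linarith
    have lim : Tendsto (fun t => (1 + R ^ 2) ^ D.p * (th D.m T t * D.nm (fun x => v x (ta T t) - v x (ta T s)) +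
        |th D.m T t - th D.m T s| * D.nm D.W)) (𝓝[Ico 0 T] s) (𝓝 0) := by
      have := ((ctm.mul cn).add (((ctm.sub_const (th D.m T s)).abs).mul_const (D.nm D.W))).const_mul ((1 + R ^ 2) ^ D.p)
      simpa using this
    refine squeeze_zero' ?_ ?_ lim
    · refine Eventually.of_forall fun t => ?_
      refine integral_nonneg_of_ae ?_
      filter_upwards [ae_restrict_of_ae D.ρpos] with x hx using mul_nonneg (abs_nonneg _) hx.le
    · filter_upwards [self_mem_nhdsWithin] with t ht
      have r1 := rg _ (ta_nonneg hT ht.1 ht.2)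
      have r2 := rg _ ts0
      have hp := th_pos (m := D.m) hT ht.2
      have i1 := (subint r1 r2).const_mul (th D.m T t)
      have i2' : Integrable (fun x => D.w x * |v x (ta T s)|) := by
        refine r2.int.congr ?_
        filter_upwards [r2.2] with x hx
        rw [abs_of_nonneg hx.1]
      have i2 := i2'.const_mul |th D.m T t - th D.m T s|
      have pw : ∀ᵐ x, D.w x * |th D.m T t * v x (ta T t) - th D.m T s * v x (ta T s)| ≤
          th D.m T t * (D.w x * |v x (ta T t) - v x (ta T s)|) + |th D.m T t - th D.m T s| * (D.w x * |v x (ta T s)|) := by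
        filter_upwards [D.wpos] with x hx
        have e : th D.m T t * v x (ta T t) - th D.m T s * v x (ta T s) =
          th D.m T t * (v x (ta T t) - v x (ta T s)) + (th D.m T t - th D.m T s) * v x (ta T s) := by ring
        have h := abs_add_le (th D.m T t * (v x (ta T t) - v x (ta T s))) ((th D.m T t - th D.m T s) * v x (ta T s))
        rw [abs_mul, abs_mul, abs_of_pos hp] at h
        rw [e]
        calc _ ≤ D.w x * (th D.m T t * |v x (ta T t) - v x (ta T s)| + |th D.m T t - th D.m T s| * |v x (ta T s)|) :=
              mul_le_mul_of_nonneg_left h hx.le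
          _ = _ := by ring
      have i3 : Integrable (fun x => D.w x * |th D.m T t * v x (ta T t) - th D.m T s * v x (ta T s)|) := by
        refine (i1.add i2).mono' ?_ ?_
        · exact (D.wmeas.mul (measurable_abs.comp (((vx _).const_mul _).sub ((vx _).const_mul _)))).aestronglyMeasurable
        · filter_upwards [pw, D.wpos] with x h1 h2
          rw [Real.norm_of_nonneg (mul_nonneg h2.le (abs_nonneg _))]
          exact h1
      refine (ball_nm i3).trans ?_
      refine mul_le_mul_of_nonneg_left ?_ (by positivity)
      have := integral_mono_ae i3 (i1.add i2) pw
      have e2 := integral_add i1 i2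
      simp only [Pi.add_apply] at this
      rw [e2, integral_const_mul, integral_const_mul] at this
      refine le_trans this ?_
      have h9 := nm_le_W r2
      unfold nm at h9 ⊢
      gcongr
  · intro t ht φ hφ
    have tp := ta_pos hT ht.1 ht.2
    have hp := th_pos (m := D.m) hT ht.2
    have d1 := orbit_hasDeriv tp (vd φ hφ _ tp.le)
    have d2 := d1.comp t (ta_deriv hT ht.2)
    have d3 := (th_deriv (m := D.m) hT ht.2).mul d2
    have e1 : (fun s => ∫ x, D.ρ x * (th D.m T s * v x (ta T s)) * φ x) =
        (th D.m T) * ((fun t => ∫ x, D.ρ x * v x t * φ x) ∘ ta T) := by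
      funext s
      simp only [Pi.mul_apply, Function.comp]
      rw [← integral_const_mul]
      exact integral_congr_ae (ae_of_all _ fun x => by simp only; ring)
    have e2 : ∫ x, (th D.m T t * v x (ta T t)) ^ D.m * lap φ x =
        th D.m T t ^ D.m * ∫ x, v x (ta T t) ^ D.m * lap φ x := by
      rw [← integral_const_mul]
      refine integral_congr_ae ?_
      filter_upwards [(rg _ tp.le).2] with x hx
      rw [Real.mul_rpow hp.le hx.1]; ring
    rw [e1, e2]
    refine d3.congr_deriv ?_
    rw [th_pow D.hm hT ht.2, ← hc]
    simp only [Function.comp]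
    ring

/-- final existence statement in terms of the data -/
theorem final {T : ℝ} (hT : 0 < T) (hc : D.c = 1 / (T * (D.m - 1))) {u0 : Euc N → ℝ}
    (hm : AEStronglyMeasurable u0 volume) (hu : ∀ᵐ x, D.W1 x ≤ u0 x ∧ u0 x ≤ D.W x) :
    ∃ u : Euc N → ℝ → ℝ, D.Cand T (th D.m T) u ∧ (∀ᵐ x, u x 0 = u0 x) ∧
      ∀ᵐ p : Euc N × ℝ, p.2 ∈ Ioo 0 T → th D.m T p.2 * D.W1 p.1 ≤ u p.1 p.2 ∧ u p.1 p.2 ≤ th D.m T p.2 * D.W p.1 := by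
  obtain ⟨v, vm, v0, vb, vc, vd⟩ := orbit hm hu
  have H := mkCand hT hc vm vb vc vd
  refine ⟨_, H, ?_, ?_⟩
  · filter_upwards [v0] with x hx
    rw [th_zero, ta_zero, one_mul, hx]
  · have thm : Measurable (th D.m T) := by
      unfold th; fun_prop
    have m1 : MeasurableSet {p : Euc N × ℝ | p.2 ∈ Ioo 0 T} := measurable_snd measurableSet_Ioo
    have m2 := measurableSet_le ((thm.comp measurable_snd).mul (D.W1m.comp measurable_fst)) H.um
    have m3 := measurableSet_le H.um ((thm.comp measurable_snd).mul (D.Wm.comp measurable_fst))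
    refine ae_prod (P := fun p => p.2 ∈ Ioo 0 T → th D.m T p.2 * D.W1 p.1 ≤ th D.m T p.2 * v p.1 (ta T p.2) ∧
      th D.m T p.2 * v p.1 (ta T p.2) ≤ th D.m T p.2 * D.W p.1) ?_ fun t => ?_
    · convert m1.compl.union (m2.inter m3) using 1
      ext p
      simp only [mem_ofPred_eq, mem_union, mem_compl_iff, mem_inter_iff, Pi.mul_apply, Function.comp]
      tauto
    · by_cases ht : t ∈ Ioo 0 T
      · filter_upwards [vb _ (ta_nonneg hT ht.1.le ht.2)] with x hx _
        have hp := th_pos (m := D.m) hT ht.2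
        exact ⟨mul_le_mul_of_nonneg_left hx.1 hp.le, mul_le_mul_of_nonneg_left hx.2 hp.le⟩
      · exact ae_of_all _ fun x h => absurd h ht
end Dat
end Blow

end

end

section
open MeasureTheory Metric Filter Set ENNReal
open scoped Topology ContDiff
noncomputable section
namespace Blow
variable {N : ℕ}

lemma growth {m γ : ℝ} (hm : 1 < m) (hγ2 : γ < 2) {W : Euc N → ℝ} (hW : memXinf m γ W) :
    ∃ C, 0 ≤ C ∧ ∀ᵐ x, W x ≤ C * sg x ^ (((2 - γ) / (m - 1)) / 2) := by
  obtain ⟨-, hfin, B, hB⟩ := hW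
  set s := (2 - γ) / (m - 1) with hs
  have hs0 : 0 < s := div_pos (by linarith) (by linarith)
  have hb : ∀ n : ℕ, ∀ᵐ x, x ∈ ball (0 : Euc N) ((n : ℝ) + 1) → W x ≤ B * ((n : ℝ) + 1) ^ s := by
    intro n
    have hn : (0 : ℝ) < (n : ℝ) + 1 := by positivity
    have h1 := hB ⟨(n : ℝ) + 1, by simp, rfl⟩
    simp only at h1
    rw [Real.rpow_neg hn.le, inv_mul_le_iff₀ (Real.rpow_pos_of_pos hn _)] at h1
    have h2 := ae_le_eLpNormEssSup (f := W) (μ := volume.restrict (ball (0 : Euc N) ((n : ℝ) + 1)))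
    rw [ae_restrict_iff' measurableSet_ball] at h2
    filter_upwards [h2] with x hx hxb
    have h3 := hx hxb
    rw [← eLpNorm_exponent_top] at h3
    have h4 := ENNReal.toReal_mono (hfin _ hn).ne h3
    rw [toReal_enorm] at h4
    calc W x ≤ ‖W x‖ := le_abs_self _
      _ ≤ _ := h4
      _ ≤ _ := h1
      _ = _ := mul_comm _ _
  have hB0 : 0 ≤ B := by
    refine le_trans ?_ (hB ⟨1, by simp, rfl⟩)
    simp
  refine ⟨B * 9 ^ (s / 2), by positivity, ?_⟩
  filter_upwards [ae_all_iff.2 hb] with x hx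
  have h1 : ‖x‖ ≤ ⌈‖x‖⌉₊ := Nat.le_ceil _
  have h2 : (⌈‖x‖⌉₊ : ℝ) < ‖x‖ + 1 := Nat.ceil_lt_add_one (norm_nonneg _)
  refine (hx ⌈‖x‖⌉₊ (by rw [mem_ball_zero_iff]; linarith)).trans ?_
  rw [mul_assoc]
  refine mul_le_mul_of_nonneg_left ?_ hB0
  rw [← Real.mul_rpow (by norm_num) (sg_pos x).le]
  have h3 : ((⌈‖x‖⌉₊ : ℝ) + 1) ^ s = (((⌈‖x‖⌉₊ : ℝ) + 1) ^ (2:ℝ)) ^ (s / 2) := by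
    rw [← Real.rpow_mul (by positivity)]; congr 1; ring
  rw [h3]
  refine Real.rpow_le_rpow (by positivity) ?_ (by positivity)
  rw [Real.rpow_two]
  have := norm_nonneg x
  unfold sg
  have h5 : ((⌈‖x‖⌉₊ : ℝ) + 1) ≤ ‖x‖ + 2 := by linarith
  have h6 : (0:ℝ) ≤ (⌈‖x‖⌉₊ : ℝ) + 1 := by positivity
  nlinarith [sq_nonneg (‖x‖ - 1)]

lemma rho_low {γ k K : ℝ} (hγ0 : 0 ≤ γ) (hk : 0 < k) {ρ : Euc N → ℝ} (hρ : WeightCond N γ k K ρ) :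
    ∃ κ, 0 < κ ∧ ∀ᵐ x, sg x ^ (-(γ / 2)) ≤ κ * ρ x := by
  refine ⟨2 ^ (γ / 2) / k, by positivity, ?_⟩
  filter_upwards [hρ.2] with x hx
  have h0 := norm_nonneg x
  have h1 : (2 * sg x) ^ (-(γ / 2)) ≤ (1 + ‖x‖) ^ (-γ) := by
    have : (1 + ‖x‖) ^ (-γ) = ((1 + ‖x‖) ^ (2:ℝ)) ^ (-(γ / 2)) := by
      rw [← Real.rpow_mul (by positivity)]; congr 1; ring
    rw [this]
    refine Real.rpow_le_rpow_of_nonpos (by positivity) ?_ (by linarith)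
    rw [Real.rpow_two]; unfold sg; nlinarith [sq_nonneg (‖x‖ - 1)]
  rw [Real.mul_rpow (by norm_num) (sg_pos x).le] at h1
  have h2 : (2:ℝ) ^ (γ / 2) * 2 ^ (-(γ / 2)) = 1 := by rw [← Real.rpow_add (by norm_num)]; simp
  have h3 : (0:ℝ) < 2 ^ (γ / 2) := by positivity
  calc sg x ^ (-(γ / 2)) = (2:ℝ) ^ (γ / 2) * (2 ^ (-(γ / 2)) * sg x ^ (-(γ / 2))) := by rw [← mul_assoc, h2, one_mul]
    _ ≤ 2 ^ (γ / 2) * (1 + ‖x‖) ^ (-γ) := by gcongr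
    _ = 2 ^ (γ / 2) / k * (k * (1 + ‖x‖) ^ (-γ)) := by field_simp
    _ ≤ _ := by gcongr; exact hx.1

lemma rho_pos {γ k K : ℝ} (hk : 0 < k) {ρ : Euc N → ℝ} (hρ : WeightCond N γ k K ρ) : ∀ᵐ x, 0 < ρ x := by
  filter_upwards [hρ.2] with x hx
  have h0 := norm_nonneg x
  exact lt_of_lt_of_le (mul_pos hk (Real.rpow_pos_of_pos (by positivity) _)) hx.1

lemma rho_loc (hN : 3 ≤ N) {γ k K : ℝ} (hγ2 : γ < 2) (hk : 0 < k) {ρ : Euc N → ℝ} (hρ : WeightCond N γ k K ρ) :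
    LocallyIntegrable ρ := by
  have hN' : (3 : ℝ) ≤ N := by exact_mod_cast hN
  have fr : Module.finrank ℝ (Euc N) = N := by simp [Euc]
  refine locallyIntegrable_of_norm_le_rpow (C := K) (α := γ) (by rw [fr]; omega) (by rw [fr]; linarith) ?_ hρ.1.aestronglyMeasurable
  filter_upwards [hρ.2, rho_pos hk hρ] with x hx h0
  rw [Real.norm_of_nonneg h0.le]; exact hx.2

lemma rho_int (hN : 3 ≤ N) {γ k K : ℝ} (hγ0 : 0 ≤ γ) (hγ2 : γ < 2) (hk : 0 < k) (hkK : k ≤ K) {ρ : Euc N → ℝ}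
    (hρ : WeightCond N γ k K ρ) : Integrable (fun x => ρ x * sg x ^ (-((N : ℝ) / 2 + 1))) := by
  have fr : Module.finrank ℝ (Euc N) = N := by simp [Euc]
  have i1 : Integrable ((ball (0 : Euc N) 1).indicator ρ) :=
    (integrable_indicator_iff measurableSet_ball).2
      (((rho_loc hN hγ2 hk hρ).integrableOn_isCompact (isCompact_closedBall 0 1)).mono_set ball_subset_closedBall)
  have i2 : Integrable (fun x : Euc N => K * sg x ^ (-((N : ℝ) / 2 + 1))) := by
    have := integrable_rpow_neg_one_add_norm_sq (E := Euc N) (μ := volume) (r := (N : ℝ) + 2) (by rw [fr]; linarith)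
    refine Integrable.const_mul ?_ K
    refine this.congr (ae_of_all _ fun x => ?_)
    simp only [sg]
    congr 1; ring
  refine (i1.add i2).mono' (hρ.1.mul (sgpow_cont _).measurable).aestronglyMeasurable ?_
  filter_upwards [hρ.2, rho_pos hk hρ] with x hx h0
  have h1 : 0 < sg x ^ (-((N : ℝ) / 2 + 1)) := Real.rpow_pos_of_pos (sg_pos x) _
  have h2 : sg x ^ (-((N : ℝ) / 2 + 1)) ≤ 1 := Real.rpow_le_one_of_one_le_of_nonpos (sg_one x) (by
    have : (0:ℝ) ≤ N := by positivity
    linarith)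
  have hK : 0 < K := hk.trans_le hkK
  rw [Real.norm_of_nonneg (mul_nonneg h0.le h1.le), Pi.add_apply]
  by_cases hb : x ∈ ball (0 : Euc N) 1
  · rw [indicator_of_mem hb]
    have := mul_le_mul_of_nonneg_left h2 h0.le
    have := mul_pos hK h1
    linarith
  · rw [indicator_of_notMem hb, zero_add]
    refine mul_le_mul_of_nonneg_right (hx.2.trans ?_) h1.le
    rw [mem_ball_zero_iff, not_lt] at hb
    have := Real.rpow_le_one_of_one_le_of_nonpos hb (by linarith : -γ ≤ 0)
    nlinarith

theorem mkDat (N : ℕ) (hN : 3 ≤ N) (m γ k K T : ℝ)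
    (hm : 1 < m) (hγ0 : 0 ≤ γ) (hγ2 : γ < 2) (hk : 0 < k) (hkK : k ≤ K) (hT : 0 < T)
    (ρ : Euc N → ℝ) (hρ : WeightCond N γ k K ρ)
    (W₁ W₂ : Euc N → ℝ)
    (hW₁meas : Measurable W₁) (hW₂meas : Measurable W₂)
    (hW₁pos : ∀ x, 0 < W₁ x) (hW₂pos : ∀ x, 0 < W₂ x)
    (hW₂inf : memXinf m γ W₂)
    (hord : ∀ᵐ x : Euc N ∂volume, W₁ x ≤ W₂ x)
    (hW₁eq : ∀ φ : Euc N → ℝ, ContDiff ℝ (⊤ : ℕ∞) φ → HasCompactSupport φ →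
      ∫ x : Euc N, W₁ x ^ m * lap φ x =
        (1 / (T * (m - 1))) * ∫ x : Euc N, ρ x * W₁ x * φ x)
    (hW₂eq : ∀ φ : Euc N → ℝ, ContDiff ℝ (⊤ : ℕ∞) φ → HasCompactSupport φ →
      ∫ x : Euc N, W₂ x ^ m * lap φ x =
        (1 / (T * (m - 1))) * ∫ x : Euc N, ρ x * W₂ x * φ x) :
    ∃ D : Dat N, D.m = m ∧ D.c = 1 / (T * (m - 1)) ∧ D.ρ = ρ ∧ D.W = W₂ ∧ D.W1 = W₁ := by
  have hm1 : 0 < m - 1 := by linarith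
  obtain ⟨C, hC0, hC⟩ := growth hm hγ2 hW₂inf
  obtain ⟨κ, hκ0, hκ⟩ := rho_low hγ0 hk hρ
  set s := (2 - γ) / (m - 1) with hs
  have hs0 : 0 < s := div_pos (by linarith) hm1
  have hsm : s * (m - 1) = 2 - γ := by rw [hs]; field_simp
  have hrp := rho_pos hk hρ
  have pull : ∀ (W φ : Euc N → ℝ) (c : ℝ), c * ∫ x, ρ x * W x * φ x = ∫ x, ρ x * (c * W x) * φ x := by
    intro W φ c
    rw [← integral_const_mul]
    exact integral_congr_ae (ae_of_all _ fun x => by simp only; ring)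
  refine ⟨{
    m := m, c := 1 / (T * (m - 1)), p := s / 2 + ((N : ℝ) / 2 + 1), Cr := κ, C1 := C ^ (m - 1) * κ, ρ := ρ, W := W₂, W1 := W₁,
    hN := hN, hm := hm, hc := by positivity, hp := by positivity, hC1 := by positivity, ρm := hρ.1, ρpos := hrp,
    ρloc := rho_loc hN hγ2 hk hρ, ρinv := ?_, Wm := hW₂meas, W1m := hW₁meas, Wpos := hW₂pos, W1pos := hW₁pos, hord := hord,
    Wpow := ?_, Wint := ?_, Wloc := ?_, Weq := ?_, W1eq := ?_ }, rfl, rfl, rfl, rfl, rfl⟩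
  · filter_upwards [hκ] with x hx
    have h1 : 1 ≤ sg x * sg x ^ (-(γ / 2)) := by
      rw [mul_comm, ← Real.rpow_add_one (sg_pos x).ne']
      exact Real.one_le_rpow (sg_one x) (by linarith)
    have h2 := mul_le_mul_of_nonneg_left hx (sg_pos x).le
    calc 1 ≤ _ := h1
      _ ≤ _ := h2
      _ = _ := by ring
  · filter_upwards [hκ, hC] with x hx hc
    have h1 : W₂ x ^ (m - 1) ≤ C ^ (m - 1) * (sg x * sg x ^ (-(γ / 2))) := by
      refine (Real.rpow_le_rpow (hW₂pos x).le hc hm1.le).trans (le_of_eq ?_)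
      rw [Real.mul_rpow hC0 (Real.rpow_nonneg (sg_pos x).le _), ← Real.rpow_mul (sg_pos x).le, mul_comm (sg x),
        ← Real.rpow_add_one (sg_pos x).ne']
      congr 2
      linarith
    refine h1.trans ?_
    have h2 := mul_le_mul_of_nonneg_left hx (sg_pos x).le
    calc _ ≤ C ^ (m - 1) * (sg x * (κ * ρ x)) := by gcongr
      _ = _ := by ring
  · refine ((rho_int hN hγ0 hγ2 hk hkK hρ).const_mul C).mono'
      ((hρ.1.mul (sgpow_cont _).measurable).mul hW₂meas).aestronglyMeasurable ?_
    filter_upwards [hrp, hC] with x h0 hc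
    have h1 : 0 < sg x ^ (-(s / 2 + ((N : ℝ) / 2 + 1))) := Real.rpow_pos_of_pos (sg_pos x) _
    have h2 := hW₂pos x
    rw [Real.norm_of_nonneg (by positivity)]
    calc _ ≤ ρ x * sg x ^ (-(s / 2 + ((N : ℝ) / 2 + 1))) * (C * sg x ^ (s / 2)) := by gcongr
      _ = C * (ρ x * (sg x ^ (-(s / 2 + ((N : ℝ) / 2 + 1))) * sg x ^ (s / 2))) := by ring
      _ = _ := by
        rw [← Real.rpow_add (sg_pos x)]
        congr 3; ring
  · intro R
    refine ⟨C * (1 + R ^ 2) ^ (s / 2), ?_⟩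
    filter_upwards [hC] with x hc hb
    refine hc.trans (mul_le_mul_of_nonneg_left (Real.rpow_le_rpow (sg_pos x).le ?_ (by positivity)) hC0)
    rw [mem_ball_zero_iff] at hb
    have := norm_nonneg x
    unfold sg; nlinarith
  · intro φ hφ
    rw [hW₂eq φ hφ.1 hφ.2, pull]
  · intro φ hφ
    rw [hW₁eq φ hφ.1 hφ.2, pull]

lemma ts_eq {T : ℝ} (hT : 0 < T) : TimeSet (ENNReal.ofReal T) = Ioo 0 T := by
  ext t
  simp only [TimeSet, mem_ofPred_eq, mem_Ioo, ENNReal.ofReal_lt_ofReal_iff hT]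

lemma ts0_eq {T : ℝ} (hT : 0 < T) : TimeSet0 (ENNReal.ofReal T) = Ico 0 T := by
  ext t
  simp only [TimeSet0, mem_ofPred_eq, mem_Ico, ENNReal.ofReal_lt_ofReal_iff hT]

lemma Dat.Cand.sol {D : Dat N} {T : ℝ} {θ : ℝ → ℝ} {u : Euc N → ℝ → ℝ} {u0 : Euc N → ℝ} (H : D.Cand T θ u)
    (h0 : ∀ᵐ x, u x 0 = u0 x) : IsVeryWeakSol D.ρ D.m (ENNReal.ofReal T) u u0 := by
  unfold IsVeryWeakSol
  rw [ts_eq H.hT, ts0_eq H.hT]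
  refine ⟨fun t ht => ?_, H.uc, h0, fun R _ a b ha hab hb => H.int4 ha hab ((ENNReal.ofReal_lt_ofReal_iff H.hT).1 hb),
    fun φ h1 h2 h3 => H.weak ⟨h1, h2⟩ fun p hp => h3 hp⟩
  intro R _
  refine (((H.uloc ht).integrableOn_isCompact (isCompact_closedBall 0 R)).mono_set ball_subset_closedBall).abs.congr ?_
  filter_upwards [ae_restrict_of_ae D.ρpos] with x hx
  rw [abs_mul, abs_of_pos hx, mul_comm]

lemma swap_ae {P : Euc N × ℝ → Prop} (h : ∀ᵐ p : Euc N × ℝ, P p) : ∀ᵐ x : Euc N, ∀ᵐ t : ℝ, P (x, t) := by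
  rw [Measure.volume_eq_prod] at h
  exact Measure.ae_ae_of_ae_prod h
end Blow
end

end

open MeasureTheory Metric Filter Set ENNReal in
/-- **Blow-up** (Theorem 2.8 of Muratori–Petitt): if `W₁ ≤ u₀ ≤ W₂` with `W₁, W₂ ∈ X_∞`
positive solutions of `Δ(W^m) = ρ W/(T(m-1))`, then there is a very weak solution with
initial datum `u₀`, sandwiched between the separable solutions
`(1-t/T)^{-1/(m-1)} Wᵢ(x)`, which blows up pointwise (in the essential sense) at `t = T`. -/
theorem blowup_theorem
    (N : ℕ) (hN : 3 ≤ N) (m γ k K T : ℝ)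
    (hm : 1 < m) (hγ0 : 0 ≤ γ) (hγ2 : γ < 2) (hk : 0 < k) (hkK : k ≤ K) (hT : 0 < T)
    (ρ : Euc N → ℝ) (hρ : WeightCond N γ k K ρ)
    (W₁ W₂ : Euc N → ℝ)
    (hW₁meas : Measurable W₁) (hW₂meas : Measurable W₂)
    (hW₁pos : ∀ x, 0 < W₁ x) (hW₂pos : ∀ x, 0 < W₂ x)
    (hW₁inf : memXinf m γ W₁) (hW₂inf : memXinf m γ W₂)
    (hW₁loc : LocInt1 ρ W₁) (hW₂loc : LocInt1 ρ W₂)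
    (hord : ∀ᵐ x : Euc N ∂volume, W₁ x ≤ W₂ x)
    (hW₁eq : ∀ φ : Euc N → ℝ, ContDiff ℝ (⊤ : ℕ∞) φ → HasCompactSupport φ →
      ∫ x : Euc N, W₁ x ^ m * lap φ x =
        (1 / (T * (m - 1))) * ∫ x : Euc N, ρ x * W₁ x * φ x)
    (hW₂eq : ∀ φ : Euc N → ℝ, ContDiff ℝ (⊤ : ℕ∞) φ → HasCompactSupport φ →
      ∫ x : Euc N, W₂ x ^ m * lap φ x =
        (1 / (T * (m - 1))) * ∫ x : Euc N, ρ x * W₂ x * φ x)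
    (u₀ : Euc N → ℝ) (hu₀meas : Measurable u₀)
    (hu₀ : ∀ᵐ x : Euc N ∂volume, W₁ x ≤ u₀ x ∧ u₀ x ≤ W₂ x) :
    ∃ u : Euc N → ℝ → ℝ,
      IsVeryWeakSol ρ m (ENNReal.ofReal T) u u₀ ∧
      (∀ᵐ p : Euc N × ℝ
          ∂(volume.restrict ((univ : Set (Euc N)) ×ˢ Ioo (0 : ℝ) T)),
        (1 - p.2 / T) ^ (-(1 / (m - 1))) * W₁ p.1 ≤ u p.1 p.2 ∧
          u p.1 p.2 ≤ (1 - p.2 / T) ^ (-(1 / (m - 1))) * W₂ p.1) ∧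
      (∀ᵐ x : Euc N ∂volume, ∀ M : ℝ, ∃ δ : ℝ, 0 < δ ∧
        ∀ᵐ t ∂(volume : Measure ℝ), t ∈ Ioo (T - δ) T → M ≤ u x t) := by
  obtain ⟨D, rfl, hDc, rfl, rfl, rfl⟩ := Blow.mkDat N hN m γ k K T hm hγ0 hγ2 hk hkK hT ρ hρ W₁ W₂
    hW₁meas hW₂meas hW₁pos hW₂pos hW₂inf hord hW₁eq hW₂eq
  obtain ⟨u, H, h0, hb⟩ := Blow.Dat.final hT hDc hu₀meas.aestronglyMeasurable hu₀
  refine ⟨u, H.sol h0, ?_, ?_⟩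
  · rw [ae_restrict_iff' (MeasurableSet.univ.prod measurableSet_Ioo)]
    filter_upwards [hb] with p hp hp2
    exact hp hp2.2
  · filter_upwards [Blow.swap_ae hb] with x hx M
    obtain ⟨δ, hδ, hδT, h⟩ := Blow.th_top hm hT (M / D.W1 x)
    refine ⟨δ, hδ, ?_⟩
    filter_upwards [hx] with t ht htt
    have h1 := h t htt
    rw [div_le_iff₀ (D.W1pos x)] at h1
    exact h1.trans (ht ⟨by linarith [htt.1], htt.2⟩).1
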